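/- Let W=(w_{ij}) be a nonnegative real m×n matrix, let R_1,…,R_p be positive integer m-vectors and C_1,…,C_p be positive integer n-vectors with |R_1|=…=|R_p|=|C_1|=…=|C_p|=N, and let α_1,…,α_p ≥ 0 satisfy α_1+…+α_p=1. Suppose R = Σ_{k=1}^p α_k R_k and C = Σ_{k=1}^p α_k C_k are again positive integer vectors. Set a = min{m,n} and s = N/a. Then (N^N/N!) · (Γ(s+1)^a / s^N) · T(R,C;W) ≥ ∏_{k=1}^p T(R_k,C_k;W)^{α_k}, where Γ is the Gamma function. -/

import Mathlib

open scoped BigOperators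

/-- The total weight `T(R,C;W)` of contingency tables with row sums `R`,
column sums `C`, and weight `∏ W i j ^ D i j` (with the convention `0 ^ 0 = 1`). -/
noncomputable def tableWeight {m n : ℕ} (R : Fin m → ℕ) (C : Fin n → ℕ)
    (W : Fin m → Fin n → ℝ) : ℝ :=
  ∑' D : {D : Fin m → Fin n → ℕ //
      (∀ i, ∑ j, D i j = R i) ∧ (∀ j, ∑ i, D i j = C j)},
    ∏ i, ∏ j, W i j ^ D.1 i j

section

open Set MeasureTheory intervalIntegral Filter Topology

theorem hasDerivAt_primitive {f : ℝ → ℝ} {A : ℝ} (hf : ContinuousOn f (Icc 0 A)) {s : ℝ}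
    (hs : s ∈ Ioo 0 A) : HasDerivAt (fun u => ∫ v in (0:ℝ)..u, f v) (f s) s := by
  have hA : (0:ℝ) ≤ A := hs.1.le.trans hs.2.le
  have hsub : uIcc 0 s ⊆ Icc 0 A := by
    rw [uIcc_of_le hs.1.le]; exact Icc_subset_Icc_right hs.2.le
  refine integral_hasDerivAt_right ((hf.mono hsub).intervalIntegrable) ?_ ?_
  · exact (hf.mono Ioo_subset_Icc_self).stronglyMeasurableAtFilter isOpen_Ioo s hs
  · exact hf.continuousAt (Icc_mem_nhds hs.1 hs.2)

theorem continuousOn_primitive_Icc {f : ℝ → ℝ} {A : ℝ} (hA : 0 ≤ A)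
    (hf : ContinuousOn f (Icc 0 A)) :
    ContinuousOn (fun u => ∫ v in (0:ℝ)..u, f v) (Icc 0 A) := by
  have := intervalIntegral.continuousOn_primitive_interval (a := 0) (b := A) (μ := volume)
    (f := f) ?_
  · rwa [uIcc_of_le hA] at this
  · rw [uIcc_of_le hA]; exact hf.integrableOn_Icc

theorem integral_le_integral_add_of_hasDerivAt {f g B B' : ℝ → ℝ} {A : ℝ} (hA : 0 ≤ A)
    (hf : ContinuousOn f (Icc 0 A)) (hg : ContinuousOn g (Icc 0 A))
    (hB : ContinuousOn B (Icc 0 A)) (hB' : ContinuousOn B' (Icc 0 A))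
    (hd : ∀ s ∈ Ioo 0 A, HasDerivAt B (B' s) s)
    (hle : ∀ s ∈ Ioo 0 A, f s ≤ g s + B' s) :
    ∫ s in (0:ℝ)..A, f s ≤ (∫ s in (0:ℝ)..A, g s) + (B A - B 0) := by
  have hi : ∀ {h : ℝ → ℝ}, ContinuousOn h (Icc 0 A) → IntervalIntegrable h volume 0 A := by
    intro h hh; apply ContinuousOn.intervalIntegrable; rwa [uIcc_of_le hA]
  rw [← integral_eq_sub_of_hasDerivAt_of_le hA hB hd (hi hB'), ← integral_add (hi hg) (hi hB')]
  exact integral_mono_on_of_le_Ioo hA (hi hf) ((hi hg).add (hi hB')) hle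

theorem lift_identity (p x q dq h r ρ Q : ℝ) (hx : x ≠ 0) (hh : h ≠ 0) (hr : r + 1 ≠ 0) :
    p * (2 * ρ * q / x - dq ^ 2 - r * q ^ 2 / x ^ 2) =
      p * (ρ / (r + 1)) ^ 2
      + p * h / (r + 1) * (2 * ρ * Q / h - ((r + 1) * (q - Q) / h) ^ 2 - (r + 1) * Q ^ 2 / h ^ 2)
      - p * ((dq - q / h - (q - Q) + ρ / (r + 1)) ^ 2 + r * (1 / h - 1 / x) ^ 2 * q ^ 2
          + 2 * (1 / h - 1 / x) * q * (ρ / (r + 1)) + r * (1 / h - 1 / x) * (q - Q) ^ 2)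
      + (p * (r / x - 1) * (-q ^ 2 / h - (q - Q) ^ 2 + 2 * q * (ρ / (r + 1)))
        + p * (-(2 * q * dq) / h + q ^ 2 * ((r + 1) - r * h / x) / h ^ 2
            - 2 * (q - Q) * (dq - (r + 1) * (q - Q) / h) + 2 * dq * (ρ / (r + 1)))) := by
  field_simp
  ring

/-- Data on `[0, A]` for the weighted Poincaré-type functional: a weight `w` of logarithmic
derivative `r / x` with `x' ≥ 1`, and a test function `q` with derivative `dq`. -/
structure KernelData (A r M : ℝ) (w x q dq : ℝ → ℝ) : Prop where
  rpos : 0 < r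
  cw : ContinuousOn w (Icc 0 A)
  cx : ContinuousOn x (Icc 0 A)
  cq : ContinuousOn q (Icc 0 A)
  cdq : ContinuousOn dq (Icc 0 A)
  wpos : ∀ s ∈ Icc 0 A, 0 < w s
  xpos : ∀ s ∈ Icc 0 A, 0 < x s
  qnonneg : ∀ s ∈ Icc 0 A, 0 ≤ q s
  q0 : q 0 = 0
  dw : ∀ s ∈ Ioo 0 A, HasDerivAt w (r * w s / x s) s
  dx : ∀ s ∈ Ioo 0 A, ∃ d, 1 ≤ d ∧ HasDerivAt x d s
  dq : ∀ s ∈ Ioo 0 A, HasDerivAt q (dq s) s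
  growth : ∀ s ∈ Icc 0 A, w s * q s ≤ M * Real.exp (s / 2)

/-- The functional controlled by `KernelData`. -/
noncomputable def kernelFunctional (A r ρ : ℝ) (w x q dq : ℝ → ℝ) : ℝ :=
  ∫ s in (0:ℝ)..A, w s * Real.exp (-s) * (2 * ρ * q s / x s - dq s ^ 2 - r * q s ^ 2 / x s ^ 2)

/-- The mass of the weight `w` against the exponential density on `[0, A]`. -/
noncomputable def kernelMass (A : ℝ) (w : ℝ → ℝ) : ℝ := ∫ s in (0:ℝ)..A, w s * Real.exp (-s)

theorem KernelData.lift {A r M ρ c : ℝ} {w x q dq : ℝ → ℝ} (H : KernelData A r M w x q dq)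
    (hA : 0 < A) (hρ : 0 ≤ ρ) (hc : 0 < c) (hc' : (r + 1) * c ≤ w 0 * x 0) :
    ∃ w' x' q' dq' : ℝ → ℝ, KernelData A (r + 1) (2 * M) w' x' q' dq' ∧
      kernelMass A w' ≤ c + kernelMass A w ∧
      kernelFunctional A r ρ w x q dq ≤ (ρ / (r + 1)) ^ 2 * kernelMass A w +
        kernelFunctional A (r + 1) ρ w' x' q' dq' + 2 * ρ * M * Real.exp (-A / 2) := by
  have hr := H.rpos
  have hr1 : 0 < r + 1 := by linarith
  have hIoo : Ioo 0 A ⊆ Icc 0 A := Ioo_subset_Icc_self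
  have h0 : (0:ℝ) ∈ Icc 0 A := ⟨le_rfl, hA.le⟩
  have hAm : A ∈ Icc 0 A := ⟨hA.le, le_rfl⟩
  have hi : ∀ {h : ℝ → ℝ}, ContinuousOn h (Icc 0 A) → ∀ s ∈ Icc 0 A,
      IntervalIntegrable h volume 0 s := by
    intro h hh s hs; apply ContinuousOn.intervalIntegrable; rw [uIcc_of_le hs.1]
    exact hh.mono (Icc_subset_Icc_right hs.2)
  obtain ⟨F, hF⟩ : ∃ f : ℝ → ℝ, f = fun u => ∫ v in (0:ℝ)..u, w v := ⟨_, rfl⟩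
  obtain ⟨K, hK⟩ : ∃ f : ℝ → ℝ, f = fun u => ∫ v in (0:ℝ)..u, w v * q v := ⟨_, rfl⟩
  have cwq : ContinuousOn (fun v => w v * q v) (Icc 0 A) := H.cw.mul H.cq
  have cF : ContinuousOn F (Icc 0 A) := hF ▸ continuousOn_primitive_Icc hA.le H.cw
  have cK : ContinuousOn K (Icc 0 A) := hK ▸ continuousOn_primitive_Icc hA.le cwq
  have dF : ∀ s ∈ Ioo 0 A, HasDerivAt F (w s) s := fun s hs => by
    rw [hF]; exact hasDerivAt_primitive H.cw hs
  have dK : ∀ s ∈ Ioo 0 A, HasDerivAt K (w s * q s) s := fun s hs => by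
    rw [hK]; exact hasDerivAt_primitive cwq hs
  have F0 : F 0 = 0 := by simp [hF]
  have K0 : K 0 = 0 := by simp [hK]
  have Fn : ∀ s ∈ Icc 0 A, 0 ≤ F s := fun s hs => by
    rw [hF]; exact integral_nonneg hs.1 fun u hu => (H.wpos u ⟨hu.1, hu.2.trans hs.2⟩).le
  have Kn : ∀ s ∈ Icc 0 A, 0 ≤ K s := fun s hs => by
    rw [hK]; exact integral_nonneg hs.1 fun u hu => mul_nonneg (H.wpos u ⟨hu.1, hu.2.trans hs.2⟩).le
      (H.qnonneg u ⟨hu.1, hu.2.trans hs.2⟩)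
  obtain ⟨W, hW⟩ : ∃ f : ℝ → ℝ, f = fun s => c + F s := ⟨_, rfl⟩
  have Wpos : ∀ s ∈ Icc 0 A, 0 < W s := fun s hs => by have := Fn s hs; simp only [hW]; linarith
  have cW : ContinuousOn W (Icc 0 A) := hW ▸ continuousOn_const.add cF
  have dW : ∀ s ∈ Ioo 0 A, HasDerivAt W (w s) s := fun s hs => by
    simpa [hW] using (dF s hs).const_add c
  obtain ⟨h, hh⟩ : ∃ f : ℝ → ℝ, f = fun s => (r + 1) * W s / w s := ⟨_, rfl⟩
  have wne : ∀ s ∈ Icc 0 A, w s ≠ 0 := fun s hs => (H.wpos s hs).ne'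
  have xne : ∀ s ∈ Icc 0 A, x s ≠ 0 := fun s hs => (H.xpos s hs).ne'
  have Wne : ∀ s ∈ Icc 0 A, W s ≠ 0 := fun s hs => (Wpos s hs).ne'
  have ch : ContinuousOn h (Icc 0 A) := hh ▸ (continuousOn_const.mul cW).div H.cw wne
  have hpos : ∀ s ∈ Icc 0 A, 0 < h s := fun s hs => by
    rw [hh]; exact div_pos (mul_pos hr1 (Wpos s hs)) (H.wpos s hs)
  have hne : ∀ s ∈ Icc 0 A, h s ≠ 0 := fun s hs => (hpos s hs).ne'
  have hwx : ∀ s ∈ Icc 0 A, h s ≤ x s := by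
    have mono : MonotoneOn (fun s => w s * x s - (r + 1) * W s) (Icc 0 A) := by
      have cc : ContinuousOn (fun s => w s * x s - (r + 1) * W s) (Icc 0 A) :=
        (H.cw.mul H.cx).sub (continuousOn_const.mul cW)
      apply monotoneOn_of_deriv_nonneg (convex_Icc 0 A) cc
      · intro s hs
        rw [interior_Icc] at hs
        obtain ⟨d, hd, hdx⟩ := H.dx s hs
        exact (((H.dw s hs).fun_mul hdx).fun_sub
          ((dW s hs).const_mul _)).differentiableAt.differentiableWithinAt
      · intro s hs
        rw [interior_Icc] at hs
        obtain ⟨d, hd, hdx⟩ := H.dx s hs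
        rw [HasDerivAt.deriv (((H.dw s hs).fun_mul hdx).fun_sub ((dW s hs).const_mul (r + 1)))]
        have := xne s (hIoo hs)
        have : r * w s / x s * x s = r * w s := by field_simp
        rw [this]
        have := H.wpos s (hIoo hs)
        nlinarith
    intro s hs
    have := mono h0 hs hs.1
    simp only at this
    have hW0 : W 0 = c := by simp [hW, F0]
    rw [hW0] at this
    rw [hh]
    simp only
    rw [div_le_iff₀ (H.wpos s hs)]
    linarith
  have dh : ∀ s ∈ Ioo 0 A, HasDerivAt h ((r + 1) - r * h s / x s) s := by
    intro s hs
    have := ((dW s hs).const_mul (r + 1)).fun_div (H.dw s hs) (wne s (hIoo hs))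
    rw [hh]
    refine this.congr_deriv ?_
    have h1 := wne s (hIoo hs)
    have h2 := xne s (hIoo hs)
    beta_reduce
    field_simp
  obtain ⟨Q, hQ⟩ : ∃ f : ℝ → ℝ, f = fun s => K s / W s := ⟨_, rfl⟩
  have cQ : ContinuousOn Q (Icc 0 A) := hQ ▸ cK.div cW Wne
  have dQ : ∀ s ∈ Ioo 0 A, HasDerivAt Q ((r + 1) * (q s - Q s) / h s) s := by
    intro s hs
    have := (dK s hs).fun_div (dW s hs) (Wne s (hIoo hs))
    rw [hh, hQ]
    refine this.congr_deriv ?_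
    have h1 := wne s (hIoo hs)
    have h2 := Wne s (hIoo hs)
    beta_reduce
    field_simp
  have Q0 : Q 0 = 0 := by simp [hQ, K0]
  have Mn : 0 ≤ M := by
    have := H.growth 0 h0
    rw [H.q0] at this
    simpa using this
  refine ⟨W, h, Q, fun s => (r + 1) * (q s - Q s) / h s, ⟨hr1, cW, ch, cQ,
    (continuousOn_const.mul (H.cq.sub cQ)).div ch hne, Wpos, hpos,
    fun s hs => by
      rw [hQ]; exact div_nonneg (Kn s hs) (Wpos s hs).le, Q0, ?_, ?_, dQ, ?_⟩, ?_, ?_⟩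
  · intro s hs
    refine (dW s hs).congr_deriv ?_
    have h1 := wne s (hIoo hs)
    have h2 := Wne s (hIoo hs)
    simp only [hh]
    field_simp
  · intro s hs
    refine ⟨_, ?_, dh s hs⟩
    have : h s / x s ≤ 1 := (div_le_one (H.xpos s (hIoo hs))).2 (hwx s (hIoo hs))
    rw [mul_div_assoc]
    nlinarith
  · intro s hs
    have : W s * Q s = K s := by
      simp only [hQ]; field_simp [Wne s hs]
    rw [this]
    have e : K s ≤ ∫ v in (0:ℝ)..s, M * Real.exp (v / 2) := by
      rw [hK]
      apply integral_mono_on hs.1 (hi cwq s hs)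
      · exact (by fun_prop : Continuous fun v => M * Real.exp (v / 2)).intervalIntegrable _ _
      · intro u hu; exact H.growth u ⟨hu.1, hu.2.trans hs.2⟩
    have e2 : ∫ v in (0:ℝ)..s, M * Real.exp (v / 2) = 2 * M * Real.exp (s / 2) - 2 * M := by
      rw [integral_eq_sub_of_hasDerivAt (f := fun v => 2 * M * Real.exp (v / 2))]
      · simp
      · intro u _
        have := (((hasDerivAt_id u).div_const 2).exp).const_mul (2 * M)
        refine this.congr_deriv ?_
        simp only [id]; ring
      · exact (by fun_prop : Continuous fun v => M * Real.exp (v / 2)).intervalIntegrable _ _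
    linarith
  · have cexp : ContinuousOn (fun s : ℝ => Real.exp (-s)) (Icc 0 A) := by fun_prop
    have hd : ∀ s ∈ Ioo 0 A, HasDerivAt (fun s => - (W s * Real.exp (-s)))
        (- (w s * Real.exp (-s) + W s * (Real.exp (-s) * -1))) s := fun s hs =>
      ((dW s hs).fun_mul ((hasDerivAt_id s).neg.exp)).fun_neg
    have := integral_le_integral_add_of_hasDerivAt hA.le
      (f := fun s => W s * Real.exp (-s)) (g := fun s => w s * Real.exp (-s))
      (B := fun s => -(W s * Real.exp (-s)))
      (B' := fun s => -(w s * Real.exp (-s) + W s * (Real.exp (-s) * -1)))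
      (cW.mul cexp) (H.cw.mul cexp) (cW.mul cexp).neg
      (((H.cw.mul cexp).add (cW.mul (cexp.mul continuousOn_const))).neg) hd
      (fun s hs => by linarith)
    unfold kernelMass
    refine this.trans ?_
    have h1 : W 0 = c := by simp [hW, F0]
    have h2 : 0 ≤ W A * Real.exp (-A) := mul_nonneg (Wpos A hAm).le (Real.exp_pos _).le
    simp only [h1, neg_zero, Real.exp_zero]
    linarith
  · have cexp : ContinuousOn (fun s : ℝ => Real.exp (-s)) (Icc 0 A) := by fun_prop
    set k := ρ / (r + 1) with hk
    have kn : 0 ≤ k := div_nonneg hρ hr1.le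
    obtain ⟨B, hB⟩ : ∃ f : ℝ → ℝ, f = fun s => w s * Real.exp (-s) *
      (-q s ^ 2 / h s - (q s - Q s) ^ 2 + 2 * q s * k) := ⟨_, rfl⟩
    obtain ⟨B', hB'⟩ : ∃ f : ℝ → ℝ, f = fun s => w s * Real.exp (-s) * (r / x s - 1) *
        (-q s ^ 2 / h s - (q s - Q s) ^ 2 + 2 * q s * k)
        + w s * Real.exp (-s) * (-(2 * q s * dq s) / h s
          + q s ^ 2 * ((r + 1) - r * h s / x s) / h s ^ 2
            - 2 * (q s - Q s) * (dq s - (r + 1) * (q s - Q s) / h s) + 2 * dq s * k) := ⟨_, rfl⟩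
    have hne2 : ∀ s ∈ Icc 0 A, h s ^ 2 ≠ 0 := fun s hs => pow_ne_zero 2 (hne s hs)
    have xne2 : ∀ s ∈ Icc 0 A, x s ^ 2 ≠ 0 := fun s hs => pow_ne_zero 2 (xne s hs)
    have c1 := H.cw; have c2 := H.cx; have c3 := H.cq; have c4 := H.cdq
    have cB : ContinuousOn B (Icc 0 A) := by
      simp only [hB]; fun_prop (disch := assumption)
    have cB' : ContinuousOn B' (Icc 0 A) := by
      simp only [hB']; fun_prop (disch := assumption)
    have dB : ∀ s ∈ Ioo 0 A, HasDerivAt B (B' s) s := by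
      intro s hs
      have e1 := (H.dw s hs).fun_mul ((hasDerivAt_id s).neg.exp)
      have e2 := (((H.dq s hs).fun_pow 2).fun_neg.fun_div (dh s hs) (hne s (hIoo hs)))
      have e3 := (((H.dq s hs).fun_sub (dQ s hs)).fun_pow 2)
      have e4 := ((H.dq s hs).const_mul 2).mul_const k
      have := e1.fun_mul ((e2.fun_sub e3).fun_add e4)
      rw [hB]
      refine this.congr_deriv ?_
      have h1 := hne s (hIoo hs)
      have h2 := xne s (hIoo hs)
      simp only [hB', id, Pi.neg_apply]
      push_cast
      field_simp
      ring
    have main := integral_le_integral_add_of_hasDerivAt hA.le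
      (f := fun s => w s * Real.exp (-s) *
        (2 * ρ * q s / x s - dq s ^ 2 - r * q s ^ 2 / x s ^ 2))
      (g := fun s => k ^ 2 * (w s * Real.exp (-s)) + W s * Real.exp (-s) *
        (2 * ρ * Q s / h s - ((r + 1) * (q s - Q s) / h s) ^ 2 - (r + 1) * Q s ^ 2 / h s ^ 2))
      (by fun_prop (disch := assumption)) (by fun_prop (disch := assumption)) cB cB' dB ?_
    · rw [intervalIntegral.integral_add, intervalIntegral.integral_const_mul] at main
      · unfold kernelFunctional kernelMass
        refine main.trans ?_
        have hB0 : B 0 = 0 := by simp [hB, H.q0, Q0]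
        have hBA : B A ≤ 2 * ρ * M * Real.exp (-A / 2) := by
          simp only [hB]
          have g := H.growth A hAm
          have wA := H.wpos A hAm
          have eA := Real.exp_pos (-A)
          have t1 : 0 ≤ q A ^ 2 / h A := div_nonneg (sq_nonneg _) (hpos A hAm).le
          have t2 : w A * Real.exp (-A) * (-q A ^ 2 / h A - (q A - Q A) ^ 2 + 2 * q A * k)
              ≤ w A * Real.exp (-A) * (2 * q A * k) := by
            apply mul_le_mul_of_nonneg_left _ (mul_pos wA eA).le
            have : -q A ^ 2 / h A = -(q A ^ 2 / h A) := by ring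
            rw [this]
            nlinarith [sq_nonneg (q A - Q A)]
          refine t2.trans ?_
          have t3 : Real.exp (A / 2) * Real.exp (-A) = Real.exp (-A / 2) := by
            rw [← Real.exp_add]; ring_nf
          have t4 : k ≤ ρ := div_le_self hρ (by linarith)
          calc w A * Real.exp (-A) * (2 * q A * k) = 2 * k * Real.exp (-A) * (w A * q A) := by ring
            _ ≤ 2 * k * Real.exp (-A) * (M * Real.exp (A / 2)) := by gcongr
            _ = 2 * k * M * Real.exp (-A / 2) := by rw [← t3]; ring
            _ ≤ _ := by gcongr
        rw [hB0]
        linarith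
      · exact hi (by fun_prop (disch := assumption)) A hAm
      · exact hi (by fun_prop (disch := assumption)) A hAm
    · intro s hs
      have hs' := hIoo hs
      have key := lift_identity (w s * Real.exp (-s)) (x s) (q s) (dq s) (h s) r ρ (Q s)
        (xne s hs') (hne s hs') hr1.ne'
      have hWh : w s * Real.exp (-s) * h s / (r + 1) = W s * Real.exp (-s) := by
        simp only [hh]; field_simp [wne s hs']
      rw [hWh] at key
      rw [key]
      have z : 0 ≤ 1 / h s - 1 / x s :=
        sub_nonneg.2 (one_div_le_one_div_of_le (hpos s hs') (hwx s hs'))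
      have pn : 0 ≤ w s * Real.exp (-s) := (mul_pos (H.wpos s hs') (Real.exp_pos _)).le
      have qn := H.qnonneg s hs'
      have : 0 ≤ w s * Real.exp (-s) * ((dq s - q s / h s - (q s - Q s) + ρ / (r + 1)) ^ 2
          + r * (1 / h s - 1 / x s) ^ 2 * q s ^ 2
          + 2 * (1 / h s - 1 / x s) * q s * (ρ / (r + 1))
          + r * (1 / h s - 1 / x s) * (q s - Q s) ^ 2) := by positivity
      simp only [hB', ← hk] at this ⊢
      linarith

theorem KernelData.functional_le (J : ℕ) : ∀ {A r M ρ : ℝ} {w x q dq : ℝ → ℝ},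
    KernelData A r M w x q dq → 0 < A → 0 ≤ ρ →
    kernelFunctional A r ρ w x q dq ≤
      ρ ^ 2 * (∑ j ∈ Finset.range J, 1 / (r + 1 + j) ^ 2 + 1 / (r + J)) * kernelMass A w
        + (2 ^ J - 1) * (2 * ρ * M * Real.exp (-A / 2)) := by
  induction J with
  | zero =>
    intro A r M ρ w x q dq H hA hρ
    have cexp : ContinuousOn (fun s : ℝ => Real.exp (-s)) (Icc 0 A) := by fun_prop
    have c1 := H.cw; have c2 := H.cx; have c3 := H.cq; have c4 := H.cdq
    have xne : ∀ s ∈ Icc 0 A, x s ≠ 0 := fun s hs => (H.xpos s hs).ne'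
    have xne2 : ∀ s ∈ Icc 0 A, x s ^ 2 ≠ 0 := fun s hs => pow_ne_zero 2 (xne s hs)
    have hi : ∀ {h : ℝ → ℝ}, ContinuousOn h (Icc 0 A) → IntervalIntegrable h volume 0 A := by
      intro h hh; apply ContinuousOn.intervalIntegrable; rwa [uIcc_of_le hA.le]
    simp only [Finset.range_zero, Finset.sum_empty, Nat.cast_zero, add_zero, zero_add, pow_zero,
      sub_self, zero_mul]
    unfold kernelFunctional kernelMass
    rw [← intervalIntegral.integral_const_mul]
    apply integral_mono_on hA.le (hi (by fun_prop (disch := assumption)))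
      (hi (by fun_prop (disch := assumption)))
    intro s hs
    have pn : 0 ≤ w s * Real.exp (-s) := (mul_pos (H.wpos s hs) (Real.exp_pos _)).le
    rw [mul_comm (ρ ^ 2 * (1 / r))]
    apply mul_le_mul_of_nonneg_left _ pn
    have hr := H.rpos
    have hx := H.xpos s hs
    have : ρ ^ 2 * (1 / r) - (2 * ρ * q s / x s - dq s ^ 2 - r * q s ^ 2 / x s ^ 2)
      = (ρ - r * q s / x s) ^ 2 / r + dq s ^ 2 := by field_simp; ring
    have : 0 ≤ (ρ - r * q s / x s) ^ 2 / r + dq s ^ 2 := by positivity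
    linarith
  | succ J ih =>
    intro A r M ρ w x q dq H hA hρ
    set S := ∑ j ∈ Finset.range J, 1 / (r + 1 + 1 + j : ℝ) ^ 2 + 1 / (r + 1 + J) with hS
    have h0 : (0:ℝ) ∈ Icc 0 A := ⟨le_rfl, hA.le⟩
    have hr := H.rpos
    have e0 : 0 < w 0 * x 0 / (r + 1) :=
      div_pos (mul_pos (H.wpos 0 h0) (H.xpos 0 h0)) (by linarith)
    have key : ∀ c ∈ Ioo 0 (w 0 * x 0 / (r + 1)), kernelFunctional A r ρ w x q dq ≤
        (ρ / (r + 1)) ^ 2 * kernelMass A w + (ρ ^ 2 * S * (c + kernelMass A w)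
          + (2 ^ J - 1) * (2 * ρ * (2 * M) * Real.exp (-A / 2)))
          + 2 * ρ * M * Real.exp (-A / 2) := by
      intro c hc
      have hc2 : (r + 1) * c ≤ w 0 * x 0 := by
        have := (lt_div_iff₀ (by linarith : 0 < r + 1)).1 hc.2
        linarith
      obtain ⟨w', x', q', dq', H', hm, hf⟩ := H.lift hA hρ hc.1 hc2
      have := ih H' hA hρ
      have hSn : 0 ≤ S := by positivity
      have : kernelFunctional A (r + 1) ρ w' x' q' dq' ≤ ρ ^ 2 * S * (c + kernelMass A w)
          + (2 ^ J - 1) * (2 * ρ * (2 * M) * Real.exp (-A / 2)) := by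
        refine this.trans ?_
        gcongr
      linarith
    have lim : Filter.Tendsto (fun c : ℝ => (ρ / (r + 1)) ^ 2 * kernelMass A w +
        (ρ ^ 2 * S * (c + kernelMass A w) + (2 ^ J - 1) * (2 * ρ * (2 * M) * Real.exp (-A / 2)))
          + 2 * ρ * M * Real.exp (-A / 2)) (nhdsWithin 0 (Ioi 0))
        (nhds ((ρ / (r + 1)) ^ 2 * kernelMass A w +
        (ρ ^ 2 * S * (0 + kernelMass A w) + (2 ^ J - 1) * (2 * ρ * (2 * M) * Real.exp (-A / 2)))
          + 2 * ρ * M * Real.exp (-A / 2))) := by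
      apply Filter.Tendsto.mono_left _ nhdsWithin_le_nhds
      apply Continuous.tendsto
      fun_prop
    have := ge_of_tendsto lim (Filter.mem_of_superset (Ioo_mem_nhdsGT e0) key)
    refine this.trans (le_of_eq ?_)
    rw [Finset.sum_range_succ']
    have e1 : ∀ j : ℕ, (1:ℝ) / (r + 1 + ((j + 1 : ℕ) : ℝ)) ^ 2 = 1 / (r + 1 + 1 + j) ^ 2 := by
      intro j; push_cast; ring_nf
    have e2 : r + ((J + 1 : ℕ) : ℝ) = r + 1 + J := by push_cast; ring
    simp only [e1, e2]
    rw [hS]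
    have e3 : (1:ℝ) / (r + 1 + ((0 : ℕ) : ℝ)) ^ 2 = (1 / (r + 1)) ^ 2 := by
      rw [Nat.cast_zero, add_zero, div_pow, one_pow]
    rw [e3]
    generalize ∑ j ∈ Finset.range J, (1:ℝ) / (r + 1 + 1 + j) ^ 2 = S'
    rw [pow_succ]
    ring

theorem KernelData.functional_le_of_sign_free (J : ℕ) {A r M ρ : ℝ} {w x q dq : ℝ → ℝ}
    (hA : 0 < A) (hr : 0 < r)
    (cw : ContinuousOn w (Icc 0 A)) (cx : ContinuousOn x (Icc 0 A))
    (cq : ContinuousOn q (Icc 0 A)) (cdq : ContinuousOn dq (Icc 0 A))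
    (wpos : ∀ s ∈ Icc 0 A, 0 < w s) (xpos : ∀ s ∈ Icc 0 A, 0 < x s)
    (q0 : q 0 = 0) (dw : ∀ s ∈ Ioo 0 A, HasDerivAt w (r * w s / x s) s)
    (dx : ∀ s ∈ Ioo 0 A, ∃ d, 1 ≤ d ∧ HasDerivAt x d s)
    (hdq : ∀ s ∈ Ioo 0 A, HasDerivAt q (dq s) s)
    (growth : ∀ s ∈ Icc 0 A, w s * |q s| ≤ M * Real.exp (s / 2)) :
    kernelFunctional A r ρ w x q dq ≤
      ρ ^ 2 * (∑ j ∈ Finset.range J, 1 / (r + 1 + j) ^ 2 + 1 / (r + J)) * kernelMass A w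
        + (2 ^ J - 1) * (2 * |ρ| * M * Real.exp (-A / 2)) := by
  have cexp : ContinuousOn (fun s : ℝ => Real.exp (-s)) (Icc 0 A) := by fun_prop
  have xne : ∀ s ∈ Icc 0 A, x s ≠ 0 := fun s hs => (xpos s hs).ne'
  have xne2 : ∀ s ∈ Icc 0 A, x s ^ 2 ≠ 0 := fun s hs => pow_ne_zero 2 (xne s hs)
  have hi : ∀ {h : ℝ → ℝ}, ContinuousOn h (Icc 0 A) → IntervalIntegrable h volume 0 A := by
    intro h hh; apply ContinuousOn.intervalIntegrable; rwa [uIcc_of_le hA.le]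
  set bound := ρ ^ 2 * (∑ j ∈ Finset.range J, 1 / (r + 1 + j) ^ 2 + 1 / (r + J)) * kernelMass A w
        + (2 ^ J - 1) * (2 * |ρ| * M * Real.exp (-A / 2)) with hbound
  set P := ∫ s in (0:ℝ)..A, w s * Real.exp (-s) / x s with hP
  have key : ∀ η ∈ Ioi (0:ℝ), kernelFunctional A r ρ w x q dq ≤ bound + 2 * |ρ| * η * P := by
    intro η hη
    have hη : 0 < η := hη
    have pos : ∀ s, 0 < q s ^ 2 + η ^ 2 := fun s => by positivity
    have sne : ∀ s, √(q s ^ 2 + η ^ 2) ≠ 0 := fun s => (Real.sqrt_pos.2 (pos s)).ne'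
    have sne' : ∀ s ∈ Icc 0 A, √(q s ^ 2 + η ^ 2) ≠ 0 := fun s _ => sne s
    have le_abs : ∀ s, √(q s ^ 2 + η ^ 2) - η ≤ |q s| := fun s => by
      rw [sub_le_iff_le_add, Real.sqrt_le_left (by positivity)]
      nlinarith [sq_abs (q s), abs_nonneg (q s)]
    have abs_le : ∀ s, |q s| ≤ √(q s ^ 2 + η ^ 2) := fun s =>
      Real.abs_le_sqrt (by nlinarith)
    have eta_le : ∀ s, η ≤ √(q s ^ 2 + η ^ 2) := fun s =>
      Real.le_sqrt_of_sq_le (by nlinarith [sq_nonneg (q s)])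
    have H : KernelData A r M w x (fun s => √(q s ^ 2 + η ^ 2) - η)
        (fun s => q s * dq s / √(q s ^ 2 + η ^ 2)) :=
      { rpos := hr, cw := cw, cx := cx
        cq := by fun_prop
        cdq := by fun_prop (disch := assumption)
        wpos := wpos, xpos := xpos, qnonneg := fun s _ => by linarith [eta_le s]
        q0 := by simp [q0, Real.sqrt_sq hη.le]
        dw := dw, dx := dx
        dq := fun s hs => by
          have := ((((hdq s hs).fun_pow 2).add_const (η ^ 2)).sqrt (pos s).ne').sub_const η
          refine this.congr_deriv ?_
          have := sne s
          simp only [Nat.cast_ofNat]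
          field_simp
          ring
        growth := fun s hs => (mul_le_mul_of_nonneg_left (le_abs s) (wpos s hs).le).trans
          (growth s hs) }
    have := H.functional_le J hA (abs_nonneg ρ)
    rw [sq_abs, ← hbound] at this
    refine le_trans ?_ (add_le_add_left this _)
    unfold kernelFunctional
    rw [hP, ← intervalIntegral.integral_const_mul, ← intervalIntegral.integral_add]
    · apply integral_mono_on hA.le
      · exact hi (by fun_prop (disch := assumption))
      · exact hi (by fun_prop (disch := assumption))
      intro s hs
      have wp := wpos s hs
      have xp := xpos s hs
      have ep := Real.exp_pos (-s)
      have e1 : 2 * |ρ| * η * (w s * Real.exp (-s) / x s)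
          = w s * Real.exp (-s) * (2 * |ρ| * η / x s) := by ring
      rw [e1, ← mul_add]
      apply mul_le_mul_of_nonneg_left _ (mul_pos wp ep).le
      have h1 : 2 * ρ * q s / x s ≤ 2 * |ρ| * (√(q s ^ 2 + η ^ 2) - η) / x s
          + 2 * |ρ| * η / x s := by
        rw [← add_div]
        gcongr
        have : ρ * q s ≤ |ρ| * |q s| := by rw [← abs_mul]; exact le_abs_self _
        nlinarith [abs_le s, abs_nonneg ρ]
      have h2 : (q s * dq s / √(q s ^ 2 + η ^ 2)) ^ 2 ≤ dq s ^ 2 := by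
        rw [div_pow, Real.sq_sqrt (pos s).le, div_le_iff₀ (pos s)]
        nlinarith [sq_nonneg (dq s * η)]
      have h3 : r * (√(q s ^ 2 + η ^ 2) - η) ^ 2 / x s ^ 2 ≤ r * q s ^ 2 / x s ^ 2 := by
        have h0 : 0 ≤ √(q s ^ 2 + η ^ 2) - η := by linarith [eta_le s]
        have h4 : (√(q s ^ 2 + η ^ 2) - η) ^ 2 ≤ q s ^ 2 := by
          exact (pow_le_pow_left₀ h0 (le_abs s) 2).trans_eq (sq_abs _)
        exact div_le_div_of_nonneg_right (mul_le_mul_of_nonneg_left h4 hr.le) (by positivity)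
      linarith
    · exact hi (by fun_prop (disch := assumption))
    · exact hi (by fun_prop (disch := assumption))
  have lim : Filter.Tendsto (fun η : ℝ => bound + 2 * |ρ| * η * P) (nhdsWithin 0 (Ioi 0))
      (nhds (bound + 2 * |ρ| * 0 * P)) := by
    apply Filter.Tendsto.mono_left _ nhdsWithin_le_nhds
    apply Continuous.tendsto
    fun_prop
  have := ge_of_tendsto lim (Filter.mem_of_superset self_mem_nhdsWithin key)
  simpa using this

theorem integrableOn_Ioi_of_abs_le_exp {f : ℝ → ℝ} {C b a : ℝ} (hb : 0 < b) (ha : 0 ≤ a)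
    (cf : ContinuousOn f (Ici 0)) (hf : ∀ s, 0 ≤ s → |f s| ≤ C * Real.exp (-b * s)) :
    IntegrableOn f (Ioi a) := by
  have h1 : IntegrableOn (fun s => C * Real.exp (-b * s)) (Ioi a) :=
    (exp_neg_integrableOn_Ioi a hb).const_mul C
  refine Integrable.mono' h1 ((cf.mono fun s hs => ?_).aestronglyMeasurable measurableSet_Ioi) ?_
  · exact ha.trans (le_of_lt hs)
  · filter_upwards [ae_restrict_mem measurableSet_Ioi] with s hs
    exact hf s (ha.trans (le_of_lt hs))

set_option maxHeartbeats 1000000 in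
theorem variance_bound_finite (J : ℕ) {r ρ M2 D Z A : ℝ} {w x V dv dx g K : ℝ → ℝ} (hr : 0 < r)
    (hA : 0 < A)
    (cw : ContinuousOn w (Ici 0)) (cx : ContinuousOn x (Ici 0)) (cV : ContinuousOn V (Ici 0))
    (cdv : ContinuousOn dv (Ici 0)) (cdx : ContinuousOn dx (Ici 0)) (cg : ContinuousOn g (Ici 0))
    (wpos : ∀ s, 0 ≤ s → 0 < w s) (xpos : ∀ s, 0 ≤ s → 0 < x s)
    (hw : ∀ s, 0 < s → HasDerivAt w (r * w s / x s) s)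
    (hx : ∀ s, 0 < s → HasDerivAt x (dx s) s) (hdx : ∀ s, 0 < s → 1 ≤ dx s)
    (dV : ∀ s, 0 < s → HasDerivAt V (dv s) s)
    (hess : ∀ s, 0 < s → ∀ y, g s + 2 * y * dv s + y ^ 2 * (-r * dx s / x s ^ 2) ≤
      2 * ρ * y / x s - r * y ^ 2 / x s ^ 2)
    (gV : ∀ s, 0 ≤ s → |V s| ≤ M2 * Real.exp (s / 8))
    (hK : K = fun u => ∫ s in (0:ℝ)..u, w s * Real.exp (-s) * V s)
    (gK : ∀ A, 0 ≤ A → |K A| ≤ D * Real.exp (-(3 / 4) * A)) (hD : 0 ≤ D)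
    (wmono : ∀ s, 0 ≤ s → w 0 ≤ w s)
    (ip : ∀ a, 0 ≤ a → IntegrableOn (fun s => w s * Real.exp (-s)) (Ioi a))
    (hZ : ∫ s in Ioi (0:ℝ), w s * Real.exp (-s) = Z) :
    ∫ s in (0:ℝ)..A, w s * Real.exp (-s) * (g s + V s ^ 2) ≤
      ρ ^ 2 * (∑ j ∈ Finset.range J, 1 / (r + 1 + j) ^ 2 + 1 / (r + J)) * Z
        + ((2 ^ J - 1) * (2 * |ρ| * D * Real.exp (-A / 2)) + 2 * D * M2 * Real.exp (-A / 2)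
        + D ^ 2 / w 0 * Real.exp (-A / 2)) := by
  set C1 := 2 * |ρ| * D with hC1
  set C2 := 2 * D * M2 with hC2
  set C3 := D ^ 2 / w 0 with hC3
  set bd := ρ ^ 2 * (∑ j ∈ Finset.range J, 1 / (r + 1 + j) ^ 2 + 1 / (r + J)) with hbd
  have bdn : 0 ≤ bd := by positivity
  have hM2 : 0 ≤ M2 := by
    have := (abs_nonneg _).trans (gV 0 le_rfl)
    simpa using this
  have C2n : 0 ≤ C2 := by positivity
  have w0 := wpos 0 le_rfl
  have K0 : K 0 = 0 := by simp [hK]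
  have cexp : ContinuousOn (fun s : ℝ => Real.exp (-s)) (Ici 0) := by fun_prop
  have cpV : ContinuousOn (fun s => w s * Real.exp (-s) * V s) (Ici 0) := by fun_prop
  have hsub : Icc 0 A ⊆ Ici 0 := Icc_subset_Ici_self
  have hAm : A ∈ Icc 0 A := ⟨hA.le, le_rfl⟩
  have c1 := cw.mono hsub; have c2 := cx.mono hsub; have c3 := cV.mono hsub
  have c4 := cdv.mono hsub; have c5 := cdx.mono hsub; have c6 := cg.mono hsub
  have c7 := cexp.mono hsub; have c8 := cpV.mono hsub
  have cK : ContinuousOn K (Icc 0 A) := by rw [hK]; exact continuousOn_primitive_Icc hA.le c8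
  have dK : ∀ s ∈ Ioo 0 A, HasDerivAt K (w s * Real.exp (-s) * V s) s := fun s hs => by
    rw [hK]; exact hasDerivAt_primitive c8 hs
  have wne : ∀ s ∈ Icc 0 A, w s * Real.exp (-s) ≠ 0 := fun s hs =>
    (mul_pos (wpos s hs.1) (Real.exp_pos _)).ne'
  have xne : ∀ s ∈ Icc 0 A, x s ≠ 0 := fun s hs => (xpos s hs.1).ne'
  have xne2 : ∀ s ∈ Icc 0 A, x s ^ 2 ≠ 0 := fun s hs => pow_ne_zero 2 (xne s hs)
  obtain ⟨q, hq⟩ : ∃ f : ℝ → ℝ, f = fun s => -(K s / (w s * Real.exp (-s))) := ⟨_, rfl⟩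
  have cq : ContinuousOn q (Icc 0 A) := by rw [hq]; fun_prop (disch := assumption)
  obtain ⟨dq, hdq⟩ : ∃ f : ℝ → ℝ, f = fun s => -V s - q s * (r / x s - 1) := ⟨_, rfl⟩
  have cdq : ContinuousOn dq (Icc 0 A) := by rw [hdq]; fun_prop (disch := assumption)
  have dp : ∀ s ∈ Ioo 0 A, HasDerivAt (fun s => w s * Real.exp (-s))
      (w s * Real.exp (-s) * (r / x s - 1)) s := fun s hs => by
    refine ((hw s hs.1).fun_mul ((hasDerivAt_id s).neg.exp)).congr_deriv ?_
    simp only [id, Pi.neg_apply]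
    ring
  have dqq : ∀ s ∈ Ioo 0 A, HasDerivAt q (dq s) s := fun s hs => by
    have hs' := Ioo_subset_Icc_self hs
    have := ((dK s hs).fun_div (dp s hs) (wne s hs')).fun_neg
    rw [hdq, hq]
    refine this.congr_deriv ?_
    have e := wne s hs'
    have e2 := xne s hs'
    simp only []
    generalize w s * Real.exp (-s) = p at e ⊢
    field_simp
    ring
  have q0 : q 0 = 0 := by simp [hq, K0]
  have hpq : ∀ s ∈ Icc 0 A, w s * Real.exp (-s) * q s = -K s := fun s hs => by
    have := wne s hs
    rw [hq]
    simp only []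
    rw [mul_neg, mul_div_cancel₀ _ this]
  have growth : ∀ s ∈ Icc 0 A, w s * |q s| ≤ D * Real.exp (s / 2) := by
    intro s hs
    have h1 : w s * |q s| = |K s| * Real.exp s := by
      have : K s = -(w s * Real.exp (-s) * q s) := by rw [hpq s hs]; ring
      rw [this, abs_neg, abs_mul, abs_mul, Real.abs_exp, abs_of_pos (wpos s hs.1)]
      have : Real.exp (-s) * Real.exp s = 1 := by rw [← Real.exp_add]; simp
      linear_combination (-(w s * |q s|)) * this
    rw [h1]
    calc |K s| * Real.exp s ≤ D * Real.exp (-(3 / 4) * s) * Real.exp s := by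
          gcongr; exact gK s hs.1
      _ = D * Real.exp (s / 4) := by rw [mul_assoc, ← Real.exp_add]; ring_nf
      _ ≤ _ := by
        have : Real.exp (s / 4) ≤ Real.exp (s / 2) := Real.exp_le_exp.2 (by linarith [hs.1])
        gcongr
  have ker := KernelData.functional_le_of_sign_free J (ρ := ρ) hA hr c1 c2 cq cdq
    (fun s hs => wpos s hs.1) (fun s hs => xpos s hs.1) q0 (fun s hs => hw s hs.1)
    (fun s hs => ⟨dx s, hdx s hs.1, hx s hs.1⟩) dqq growth
  have massle : kernelMass A w ≤ Z := by
    rw [← hZ]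
    unfold kernelMass
    rw [intervalIntegral.integral_of_le hA.le]
    apply setIntegral_mono_set (ip 0 le_rfl)
    · filter_upwards [ae_restrict_mem measurableSet_Ioi] with s hs
      exact (mul_pos (wpos s (le_of_lt hs)) (Real.exp_pos _)).le
    · exact (Ioc_subset_Ioi_self).eventuallyLE
  have cmp := integral_le_integral_add_of_hasDerivAt hA.le
    (f := fun s => w s * Real.exp (-s) * (g s + V s ^ 2))
    (g := fun s => w s * Real.exp (-s) *
      (2 * ρ * q s / x s - dq s ^ 2 - r * q s ^ 2 / x s ^ 2))
    (B := fun s => 2 * K s * V s - w s * Real.exp (-s) * (r / x s - 1) * q s ^ 2)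
    (B' := fun s => (2 * (w s * Real.exp (-s) * V s) * V s + 2 * K s * dv s)
      - ((w s * Real.exp (-s) * (r / x s - 1) * (r / x s - 1)
          + w s * Real.exp (-s) * (-r * dx s / x s ^ 2)) * q s ^ 2
        + w s * Real.exp (-s) * (r / x s - 1) * (2 * q s * dq s)))
    (by fun_prop (disch := assumption)) (by fun_prop (disch := assumption))
    (by fun_prop (disch := assumption)) (by fun_prop (disch := assumption)) ?_ ?_
  · refine cmp.trans ?_
    have hK0 : 2 * K 0 * V 0 - w 0 * Real.exp (-0) * (r / x 0 - 1) * q 0 ^ 2 = 0 := by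
      rw [K0, q0]; ring
    simp only [hK0, sub_zero]
    have t1 : kernelFunctional A r ρ w x q dq ≤ bd * Z + (2 ^ J - 1) *
        (C1 * Real.exp (-A / 2)) := by
      refine ker.trans ?_
      gcongr
    have t2 : 2 * K A * V A ≤ C2 * Real.exp (-A / 2) := by
      have e1 := gK A hA.le
      have e2 := gV A hA.le
      calc 2 * K A * V A ≤ |2 * K A * V A| := le_abs_self _
        _ = 2 * |K A| * |V A| := by rw [abs_mul, abs_mul, abs_two]
        _ ≤ 2 * (D * Real.exp (-(3 / 4) * A)) * (M2 * Real.exp (A / 8)) := by gcongr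
        _ = C2 * (Real.exp (-(3 / 4) * A) * Real.exp (A / 8)) := by rw [hC2]; ring
        _ ≤ C2 * Real.exp (-A / 2) := by
          rw [← Real.exp_add]
          gcongr
          linarith
    have t3 : -(w A * Real.exp (-A) * (r / x A - 1) * q A ^ 2) ≤ C3 * Real.exp (-A / 2) := by
      have xp := xpos A hA.le
      have wp := wpos A hA.le
      have ep := Real.exp_pos (-A)
      have e0 : 0 ≤ w A * Real.exp (-A) * (r / x A) * q A ^ 2 := by positivity
      have e1 : -(w A * Real.exp (-A) * (r / x A - 1) * q A ^ 2)
          ≤ w A * Real.exp (-A) * q A ^ 2 := by nlinarith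
      refine e1.trans ?_
      have e2 : w A * Real.exp (-A) * q A ^ 2 = |K A| ^ 2 / (w A * Real.exp (-A)) := by
        rw [sq_abs, ← neg_sq (K A), ← hpq A hAm]
        field_simp
      rw [e2, div_le_iff₀ (mul_pos wp ep)]
      have e3 := gK A hA.le
      have e4 := wmono A hA.le
      have e5 : Real.exp (-(3 / 4) * A) ^ 2 = Real.exp (-A / 2) * Real.exp (-A) := by
        rw [← Real.exp_nat_mul, ← Real.exp_add]; push_cast; ring_nf
      calc |K A| ^ 2 ≤ (D * Real.exp (-(3 / 4) * A)) ^ 2 := by gcongr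
        _ = C3 * Real.exp (-A / 2) * (w 0 * Real.exp (-A)) := by
          rw [mul_pow _ (Real.exp _), e5, hC3]
          field_simp
        _ ≤ _ := by gcongr
    unfold kernelFunctional at t1
    linarith
  · intro s hs
    have e1 := ((dK s hs).const_mul 2).fun_mul (dV s hs.1)
    have e2 := ((hasDerivAt_const s r).fun_div (hx s hs.1)
      (xpos s hs.1.le).ne').sub_const 1
    have e3 := ((dp s hs).fun_mul e2).fun_mul ((dqq s hs).fun_pow 2)
    refine (e1.fun_sub e3).congr_deriv ?_
    push_cast
    ring
  · intro s hs
    have hs' := Ioo_subset_Icc_self hs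
    have h1 := hpq s hs'
    have hK1 : K s = -(w s * Real.exp (-s) * q s) := by rw [h1]; ring
    have pp : 0 < w s * Real.exp (-s) := mul_pos (wpos s hs.1.le) (Real.exp_pos _)
    have h2 := mul_le_mul_of_nonneg_left (hess s hs.1 (q s)) pp.le
    simp only [hK1, hdq]
    linarith [h2]

set_option maxHeartbeats 1000000 in
theorem variance_bound (J : ℕ) {r ρ M : ℝ} {w x v dv dx g : ℝ → ℝ} (hr : 0 < r)
    (cw : ContinuousOn w (Ici 0)) (cx : ContinuousOn x (Ici 0)) (cv : ContinuousOn v (Ici 0))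
    (cdv : ContinuousOn dv (Ici 0)) (cdx : ContinuousOn dx (Ici 0)) (cg : ContinuousOn g (Ici 0))
    (wpos : ∀ s, 0 ≤ s → 0 < w s) (xpos : ∀ s, 0 ≤ s → 0 < x s)
    (hw : ∀ s, 0 < s → HasDerivAt w (r * w s / x s) s)
    (hx : ∀ s, 0 < s → HasDerivAt x (dx s) s) (hdx : ∀ s, 0 < s → 1 ≤ dx s)
    (hv : ∀ s, 0 < s → HasDerivAt v (dv s) s)
    (hess : ∀ s, 0 < s → ∀ y, g s + 2 * y * dv s + y ^ 2 * (-r * dx s / x s ^ 2) ≤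
      2 * ρ * y / x s - r * y ^ 2 / x s ^ 2)
    (gw : ∀ s, 0 ≤ s → w s ≤ M * Real.exp (s / 8))
    (gv : ∀ s, 0 ≤ s → |v s| ≤ M * Real.exp (s / 8))
    (gg : ∀ s, 0 ≤ s → |g s| ≤ M * Real.exp (s / 8)) :
    (∫ s in Ioi (0:ℝ), (g s + v s ^ 2) * (w s * Real.exp (-s))) *
        (∫ s in Ioi (0:ℝ), w s * Real.exp (-s)) ≤
      ρ ^ 2 * (∑ j ∈ Finset.range J, 1 / (r + 1 + j) ^ 2 + 1 / (r + J)) *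
        (∫ s in Ioi (0:ℝ), w s * Real.exp (-s)) ^ 2
      + (∫ s in Ioi (0:ℝ), v s * (w s * Real.exp (-s))) ^ 2 := by
  have Mpos : 0 < M := by
    have := (wpos 0 le_rfl).trans_le (gw 0 le_rfl)
    simpa using this
  have cexp : ContinuousOn (fun s : ℝ => Real.exp (-s)) (Ici 0) := by fun_prop
  have wabs : ∀ s, 0 ≤ s → |w s| ≤ M * Real.exp (s / 8) := fun s hs => by
    rw [abs_of_pos (wpos s hs)]; exact gw s hs
  have ip : ∀ a, 0 ≤ a → IntegrableOn (fun s => w s * Real.exp (-s)) (Ioi a) := fun a ha => by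
    refine integrableOn_Ioi_of_abs_le_exp (C := M) (b := 7 / 8) (by norm_num) ha
      (by fun_prop) fun s hs => ?_
    rw [abs_mul, Real.abs_exp]
    calc |w s| * Real.exp (-s) ≤ M * Real.exp (s / 8) * Real.exp (-s) := by
          gcongr; exact wabs s hs
      _ = M * Real.exp (-(7 / 8) * s) := by rw [mul_assoc, ← Real.exp_add]; ring_nf
  have ipv : IntegrableOn (fun s => v s * (w s * Real.exp (-s))) (Ioi 0) := by
    refine integrableOn_Ioi_of_abs_le_exp (C := M * M) (b := 3 / 4) (by norm_num) le_rfl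
      (by fun_prop) fun s hs => ?_
    rw [abs_mul, abs_mul, Real.abs_exp]
    calc |v s| * (|w s| * Real.exp (-s))
        ≤ M * Real.exp (s / 8) * (M * Real.exp (s / 8) * Real.exp (-s)) := by
          gcongr
          · exact gv s hs
          · exact wabs s hs
      _ = M * M * (Real.exp (s / 8) * (Real.exp (s / 8) * Real.exp (-s))) := by ring
      _ = M * M * Real.exp (-(3 / 4) * s) := by
        rw [← Real.exp_add, ← Real.exp_add]; ring_nf
  have ipg : IntegrableOn (fun s => (g s + v s ^ 2) * (w s * Real.exp (-s))) (Ioi 0) := by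
    refine integrableOn_Ioi_of_abs_le_exp (C := (M + M ^ 2) * M) (b := 5 / 8) (by norm_num) le_rfl
      (by fun_prop) fun s hs => ?_
    rw [abs_mul, abs_mul, Real.abs_exp]
    have h1 : Real.exp (s / 8) ≤ Real.exp (s / 4) := Real.exp_le_exp.2 (by linarith)
    have h2 : |g s + v s ^ 2| ≤ (M + M ^ 2) * Real.exp (s / 4) := by
      refine (abs_add_le _ _).trans ?_
      rw [abs_pow, add_mul]
      refine add_le_add ((gg s hs).trans (by gcongr)) ?_
      calc |v s| ^ 2 ≤ (M * Real.exp (s / 8)) ^ 2 := by gcongr; exact gv s hs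
        _ = M ^ 2 * Real.exp (s / 4) := by
          rw [mul_pow, ← Real.exp_nat_mul]; congr 2; push_cast; ring
    calc |g s + v s ^ 2| * (|w s| * Real.exp (-s))
        ≤ (M + M ^ 2) * Real.exp (s / 4) * (M * Real.exp (s / 8) * Real.exp (-s)) := by
          gcongr
          exact wabs s hs
      _ = (M + M ^ 2) * M * (Real.exp (s / 4) * (Real.exp (s / 8) * Real.exp (-s))) := by ring
      _ = (M + M ^ 2) * M * Real.exp (-(5 / 8) * s) := by
        rw [← Real.exp_add, ← Real.exp_add]; ring_nf
  set Z := ∫ s in Ioi (0:ℝ), w s * Real.exp (-s) with hZ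
  set Z1 := ∫ s in Ioi (0:ℝ), v s * (w s * Real.exp (-s)) with hZ1
  set Z2 := ∫ s in Ioi (0:ℝ), (g s + v s ^ 2) * (w s * Real.exp (-s)) with hZ2
  have Zpos : 0 < Z := by
    rw [hZ, setIntegral_pos_iff_support_of_nonneg_ae]
    · have : (Function.support fun s => w s * Real.exp (-s)) ∩ Ioi 0 = Ioi 0 := by
        apply inter_eq_right.2
        intro s hs
        exact (mul_pos (wpos s (le_of_lt hs)) (Real.exp_pos _)).ne'
      rw [this]; simp
    · filter_upwards [ae_restrict_mem measurableSet_Ioi] with s hs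
      exact (mul_pos (wpos s (le_of_lt hs)) (Real.exp_pos _)).le
    · exact ip 0 le_rfl
  set μ := Z1 / Z with hμ
  obtain ⟨V, hV⟩ : ∃ f : ℝ → ℝ, f = fun s => v s - μ := ⟨_, rfl⟩
  have cV : ContinuousOn V (Ici 0) := by rw [hV]; fun_prop
  have dV : ∀ s, 0 < s → HasDerivAt V (dv s) s := fun s hs => by
    rw [hV]; exact (hv s hs).sub_const μ
  set M2 := M + |μ| with hM2
  have M2pos : 0 < M2 := by positivity
  have gV : ∀ s, 0 ≤ s → |V s| ≤ M2 * Real.exp (s / 8) := fun s hs => by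
    rw [hV]
    refine (abs_sub _ _).trans ?_
    rw [hM2, add_mul]
    refine add_le_add (gv s hs) (le_mul_of_one_le_right (abs_nonneg _) ?_)
    exact Real.one_le_exp (by linarith)
  have gpV : ∀ s, 0 ≤ s → |w s * Real.exp (-s) * V s| ≤ M * M2 * Real.exp (-(3 / 4) * s) := by
    intro s hs
    rw [abs_mul, abs_mul, Real.abs_exp]
    calc |w s| * Real.exp (-s) * |V s|
        ≤ M * Real.exp (s / 8) * Real.exp (-s) * (M2 * Real.exp (s / 8)) := by
          gcongr
          · exact wabs s hs
          · exact gV s hs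
      _ = M * M2 * (Real.exp (s / 8) * (Real.exp (s / 8) * Real.exp (-s))) := by ring
      _ = M * M2 * Real.exp (-(3 / 4) * s) := by
        rw [← Real.exp_add, ← Real.exp_add]; ring_nf
  have cpV : ContinuousOn (fun s => w s * Real.exp (-s) * V s) (Ici 0) := by fun_prop
  have ipV : ∀ a, 0 ≤ a → IntegrableOn (fun s => w s * Real.exp (-s) * V s) (Ioi a) := fun a ha =>
    integrableOn_Ioi_of_abs_le_exp (by norm_num) ha cpV gpV
  have V0 : ∫ s in Ioi (0:ℝ), w s * Real.exp (-s) * V s = 0 := by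
    have : ∀ s, w s * Real.exp (-s) * V s
        = v s * (w s * Real.exp (-s)) - μ * (w s * Real.exp (-s)) := fun s => by rw [hV]; ring
    simp_rw [this]
    rw [MeasureTheory.integral_sub ipv ((ip 0 le_rfl).const_mul μ),
      MeasureTheory.integral_const_mul, ← hZ, ← hZ1, hμ]
    field_simp
    ring
  obtain ⟨K, hK⟩ : ∃ f : ℝ → ℝ, f = fun u => ∫ s in (0:ℝ)..u, w s * Real.exp (-s) * V s :=
    ⟨_, rfl⟩
  have K0 : K 0 = 0 := by simp [hK]
  have gK : ∀ A, 0 ≤ A → |K A| ≤ 2 * M * M2 * Real.exp (-(3 / 4) * A) := by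
    intro A hA
    have h1 : K A + ∫ s in Ioi A, w s * Real.exp (-s) * V s = 0 := by
      have := intervalIntegral.integral_interval_add_Ioi (ipV 0 le_rfl) (ipV A hA)
      rw [V0] at this
      rw [hK]
      exact this
    have h2 : |∫ s in Ioi A, w s * Real.exp (-s) * V s| ≤
        ∫ s in Ioi A, M * M2 * Real.exp (-(3 / 4) * s) := by
      refine norm_integral_le_of_norm_le (G := ℝ) ((exp_neg_integrableOn_Ioi A
        (by norm_num)).const_mul _) ?_
      filter_upwards [ae_restrict_mem measurableSet_Ioi] with s hs
      exact gpV s (hA.trans (le_of_lt hs))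
    have h3 : ∫ s in Ioi A, M * M2 * Real.exp (-(3 / 4) * s)
        = 4 / 3 * (M * M2 * Real.exp (-(3 / 4) * A)) := by
      rw [MeasureTheory.integral_const_mul, integral_exp_mul_Ioi (by norm_num)]
      ring
    have h4 : K A = - ∫ s in Ioi A, w s * Real.exp (-s) * V s := by linarith
    rw [h4, abs_neg]
    refine h2.trans ?_
    rw [h3]
    have : 0 < M * M2 * Real.exp (-(3 / 4) * A) := by positivity
    linarith
  have wmono : ∀ s, 0 ≤ s → w 0 ≤ w s := by
    have : MonotoneOn w (Ici 0) := by
      apply monotoneOn_of_deriv_nonneg (convex_Ici 0) cw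
      · intro s hs
        rw [interior_Ici] at hs
        exact (hw s hs).differentiableAt.differentiableWithinAt
      · intro s hs
        rw [interior_Ici] at hs
        rw [(hw s hs).deriv]
        have := wpos s (le_of_lt hs)
        have := xpos s (le_of_lt hs)
        positivity
    intro s hs
    exact this self_mem_Ici hs hs
  have w0 := wpos 0 le_rfl
  set bd := ρ ^ 2 * (∑ j ∈ Finset.range J, 1 / (r + 1 + j) ^ 2 + 1 / (r + J)) with hbd
  have bdn : 0 ≤ bd := by positivity
  set C1 := 2 * |ρ| * (2 * M * M2) with hC1
  set C2 := 2 * (2 * M * M2) * M2 with hC2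
  set C3 := (2 * M * M2) ^ 2 / w 0 with hC3
  have finite : ∀ A, 0 < A → ∫ s in (0:ℝ)..A, w s * Real.exp (-s) * (g s + V s ^ 2) ≤
      bd * Z + ((2 ^ J - 1) * (C1 * Real.exp (-A / 2)) + C2 * Real.exp (-A / 2)
        + C3 * Real.exp (-A / 2)) := by
    intro A hA
    have := variance_bound_finite J hr hA cw cx cV cdv cdx cg wpos xpos hw hx hdx dV hess gV hK gK
      (by positivity) wmono ip hZ.symm
    rw [hC1, hC2, hC3]
    linarith
  have ipgV : IntegrableOn (fun s => w s * Real.exp (-s) * (g s + V s ^ 2)) (Ioi 0) := by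
    have : (fun s => w s * Real.exp (-s) * (g s + V s ^ 2)) =
        fun s => ((g s + v s ^ 2) * (w s * Real.exp (-s))
          - 2 * μ * (v s * (w s * Real.exp (-s)))) + μ ^ 2 * (w s * Real.exp (-s)) := by
      funext s; rw [hV]; ring
    rw [this]
    exact (ipg.sub (ipv.const_mul _)).add ((ip 0 le_rfl).const_mul _)
  have lim1 := intervalIntegral_tendsto_integral_Ioi 0 ipgV tendsto_id
  have e0 : Tendsto (fun A : ℝ => Real.exp (-A / 2)) atTop (𝓝 0) := by
    apply Real.tendsto_exp_atBot.comp
    have : (fun A : ℝ => -A / 2) = fun A => (-(1 / 2) : ℝ) * A := by funext A; ring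
    rw [this]
    exact tendsto_id.const_mul_atTop_of_neg (by norm_num)
  have lim2 : Tendsto (fun A : ℝ => bd * Z + ((2 ^ J - 1) * (C1 * Real.exp (-A / 2))
      + C2 * Real.exp (-A / 2) + C3 * Real.exp (-A / 2))) atTop
      (𝓝 (bd * Z + ((2 ^ J - 1) * (C1 * 0) + C2 * 0 + C3 * 0))) :=
    tendsto_const_nhds.add ((((e0.const_mul C1).const_mul _).add (e0.const_mul C2)).add
      (e0.const_mul C3))
  have final := le_of_tendsto_of_tendsto lim1 lim2
    ((eventually_gt_atTop 0).mono fun A hA => finite A hA)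
  have split : ∫ s in Ioi (0:ℝ), w s * Real.exp (-s) * (g s + V s ^ 2)
      = Z2 - 2 * μ * Z1 + μ ^ 2 * Z := by
    have : ∀ s, w s * Real.exp (-s) * (g s + V s ^ 2) =
        ((g s + v s ^ 2) * (w s * Real.exp (-s))
          - 2 * μ * (v s * (w s * Real.exp (-s)))) + μ ^ 2 * (w s * Real.exp (-s)) := by
      intro s; rw [hV]; ring
    simp_rw [this]
    have a1 : IntegrableOn (fun s => (g s + v s ^ 2) * (w s * Real.exp (-s))
        - 2 * μ * (v s * (w s * Real.exp (-s)))) (Ioi 0) := ipg.sub (ipv.const_mul _)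
    rw [MeasureTheory.integral_add a1 ((ip 0 le_rfl).const_mul _),
      MeasureTheory.integral_sub ipg (ipv.const_mul _), MeasureTheory.integral_const_mul,
      MeasureTheory.integral_const_mul]
  rw [split] at final
  have hμZ : μ * Z = Z1 := by rw [hμ]; field_simp
  have := mul_le_mul_of_nonneg_right final Zpos.le
  have e9 : (Z2 - 2 * μ * Z1 + μ ^ 2 * Z) * Z = Z2 * Z - Z1 ^ 2 := by
    linear_combination (-2 * Z1 + μ * Z + Z1) * hμZ
  rw [e9] at this
  linarith

/-- The average of `g` with respect to the weights `a`. -/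
noncomputable def weightedAvg {ι : Type*} [Fintype ι] (a g : ι → ℝ) : ℝ :=
  (∑ j, a j * g j) / ∑ j, a j

section weightedAvg
variable {ι : Type*} [Fintype ι] {a : ι → ℝ}

theorem weightedAvg_add (a g h : ι → ℝ) :
    weightedAvg a (fun j => g j + h j) = weightedAvg a g + weightedAvg a h := by
  simp only [weightedAvg, mul_add, Finset.sum_add_distrib, add_div]

theorem weightedAvg_const_mul (a g : ι → ℝ) (c : ℝ) :
    weightedAvg a (fun j => c * g j) = c * weightedAvg a g := by
  simp only [weightedAvg, mul_left_comm _ c, ← Finset.mul_sum, mul_div_assoc]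

theorem weightedAvg_sq_le (ha : ∀ j, 0 < a j) (g : ι → ℝ) (hS : 0 < ∑ j, a j) :
    weightedAvg a g ^ 2 ≤ weightedAvg a (fun j => g j ^ 2) := by
  unfold weightedAvg
  rw [div_pow, div_le_div_iff₀ (by positivity) hS]
  have := Finset.sum_mul_sq_le_sq_mul_sq Finset.univ (fun j => √(a j)) (fun j => √(a j) * g j)
  have e1 : ∀ j, √(a j) * (√(a j) * g j) = a j * g j := fun j => by
    rw [← mul_assoc, Real.mul_self_sqrt (ha j).le]
  have e2 : ∀ j, (√(a j) * g j) ^ 2 = a j * g j ^ 2 := fun j => by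
    rw [mul_pow, Real.sq_sqrt (ha j).le]
  simp only [e1, e2, Real.sq_sqrt (ha _).le] at this
  calc _ ≤ ((∑ j, a j) * ∑ j, a j * g j ^ 2) * ∑ j, a j := by gcongr
    _ = _ := by ring

theorem abs_weightedAvg_le (ha : ∀ j, 0 < a j) {g : ι → ℝ} {C : ℝ} (hS : 0 < ∑ j, a j)
    (hg : ∀ j, |g j| ≤ C) : |weightedAvg a g| ≤ C := by
  unfold weightedAvg
  rw [abs_div, abs_of_pos hS, div_le_iff₀ hS, Finset.mul_sum]
  refine (Finset.abs_sum_le_sum_abs _ _).trans (Finset.sum_le_sum fun j _ => ?_)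
  rw [abs_mul, abs_of_pos (ha j), mul_comm]
  exact mul_le_mul_of_nonneg_right (hg j) (ha j).le

theorem weightedAvg_pos [Nonempty ι] (ha : ∀ j, 0 < a j) {g : ι → ℝ} (hg : ∀ j, 0 < g j) :
    0 < weightedAvg a g :=
  div_pos (Finset.sum_pos (fun j _ => mul_pos (ha j) (hg j)) Finset.univ_nonempty)
    (Finset.sum_pos (fun j _ => ha j) Finset.univ_nonempty)

theorem hasDerivAt_weightedAvg {a g : ι → ℝ → ℝ} {d g' : ι → ℝ} {s : ℝ}
    (ha : ∀ j, HasDerivAt (a j) (a j s * d j) s) (hg : ∀ j, HasDerivAt (g j) (g' j) s)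
    (hS : 0 < ∑ j, a j s) :
    HasDerivAt (fun u => weightedAvg (fun j => a j u) (fun j => g j u))
      (weightedAvg (fun j => a j s) g' + (weightedAvg (fun j => a j s) (fun j => g j s * d j)
        - weightedAvg (fun j => a j s) (fun j => g j s) * weightedAvg (fun j => a j s) d)) s := by
  unfold weightedAvg
  have h1 := HasDerivAt.fun_sum (u := Finset.univ) (fun j _ => (ha j).fun_mul (hg j))
  have h2 := HasDerivAt.fun_sum (u := Finset.univ) (fun j _ => ha j)
  refine (h1.fun_div h2 hS.ne').congr_deriv ?_
  have e : ∑ j, (a j s * d j * g j s + a j s * g' j) =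
      ∑ j, a j s * (g j s * d j) + ∑ j, a j s * g' j := by
    rw [← Finset.sum_add_distrib]; exact Finset.sum_congr rfl fun j _ => by ring
  rw [e]
  field_simp
  ring

end weightedAvg

/-- Finitely many functions `c + β t + (r₀ + ρ t) log (l s + m)` and a smoothing parameter `ε`. -/
structure LogAffineFamily (ι : Type*) where
  c : ι → ℝ
  β : ι → ℝ
  l : ι → ℝ
  m : ι → ℝ
  r₀ : ℝ
  ρ : ℝ
  ε : ℝ
  lpos : ∀ j, 0 < l j
  mpos : ∀ j, 0 < m j
  εpos : 0 < ε

namespace LogAffineFamily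
variable {ι : Type*} [Fintype ι] (F : LogAffineFamily ι)

noncomputable def y (j : ι) (s : ℝ) : ℝ := F.l j * s + F.m j

noncomputable def T (j : ι) (t s : ℝ) : ℝ :=
  F.c j + F.β j * t + (F.r₀ + F.ρ * t) * Real.log (F.y j s)

noncomputable def a (t s : ℝ) (j : ι) : ℝ := Real.exp (-(F.T j t s) / F.ε)

/-- The exponential of the smooth minimum of the family. -/
noncomputable def w (t s : ℝ) : ℝ := Real.exp (-F.ε * Real.log (∑ j, F.a t s j))

noncomputable def κ (s : ℝ) (j : ι) : ℝ := F.l j / F.y j s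

noncomputable def τ (s : ℝ) (j : ι) : ℝ := F.β j + F.ρ * Real.log (F.y j s)

noncomputable def v (t s : ℝ) : ℝ := weightedAvg (F.a t s) (F.τ s)

noncomputable def g (t s : ℝ) : ℝ :=
  -((weightedAvg (F.a t s) (fun j => F.τ s j ^ 2) - F.v t s ^ 2) / F.ε)

noncomputable def avκ (t s : ℝ) : ℝ := weightedAvg (F.a t s) (F.κ s)

noncomputable def varκ (t s : ℝ) : ℝ :=
  weightedAvg (F.a t s) (fun j => F.κ s j ^ 2) - F.avκ t s ^ 2

noncomputable def cov (t s : ℝ) : ℝ :=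
  weightedAvg (F.a t s) (fun j => F.τ s j * F.κ s j) - F.v t s * F.avκ t s

noncomputable def dv (t s : ℝ) : ℝ :=
  F.ρ * F.avκ t s - (F.r₀ + F.ρ * t) / F.ε * F.cov t s

noncomputable def dx (t s : ℝ) : ℝ :=
  (weightedAvg (F.a t s) (fun j => F.κ s j ^ 2) + (F.r₀ + F.ρ * t) / F.ε * F.varκ t s) /
    F.avκ t s ^ 2

end LogAffineFamily

namespace LogAffineFamily
variable {ι : Type*} (F : LogAffineFamily ι)

theorem y_pos (j : ι) {s : ℝ} (hs : 0 ≤ s) : 0 < F.y j s :=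
  add_pos_of_nonneg_of_pos (mul_nonneg (F.lpos j).le hs) (F.mpos j)

theorem a_pos (t s : ℝ) (j : ι) : 0 < F.a t s j := Real.exp_pos _

theorem κ_pos {s : ℝ} (hs : 0 ≤ s) (j : ι) : 0 < F.κ s j := div_pos (F.lpos j) (F.y_pos j hs)

theorem hasDerivAt_y (j : ι) (s : ℝ) : HasDerivAt (F.y j) (F.l j) s := by
  unfold y
  refine (((hasDerivAt_id s).const_mul (F.l j)).add_const (F.m j)).congr_deriv (by simp)

theorem hasDerivAt_log_y (j : ι) {s : ℝ} (hs : 0 ≤ s) :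
    HasDerivAt (fun s => Real.log (F.y j s)) (F.κ s j) s :=
  (F.hasDerivAt_y j s).log (F.y_pos j hs).ne'

theorem hasDerivAt_κ (j : ι) {s : ℝ} (hs : 0 ≤ s) :
    HasDerivAt (fun s => F.κ s j) (-(F.κ s j ^ 2)) s := by
  unfold κ
  have := (hasDerivAt_const s (F.l j)).fun_div (F.hasDerivAt_y j s) (F.y_pos j hs).ne'
  refine this.congr_deriv ?_
  have := F.y_pos j hs
  field_simp
  ring

theorem hasDerivAt_τ (j : ι) {s : ℝ} (hs : 0 ≤ s) :
    HasDerivAt (fun s => F.τ s j) (F.ρ * F.κ s j) s :=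
  ((F.hasDerivAt_log_y j hs).const_mul F.ρ).const_add (F.β j)

theorem hasDerivAt_a_s (t : ℝ) (j : ι) {s : ℝ} (hs : 0 ≤ s) :
    HasDerivAt (fun s => F.a t s j) (F.a t s j * (-((F.r₀ + F.ρ * t) / F.ε) * F.κ s j)) s := by
  unfold a T
  have := ((((F.hasDerivAt_log_y j hs).const_mul (F.r₀ + F.ρ * t)).const_add
    (F.c j + F.β j * t)).fun_neg.div_const F.ε).exp
  refine this.congr_deriv ?_
  ring

theorem hasDerivAt_a_t (t : ℝ) (j : ι) (s : ℝ) :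
    HasDerivAt (fun t => F.a t s j) (F.a t s j * (-(1 / F.ε) * F.τ s j)) t := by
  unfold a T τ
  have h1 := ((hasDerivAt_id t).const_mul (F.β j)).const_add (F.c j)
  have h2 := (((hasDerivAt_id t).const_mul F.ρ).const_add F.r₀).mul_const (Real.log (F.y j s))
  have := ((h1.fun_add h2).fun_neg.div_const F.ε).exp
  refine this.congr_deriv ?_
  simp only [id]
  ring

theorem continuousOn_κ (j : ι) : ContinuousOn (fun s => F.κ s j) (Ici 0) := fun _ hs =>
    (F.hasDerivAt_κ j hs).continuousAt.continuousWithinAt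

theorem continuousOn_τ (j : ι) : ContinuousOn (fun s => F.τ s j) (Ici 0) := fun _ hs =>
    (F.hasDerivAt_τ j hs).continuousAt.continuousWithinAt

variable [Fintype ι]

theorem w_pos (t s : ℝ) : 0 < F.w t s := Real.exp_pos _

theorem hasDerivAt_w {θ : ℝ} {A : ι → ℝ → ℝ} {d : ι → ℝ} {k : ℝ} {h : ι → ℝ}
    (hd : ∀ j, d j = -(k / F.ε) * h j) (hA : ∀ j, HasDerivAt (A j) (A j θ * d j) θ)
    (hS : 0 < ∑ j, A j θ) :
    HasDerivAt (fun u => Real.exp (-F.ε * Real.log (∑ j, A j u)))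
      (k * weightedAvg (fun j => A j θ) h * Real.exp (-F.ε * Real.log (∑ j, A j θ))) θ := by
  have h2 := HasDerivAt.fun_sum (u := Finset.univ) (fun j _ => hA j)
  refine (((h2.log hS.ne').const_mul (-F.ε)).exp).congr_deriv ?_
  have e : ∑ j, A j θ * d j = -(k / F.ε) * ∑ j, A j θ * h j := by
    rw [Finset.mul_sum]; exact Finset.sum_congr rfl fun j _ => by rw [hd]; ring
  rw [e]
  unfold weightedAvg
  have := F.εpos
  field_simp

variable [Nonempty ι]

theorem sum_a_pos (t s : ℝ) : 0 < ∑ j, F.a t s j :=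
  Finset.sum_pos (fun j _ => F.a_pos t s j) Finset.univ_nonempty

theorem avκ_pos (t : ℝ) {s : ℝ} (hs : 0 ≤ s) : 0 < F.avκ t s :=
  weightedAvg_pos (F.a_pos t s) (F.κ_pos hs)

theorem hasDerivAt_w_s (t : ℝ) {s : ℝ} (hs : 0 ≤ s) :
    HasDerivAt (F.w t) ((F.r₀ + F.ρ * t) * F.avκ t s * F.w t s) s :=
  F.hasDerivAt_w (fun _ => rfl) (fun j => F.hasDerivAt_a_s t j hs) (F.sum_a_pos t s)

theorem hasDerivAt_w_t (t s : ℝ) : HasDerivAt (fun t => F.w t s) (F.v t s * F.w t s) t := by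
  have := F.hasDerivAt_w (fun _ => rfl) (fun j => F.hasDerivAt_a_t t j s) (F.sum_a_pos t s)
  rw [one_mul] at this
  exact this

theorem hasDerivAt_avκ (t : ℝ) {s : ℝ} (hs : 0 ≤ s) :
    HasDerivAt (F.avκ t) (-(weightedAvg (F.a t s) (fun j => F.κ s j ^ 2))
      - (F.r₀ + F.ρ * t) / F.ε * F.varκ t s) s := by
  refine (hasDerivAt_weightedAvg (fun j => F.hasDerivAt_a_s t j hs)
    (fun j => F.hasDerivAt_κ j hs) (F.sum_a_pos t s)).congr_deriv ?_
  have e1 : (fun j => F.κ s j * (-((F.r₀ + F.ρ * t) / F.ε) * F.κ s j)) =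
      fun j => -((F.r₀ + F.ρ * t) / F.ε) * F.κ s j ^ 2 := by funext j; ring
  have e2 : (fun j => -(F.κ s j ^ 2)) = fun j => -1 * F.κ s j ^ 2 := by funext j; ring
  rw [e1, e2]
  simp only [weightedAvg_const_mul, varκ, avκ]
  ring

theorem hasDerivAt_v_s (t : ℝ) {s : ℝ} (hs : 0 ≤ s) : HasDerivAt (F.v t) (F.dv t s) s := by
  refine (hasDerivAt_weightedAvg (fun j => F.hasDerivAt_a_s t j hs)
    (fun j => F.hasDerivAt_τ j hs) (F.sum_a_pos t s)).congr_deriv ?_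
  have e1 : (fun j => F.τ s j * (-((F.r₀ + F.ρ * t) / F.ε) * F.κ s j)) =
      fun j => -((F.r₀ + F.ρ * t) / F.ε) * (F.τ s j * F.κ s j) := by funext j; ring
  rw [e1]
  simp only [weightedAvg_const_mul, dv, cov, avκ, v]
  ring

theorem hasDerivAt_v_t (t s : ℝ) : HasDerivAt (fun t => F.v t s) (F.g t s) t := by
  refine (hasDerivAt_weightedAvg (fun j => F.hasDerivAt_a_t t j s)
    (fun j => hasDerivAt_const t (F.τ s j)) (F.sum_a_pos t s)).congr_deriv ?_
  have e1 : (fun j => F.τ s j * (-(1 / F.ε) * F.τ s j)) =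
      fun j => -(1 / F.ε) * F.τ s j ^ 2 := by funext j; ring
  have e2 : (fun _ : ι => (0:ℝ)) = fun j => 0 * F.τ s j := by funext j; ring
  rw [e1, e2]
  simp only [weightedAvg_const_mul, g, v]
  ring

theorem varκ_nonneg (t s : ℝ) : 0 ≤ F.varκ t s :=
  sub_nonneg.2 (weightedAvg_sq_le (F.a_pos t s) _ (F.sum_a_pos t s))

theorem one_le_dx {t s : ℝ} (hr : 0 < F.r₀ + F.ρ * t) (hs : 0 ≤ s) : 1 ≤ F.dx t s := by
  unfold dx
  have := F.avκ_pos t hs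
  have h1 := F.varκ_nonneg t s
  have h2 : F.avκ t s ^ 2 ≤ weightedAvg (F.a t s) (fun j => F.κ s j ^ 2) :=
    sub_nonneg.1 h1
  have := F.εpos
  have h3 : 0 ≤ (F.r₀ + F.ρ * t) / F.ε * F.varκ t s := by positivity
  rw [le_div_iff₀ (by positivity)]
  linarith

theorem hasDerivAt_x (t : ℝ) {s : ℝ} (hs : 0 ≤ s) :
    HasDerivAt (fun s => 1 / F.avκ t s) (F.dx t s) s := by
  have := (hasDerivAt_const s (1:ℝ)).fun_div (F.hasDerivAt_avκ t hs) (F.avκ_pos t hs).ne'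
  refine this.congr_deriv ?_
  unfold dx
  ring

theorem hessian_le {t s : ℝ} (hr : 0 < F.r₀ + F.ρ * t) (hs : 0 ≤ s) (u : ℝ) :
    F.g t s + 2 * u * F.dv t s + u ^ 2 * (-(F.r₀ + F.ρ * t) * F.dx t s / (1 / F.avκ t s) ^ 2) ≤
      2 * F.ρ * u / (1 / F.avκ t s) - (F.r₀ + F.ρ * t) * u ^ 2 / (1 / F.avκ t s) ^ 2 := by
  have hκ := F.avκ_pos t hs
  set r := F.r₀ + F.ρ * t with hr'
  have h1 := weightedAvg_sq_le (F.a_pos t s) (fun j => F.τ s j + u * r * F.κ s j) (F.sum_a_pos t s)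
  have e1 : (fun j => (F.τ s j + u * r * F.κ s j) ^ 2) = fun j => F.τ s j ^ 2 +
      (2 * (u * r) * (F.τ s j * F.κ s j) + (u * r) ^ 2 * F.κ s j ^ 2) := by funext j; ring
  rw [e1] at h1
  simp only [weightedAvg_add, weightedAvg_const_mul] at h1
  have h2 := F.varκ_nonneg t s
  have h3 : F.dx t s * F.avκ t s ^ 2 = weightedAvg (F.a t s) (fun j => F.κ s j ^ 2) +
      r / F.ε * F.varκ t s := by
    unfold dx
    rw [div_mul_cancel₀ _ (by positivity)]
  have e2 : -r * F.dx t s / (1 / F.avκ t s) ^ 2 = -r * (F.dx t s * F.avκ t s ^ 2) := by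
    field_simp
  have e3 : r * u ^ 2 / (1 / F.avκ t s) ^ 2 = r * u ^ 2 * F.avκ t s ^ 2 := by field_simp
  have e4 : 2 * F.ρ * u / (1 / F.avκ t s) = 2 * F.ρ * u * F.avκ t s := by field_simp
  rw [e2, e3, e4, h3]
  have h4 : 0 ≤ r * u ^ 2 * F.varκ t s := by positivity
  have hε := F.εpos
  have h5 : 0 ≤ (weightedAvg (F.a t s) (fun j => F.τ s j ^ 2) - F.v t s ^ 2
      + 2 * (u * r) * F.cov t s + (u * r) ^ 2 * F.varκ t s) / F.ε := by
    apply div_nonneg _ hε.le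
    unfold cov varκ v avκ
    nlinarith [h1]
  have h6 : weightedAvg (F.a t s) (fun j => F.κ s j ^ 2) = F.varκ t s + F.avκ t s ^ 2 := by
    unfold varκ; ring
  unfold g dv
  rw [← hr', h6]
  have h7 : (-((weightedAvg (F.a t s) (fun j => F.τ s j ^ 2) - F.v t s ^ 2) / F.ε) +
      2 * u * (F.ρ * F.avκ t s - r / F.ε * F.cov t s) +
      u ^ 2 * (-r * (F.varκ t s + F.avκ t s ^ 2 + r / F.ε * F.varκ t s))) =
      2 * F.ρ * u * F.avκ t s - r * u ^ 2 * F.avκ t s ^ 2 - r * u ^ 2 * F.varκ t s -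
      (weightedAvg (F.a t s) (fun j => F.τ s j ^ 2) - F.v t s ^ 2
      + 2 * (u * r) * F.cov t s + (u * r) ^ 2 * F.varκ t s) / F.ε := by
    field_simp
    ring
  rw [h7]
  linarith

end LogAffineFamily

theorem exists_abs_log_le {l m δ : ℝ} (hl : 0 < l) (hm : 0 < m) (hδ : 0 < δ) :
    ∃ C, 0 ≤ C ∧ ∀ s, 0 ≤ s → |Real.log (l * s + m)| ≤ C + δ * s := by
  refine ⟨|Real.log m| + m * δ / l + |Real.log (l / δ)|, by positivity, fun s hs => ?_⟩
  have h0 : 0 < l * s + m := by positivity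
  have h1 : Real.log m ≤ Real.log (l * s + m) := Real.log_le_log hm (by nlinarith)
  have h2 : Real.log (l * s + m) = Real.log ((l * s + m) * δ / l) + Real.log (l / δ) := by
    rw [← Real.log_mul (by positivity) (by positivity)]; congr 1; field_simp
  have h3 : Real.log ((l * s + m) * δ / l) ≤ (l * s + m) * δ / l - 1 :=
    Real.log_le_sub_one_of_pos (by positivity)
  have h4 : (l * s + m) * δ / l = δ * s + m * δ / l := by field_simp
  have h5 : 0 ≤ m * δ / l := by positivity
  have h6 : 0 ≤ δ * s := by positivity
  rw [abs_le]
  constructor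
  · linarith [neg_abs_le (Real.log m), abs_nonneg (Real.log (l / δ))]
  · linarith [le_abs_self (Real.log (l / δ)), abs_nonneg (Real.log m)]

namespace LogAffineFamily
variable {ι : Type*} [Fintype ι] (F : LogAffineFamily ι)

theorem w_le (t s : ℝ) (j : ι) : F.w t s ≤ Real.exp (F.T j t s) := by
  unfold w
  apply Real.exp_le_exp.2
  have h1 : F.a t s j ≤ ∑ j, F.a t s j :=
    Finset.single_le_sum (fun i _ => (F.a_pos t s i).le) (Finset.mem_univ j)
  have h2 := Real.log_le_log (F.a_pos t s j) h1
  have h3 : Real.log (F.a t s j) = -(F.T j t s) / F.ε := by unfold a; rw [Real.log_exp]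
  rw [h3, div_le_iff₀ F.εpos] at h2
  linarith

variable [Nonempty ι]

theorem le_w {t s b : ℝ} (hb : ∀ j, b ≤ F.T j t s) :
    Real.exp (b - F.ε * Real.log (Fintype.card ι)) ≤ F.w t s := by
  unfold w
  apply Real.exp_le_exp.2
  have h1 : ∑ j, F.a t s j ≤ Fintype.card ι * Real.exp (-b / F.ε) := by
    rw [← nsmul_eq_mul, ← Finset.card_univ]
    apply Finset.sum_le_card_nsmul
    intro j _
    apply Real.exp_le_exp.2
    have := F.εpos
    have := hb j
    gcongr
  have h2 := Real.log_le_log (F.sum_a_pos t s) h1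
  have hc : (0:ℝ) < Fintype.card ι := by exact_mod_cast Fintype.card_pos
  rw [Real.log_mul hc.ne' (Real.exp_pos _).ne', Real.log_exp] at h2
  have h3 := mul_le_mul_of_nonneg_left h2 F.εpos.le
  have := F.εpos
  have e : F.ε * (-b / F.ε) = -b := by field_simp
  rw [mul_add, e] at h3
  linarith

theorem exists_growth (B : ℝ) (hB : 0 ≤ B) : ∃ M, 0 < M ∧ ∀ t, |t| ≤ B → ∀ s, 0 ≤ s →
    F.w t s ≤ M * Real.exp (s / 8) ∧ |F.v t s| ≤ M * Real.exp (s / 8) ∧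
      |F.g t s| ≤ M * Real.exp (s / 8) := by
  obtain ⟨R, hR⟩ : ∃ R, R = |F.r₀| + |F.ρ| * B + 1 := ⟨_, rfl⟩
  have Rpos : 0 < R := by rw [hR]; positivity
  have hρ := abs_nonneg F.ρ
  have h1 : ∀ j, ∃ C, 0 ≤ C ∧ ∀ s, 0 ≤ s →
      |Real.log (F.l j * s + F.m j)| ≤ C + 1 / (8 * R) * s :=
    fun j => exists_abs_log_le (F.lpos j) (F.mpos j) (by positivity)
  choose C hC0 hC using h1
  have h2 : ∀ j, ∃ C, 0 ≤ C ∧ ∀ s, 0 ≤ s → |Real.log (F.l j * s + F.m j)| ≤ C + 1 * s :=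
    fun j => exists_abs_log_le (F.lpos j) (F.mpos j) one_pos
  choose D hD0 hD using h2
  obtain ⟨j⟩ := ‹Nonempty ι›
  set M1 := Real.exp (|F.c j| + |F.β j| * B + R * C j) with hM1
  set K := ∑ i, (|F.β i| + |F.ρ| * (D i + 16)) with hK
  have Kn : 0 ≤ K := Finset.sum_nonneg fun i _ => by have := hD0 i; positivity
  have hε := F.εpos
  have hτ : ∀ s, 0 ≤ s → ∀ i, |F.τ s i| ≤ K * Real.exp (s / 16) := by
    intro s hs i
    have e1 : s / 16 + 1 ≤ Real.exp (s / 16) := Real.add_one_le_exp _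
    have e2 : |F.τ s i| ≤ |F.β i| + |F.ρ| * (D i + 1 * s) := by
      unfold τ y
      refine (abs_add_le _ _).trans ?_
      rw [abs_mul]
      gcongr
      exact hD i s hs
    have e3 : |F.β i| + |F.ρ| * (D i + 16) ≤ K :=
      Finset.single_le_sum (f := fun i => |F.β i| + |F.ρ| * (D i + 16))
        (fun i _ => by have := hD0 i; positivity) (Finset.mem_univ i)
    have e4 : |F.β i| + |F.ρ| * (D i + 1 * s) ≤
        (|F.β i| + |F.ρ| * (D i + 16)) * Real.exp (s / 16) := by
      have d := hD0 i
      have b := abs_nonneg (F.β i)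
      calc |F.β i| + |F.ρ| * (D i + 1 * s) ≤
          (|F.β i| + |F.ρ| * (D i + 16)) * (s / 16 + 1) := by
            have : 0 ≤ |F.β i| * (s / 16) := by positivity
            have : 0 ≤ |F.ρ| * (D i * (s / 16)) := by positivity
            have : 0 ≤ |F.ρ| * 16 := by positivity
            nlinarith
        _ ≤ _ := by gcongr
    refine (e2.trans e4).trans ?_
    gcongr
  refine ⟨M1 + K + (2 / F.ε) * K ^ 2 + 1, by positivity, fun t ht s hs => ⟨?_, ?_, ?_⟩⟩
  · refine (F.w_le t s j).trans ?_
    have e0 : |F.r₀ + F.ρ * t| ≤ R := by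
      refine (abs_add_le _ _).trans ?_
      rw [abs_mul, hR]
      nlinarith
    have e1 : F.T j t s ≤ |F.c j| + |F.β j| * B + R * C j + s / 8 := by
      unfold T y
      have a1 := le_abs_self (F.c j)
      have a2 : F.β j * t ≤ |F.β j| * B := (le_abs_self _).trans (by rw [abs_mul]; gcongr)
      have a3 : (F.r₀ + F.ρ * t) * Real.log (F.l j * s + F.m j) ≤ R * (C j + 1 / (8 * R) * s) := by
        refine (le_abs_self _).trans ?_
        rw [abs_mul]
        gcongr
        exact hC j s hs
      have a4 : R * (C j + 1 / (8 * R) * s) = R * C j + s / 8 := by field_simp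
      linarith
    calc Real.exp (F.T j t s) ≤ M1 * Real.exp (s / 8) := by
          rw [hM1, ← Real.exp_add]; exact Real.exp_le_exp.2 e1
      _ ≤ _ := by
        gcongr
        have : 0 ≤ (2 / F.ε) * K ^ 2 := by positivity
        linarith
  · have e1 : |F.v t s| ≤ K * Real.exp (s / 16) :=
      abs_weightedAvg_le (F.a_pos t s) (F.sum_a_pos t s) (hτ s hs)
    refine e1.trans ?_
    have : 0 ≤ (2 / F.ε) * K ^ 2 := by positivity
    have m1 : 0 < M1 := Real.exp_pos _
    gcongr
    · linarith
    · norm_num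
  · have e1 : |F.v t s| ≤ K * Real.exp (s / 16) :=
      abs_weightedAvg_le (F.a_pos t s) (F.sum_a_pos t s) (hτ s hs)
    have q1 : (K * Real.exp (s / 16)) ^ 2 = K ^ 2 * Real.exp (s / 8) := by
      rw [mul_pow, ← Real.exp_nat_mul]; congr 2; push_cast; ring
    have e2 : |weightedAvg (F.a t s) (fun j => F.τ s j ^ 2)| ≤ K ^ 2 * Real.exp (s / 8) := by
      rw [← q1]
      refine abs_weightedAvg_le (F.a_pos t s) (F.sum_a_pos t s) fun i => ?_
      rw [abs_pow]
      exact pow_le_pow_left₀ (abs_nonneg _) (hτ s hs i) 2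
    have e3 : |F.v t s ^ 2| ≤ K ^ 2 * Real.exp (s / 8) := by
      rw [← q1, abs_pow]
      exact pow_le_pow_left₀ (abs_nonneg _) e1 2
    have e4 : |F.g t s| ≤ (2 / F.ε) * K ^ 2 * Real.exp (s / 8) := by
      unfold g
      rw [abs_neg, abs_div, abs_of_pos hε, div_le_iff₀ hε]
      refine (abs_sub _ _).trans ?_
      have : (2 / F.ε) * K ^ 2 * Real.exp (s / 8) * F.ε = 2 * (K ^ 2 * Real.exp (s / 8)) := by
        field_simp
      linarith
    refine e4.trans ?_
    have m1 : 0 < M1 := Real.exp_pos _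
    gcongr
    linarith

end LogAffineFamily

namespace LogAffineFamily
variable {ι : Type*} [Fintype ι] [Nonempty ι] (F : LogAffineFamily ι)

theorem continuousOn_weightedAvg (t : ℝ) {h : ι → ℝ → ℝ} (hh : ∀ j, ContinuousOn (h j) (Ici 0)) :
    ContinuousOn (fun s => weightedAvg (F.a t s) (fun j => h j s)) (Ici 0) := by
  have ca : ∀ j, ContinuousOn (fun s => F.a t s j) (Ici 0) := fun j s hs =>
    (F.hasDerivAt_a_s t j hs).continuousAt.continuousWithinAt
  unfold weightedAvg
  refine ContinuousOn.div ?_ ?_ fun s _ => (F.sum_a_pos t s).ne'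
  · exact continuousOn_finsetSum _ fun j _ => (ca j).mul (hh j)
  · exact continuousOn_finsetSum _ fun j _ => ca j

theorem continuousOn_w (t : ℝ) : ContinuousOn (F.w t) (Ici 0) := fun _ hs =>
    (F.hasDerivAt_w_s t hs).continuousAt.continuousWithinAt

theorem continuousOn_v (t : ℝ) : ContinuousOn (F.v t) (Ici 0) := fun _ hs =>
    (F.hasDerivAt_v_s t hs).continuousAt.continuousWithinAt

theorem continuousOn_avκ (t : ℝ) : ContinuousOn (F.avκ t) (Ici 0) :=
  F.continuousOn_weightedAvg t F.continuousOn_κ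

theorem continuousOn_g (t : ℝ) : ContinuousOn (F.g t) (Ici 0) := by
  unfold g
  have := F.continuousOn_weightedAvg t (fun j => (F.continuousOn_τ j).pow 2)
  have := F.continuousOn_v t
  fun_prop

theorem continuousOn_avκ2 (t : ℝ) :
    ContinuousOn (fun s => weightedAvg (F.a t s) (fun j => F.κ s j ^ 2)) (Ici 0) :=
  F.continuousOn_weightedAvg t (fun j => (F.continuousOn_κ j).pow 2)

theorem continuousOn_dv (t : ℝ) : ContinuousOn (F.dv t) (Ici 0) := by
  unfold dv cov
  have := F.continuousOn_weightedAvg t (fun j => (F.continuousOn_τ j).mul (F.continuousOn_κ j))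
  have := F.continuousOn_v t
  have := F.continuousOn_avκ t
  fun_prop

theorem continuousOn_dx (t : ℝ) : ContinuousOn (F.dx t) (Ici 0) := by
  unfold dx varκ
  have := F.continuousOn_avκ2 t
  have := F.continuousOn_avκ t
  refine ContinuousOn.div (by fun_prop) (by fun_prop) fun s hs => ?_
  exact (pow_pos (F.avκ_pos t hs) 2).ne'

/-- The Laplace integral of the smooth minimum. -/
noncomputable def Z (t : ℝ) : ℝ := ∫ s in Ioi (0:ℝ), F.w t s * Real.exp (-s)

theorem growth_integrable {f : ℝ → ℝ} {C : ℝ} (cf : ContinuousOn f (Ici 0))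
    (hf : ∀ s, 0 ≤ s → |f s| ≤ C * Real.exp (-(5 / 8) * s)) : IntegrableOn f (Ioi 0) :=
  integrableOn_Ioi_of_abs_le_exp (by norm_num) le_rfl cf hf

theorem growth_bounds {M s w v g : ℝ} (hM : 0 < M) (hs : 0 ≤ s) (wp : 0 < w)
    (hw : w ≤ M * Real.exp (s / 8)) (hv : |v| ≤ M * Real.exp (s / 8))
    (hg : |g| ≤ M * Real.exp (s / 8)) :
    |w * Real.exp (-s)| ≤ M * Real.exp (-(5 / 8) * s) ∧
    |v * (w * Real.exp (-s))| ≤ M * M * Real.exp (-(5 / 8) * s) ∧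
    |(g + v ^ 2) * (w * Real.exp (-s))| ≤ (M + M ^ 2) * M * Real.exp (-(5 / 8) * s) := by
  have e1 : |w * Real.exp (-s)| ≤ M * Real.exp (-(7 / 8) * s) := by
    rw [abs_mul, Real.abs_exp, abs_of_pos wp]
    calc w * Real.exp (-s) ≤ M * Real.exp (s / 8) * Real.exp (-s) := by gcongr
      _ = _ := by rw [mul_assoc, ← Real.exp_add]; ring_nf
  have h1 : Real.exp (s / 8) ≤ Real.exp (s / 4) := Real.exp_le_exp.2 (by linarith)
  have h2 : |g + v ^ 2| ≤ (M + M ^ 2) * Real.exp (s / 4) := by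
    refine (abs_add_le _ _).trans ?_
    rw [abs_pow, add_mul]
    refine add_le_add (hg.trans (by gcongr)) ?_
    calc |v| ^ 2 ≤ (M * Real.exp (s / 8)) ^ 2 := by gcongr
      _ = M ^ 2 * Real.exp (s / 4) := by
        rw [mul_pow, ← Real.exp_nat_mul]; congr 2; push_cast; ring
  refine ⟨e1.trans ?_, ?_, ?_⟩
  · gcongr
    norm_num
  · rw [abs_mul]
    calc |v| * |w * Real.exp (-s)| ≤ M * Real.exp (s / 4) * (M * Real.exp (-(7 / 8) * s)) := by
          gcongr
          exact hv.trans (by gcongr)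
      _ = M * M * (Real.exp (s / 4) * Real.exp (-(7 / 8) * s)) := by ring
      _ = _ := by rw [← Real.exp_add]; ring_nf
  · rw [abs_mul]
    calc |g + v ^ 2| * |w * Real.exp (-s)|
        ≤ (M + M ^ 2) * Real.exp (s / 4) * (M * Real.exp (-(7 / 8) * s)) := by gcongr
      _ = (M + M ^ 2) * M * (Real.exp (s / 4) * Real.exp (-(7 / 8) * s)) := by ring
      _ = _ := by rw [← Real.exp_add]; ring_nf

theorem integrableOn_w (t : ℝ) : IntegrableOn (fun s => F.w t s * Real.exp (-s)) (Ioi 0) := by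
  obtain ⟨M, hM, h⟩ := F.exists_growth |t| (abs_nonneg t)
  have := F.continuousOn_w t
  refine growth_integrable (C := M) (by fun_prop) fun s hs => ?_
  obtain ⟨h1, h2, h3⟩ := h t le_rfl s hs
  exact (growth_bounds hM hs (F.w_pos t s) h1 h2 h3).1

theorem integrableOn_vw (t : ℝ) :
    IntegrableOn (fun s => F.v t s * (F.w t s * Real.exp (-s))) (Ioi 0) := by
  obtain ⟨M, hM, h⟩ := F.exists_growth |t| (abs_nonneg t)
  have := F.continuousOn_w t
  have := F.continuousOn_v t
  refine growth_integrable (C := M * M) (by fun_prop) fun s hs => ?_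
  obtain ⟨h1, h2, h3⟩ := h t le_rfl s hs
  exact (growth_bounds hM hs (F.w_pos t s) h1 h2 h3).2.1

theorem Z_pos (t : ℝ) : 0 < F.Z t := by
  unfold Z
  rw [setIntegral_pos_iff_support_of_nonneg_ae]
  · have : (Function.support fun s => F.w t s * Real.exp (-s)) ∩ Ioi 0 = Ioi 0 := by
      apply inter_eq_right.2
      intro s hs
      exact (mul_pos (F.w_pos t s) (Real.exp_pos _)).ne'
    rw [this]; simp
  · filter_upwards with s
    exact (mul_pos (F.w_pos t s) (Real.exp_pos _)).le
  · exact F.integrableOn_w t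

theorem ball_abs_le {t u : ℝ} (hu : u ∈ Metric.ball t 1) : |u| ≤ |t| + 1 := by
  rw [Metric.mem_ball, Real.dist_eq] at hu
  have := abs_add_le (u - t) t
  rw [sub_add_cancel] at this
  linarith

theorem hasDerivAt_Z (t : ℝ) :
    HasDerivAt F.Z (∫ s in Ioi (0:ℝ), F.v t s * (F.w t s * Real.exp (-s))) t := by
  obtain ⟨M, hM, h⟩ := F.exists_growth (|t| + 1) (by positivity)
  have b1 : IntegrableOn (fun s => M * M * Real.exp (-(5 / 8) * s)) (Ioi 0) :=
    (exp_neg_integrableOn_Ioi 0 (by norm_num)).const_mul _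
  refine (hasDerivAt_integral_of_dominated_loc_of_deriv_le
    (F' := fun t s => F.v t s * (F.w t s * Real.exp (-s))) (Metric.ball_mem_nhds t one_pos)
    (Eventually.of_forall fun u => (F.integrableOn_w u).aestronglyMeasurable)
    (F.integrableOn_w t) (F.integrableOn_vw t).aestronglyMeasurable ?_ b1 ?_).2
  · filter_upwards [ae_restrict_mem measurableSet_Ioi] with s hs u hu
    have hs : 0 ≤ s := le_of_lt hs
    obtain ⟨h1, h2, h3⟩ := h u (ball_abs_le hu) s hs
    exact (growth_bounds hM hs (F.w_pos u s) h1 h2 h3).2.1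
  · filter_upwards with s u hu
    refine ((F.hasDerivAt_w_t u s).mul_const _).congr_deriv (by ring)

theorem hasDerivAt_Z' (t : ℝ) :
    HasDerivAt (fun t => ∫ s in Ioi (0:ℝ), F.v t s * (F.w t s * Real.exp (-s)))
      (∫ s in Ioi (0:ℝ), (F.g t s + F.v t s ^ 2) * (F.w t s * Real.exp (-s))) t := by
  obtain ⟨M, hM, h⟩ := F.exists_growth (|t| + 1) (by positivity)
  have b1 : IntegrableOn (fun s => (M + M ^ 2) * M * Real.exp (-(5 / 8) * s)) (Ioi 0) :=
    (exp_neg_integrableOn_Ioi 0 (by norm_num)).const_mul _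
  refine (hasDerivAt_integral_of_dominated_loc_of_deriv_le
    (F' := fun t s => (F.g t s + F.v t s ^ 2) * (F.w t s * Real.exp (-s)))
      (Metric.ball_mem_nhds t one_pos)
    (Eventually.of_forall fun u => (F.integrableOn_vw u).aestronglyMeasurable)
    (F.integrableOn_vw t) ?_ ?_ b1 ?_).2
  · have := F.continuousOn_w t
    have := F.continuousOn_v t
    have := F.continuousOn_g t
    refine ContinuousOn.aestronglyMeasurable (ContinuousOn.mono ?_ Ioi_subset_Ici_self)
      measurableSet_Ioi
    fun_prop
  · filter_upwards [ae_restrict_mem measurableSet_Ioi] with s hs u hu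
    have hs : 0 ≤ s := le_of_lt hs
    obtain ⟨h1, h2, h3⟩ := h u (ball_abs_le hu) s hs
    exact (growth_bounds hM hs (F.w_pos u s) h1 h2 h3).2.2
  · filter_upwards with s u hu
    refine ((F.hasDerivAt_v_t u s).fun_mul
      ((F.hasDerivAt_w_t u s).mul_const (Real.exp (-s)))).congr_deriv (by ring)

theorem second_deriv_le (J : ℕ) {t : ℝ} (hr : 0 < F.r₀ + F.ρ * t) :
    (∫ s in Ioi (0:ℝ), (F.g t s + F.v t s ^ 2) * (F.w t s * Real.exp (-s))) * F.Z t ≤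
      F.ρ ^ 2 * (∑ j ∈ Finset.range J, 1 / (F.r₀ + F.ρ * t + 1 + j) ^ 2
        + 1 / (F.r₀ + F.ρ * t + J)) * F.Z t ^ 2
      + (∫ s in Ioi (0:ℝ), F.v t s * (F.w t s * Real.exp (-s))) ^ 2 := by
  obtain ⟨M, hM, h⟩ := F.exists_growth |t| (abs_nonneg t)
  have cκ := F.continuousOn_avκ t
  refine variance_bound J (x := fun s => 1 / F.avκ t s) (dv := F.dv t) (dx := F.dx t) hr
    (F.continuousOn_w t) ?_
    (F.continuousOn_v t) (F.continuousOn_dv t) (F.continuousOn_dx t) (F.continuousOn_g t)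
    (fun s _ => F.w_pos t s) (fun s hs => one_div_pos.2 (F.avκ_pos t hs)) (fun s hs => ?_)
    (fun s hs => F.hasDerivAt_x t hs.le) (fun s hs => F.one_le_dx hr hs.le)
    (fun s hs => F.hasDerivAt_v_s t hs.le) (fun s hs u => F.hessian_le hr hs.le u)
    (fun s hs => (h t le_rfl s hs).1) (fun s hs => (h t le_rfl s hs).2.1)
    (fun s hs => (h t le_rfl s hs).2.2)
  · exact ContinuousOn.div continuousOn_const cκ fun s hs => (F.avκ_pos t hs).ne'
  · refine (F.hasDerivAt_w_s t hs.le).congr_deriv ?_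
    have := F.avκ_pos t hs.le
    field_simp

theorem concaveOn_log_Z_sub (h0 : 0 < F.r₀) (h1 : 0 < F.r₀ + F.ρ) (n : ℕ) :
    ConcaveOn ℝ (Icc 0 1) (fun t => Real.log (F.Z t)
      - Real.BohrMollerup.logGammaSeq (F.r₀ + F.ρ * t + 1) n
      - F.ρ ^ 2 / (n + 1) * (t ^ 2 / 2)) := by
  have rpos : ∀ t ∈ Icc (0:ℝ) 1, 0 < F.r₀ + F.ρ * t := by
    intro t ht
    have : F.r₀ + F.ρ * t = (1 - t) * F.r₀ + t * (F.r₀ + F.ρ) := by ring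
    rw [this]
    rcases eq_or_lt_of_le ht.1 with e | e
    · rw [← e]; simpa using h0
    · have : 0 ≤ (1 - t) * F.r₀ := mul_nonneg (by linarith [ht.2]) h0.le
      positivity
  obtain ⟨Z1, hZ1⟩ : ∃ f : ℝ → ℝ, f = fun t =>
    ∫ s in Ioi (0:ℝ), F.v t s * (F.w t s * Real.exp (-s)) := ⟨_, rfl⟩
  obtain ⟨Z2, hZ2⟩ : ∃ f : ℝ → ℝ, f = fun t =>
    ∫ s in Ioi (0:ℝ), (F.g t s + F.v t s ^ 2) * (F.w t s * Real.exp (-s)) := ⟨_, rfl⟩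
  have d1 : ∀ t, HasDerivAt F.Z (Z1 t) t := fun t => by rw [hZ1]; exact F.hasDerivAt_Z t
  have d2 : ∀ t, HasDerivAt Z1 (Z2 t) t := fun t => by rw [hZ1, hZ2]; exact F.hasDerivAt_Z' t
  have dlin : ∀ (k t : ℝ), HasDerivAt (fun t => F.r₀ + F.ρ * t + 1 + k) F.ρ t := fun k t => by
    refine (((((hasDerivAt_id t).const_mul F.ρ).const_add F.r₀).add_const 1).add_const
      k).congr_deriv (by simp)
  have D1 : ∀ t ∈ Icc (0:ℝ) 1, HasDerivAt (fun t => Real.log (F.Z t)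
      - Real.BohrMollerup.logGammaSeq (F.r₀ + F.ρ * t + 1) n
      - F.ρ ^ 2 / (n + 1) * (t ^ 2 / 2))
      (Z1 t / F.Z t - (F.ρ * Real.log n - ∑ m ∈ Finset.range (n + 1),
        F.ρ / (F.r₀ + F.ρ * t + 1 + m)) - F.ρ ^ 2 / (n + 1) * t) t := by
    intro t ht
    have hr := rpos t ht
    unfold Real.BohrMollerup.logGammaSeq
    have e1 := (d1 t).log (F.Z_pos t).ne'
    have e2 : HasDerivAt (fun t => F.r₀ + F.ρ * t + 1) F.ρ t := by
      refine ((((hasDerivAt_id t).const_mul F.ρ).const_add F.r₀).add_const 1).congr_deriv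
        (by simp)
    have e3 := HasDerivAt.fun_sum (u := Finset.range (n + 1))
      (fun m _ => (dlin m t).log (by positivity))
    have e4 := (((hasDerivAt_id t).fun_pow 2).div_const 2).const_mul (F.ρ ^ 2 / (n + 1))
    refine ((e1.fun_sub (((e2.mul_const (Real.log n)).add_const _).fun_sub e3)).fun_sub
      e4).congr_deriv ?_
    simp
  refine concaveOn_of_hasDerivWithinAt2_nonpos (convex_Icc 0 1)
    (f' := fun t => Z1 t / F.Z t - (F.ρ * Real.log n - ∑ m ∈ Finset.range (n + 1),
        F.ρ / (F.r₀ + F.ρ * t + 1 + m)) - F.ρ ^ 2 / (n + 1) * t)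
    (f'' := fun t => (Z2 t * F.Z t - Z1 t * Z1 t) / F.Z t ^ 2 + (∑ m ∈ Finset.range (n + 1),
        (-(F.ρ ^ 2 / (F.r₀ + F.ρ * t + 1 + m) ^ 2))) - F.ρ ^ 2 / (n + 1))
    (fun t ht => (D1 t ht).continuousAt.continuousWithinAt)
    (fun t ht => (D1 t (interior_subset ht)).hasDerivWithinAt) ?_ ?_
  · intro t ht
    have ht := interior_subset ht
    have hr := rpos t ht
    have e1 := (d2 t).fun_div (d1 t) (F.Z_pos t).ne'
    have e3 := HasDerivAt.fun_sum (u := Finset.range (n + 1))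
      (fun m _ => (hasDerivAt_const t F.ρ).fun_div (dlin m t)
        (by positivity : F.r₀ + F.ρ * t + 1 + (m:ℝ) ≠ 0))
    have e4 := (hasDerivAt_id t).const_mul (F.ρ ^ 2 / (n + 1))
    refine ((e1.fun_sub (e3.const_sub
      (F.ρ * Real.log n))).fun_sub e4).congr_deriv ?_ |>.hasDerivWithinAt
    rw [sub_neg_eq_add, mul_one]
    congr 2
    refine Finset.sum_congr rfl fun m _ => ?_
    ring
  · intro t ht
    have ht := interior_subset ht
    have hr := rpos t ht
    have hZ := F.Z_pos t
    have b := F.second_deriv_le (n + 1) hr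
    have b1 : (Z2 t * F.Z t - Z1 t * Z1 t) / F.Z t ^ 2 ≤
        F.ρ ^ 2 * (∑ j ∈ Finset.range (n + 1), 1 / (F.r₀ + F.ρ * t + 1 + j) ^ 2
        + 1 / (F.r₀ + F.ρ * t + (n + 1 : ℕ))) := by
      rw [div_le_iff₀ (by positivity)]
      simp only [hZ1, hZ2]
      linarith [b]
    have b2 : F.ρ ^ 2 * (1 / (F.r₀ + F.ρ * t + (n + 1 : ℕ))) ≤ F.ρ ^ 2 / (n + 1) := by
      rw [mul_one_div]
      push_cast
      exact div_le_div_of_nonneg_left (by positivity) (by positivity) (by linarith)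
    rw [Finset.sum_neg_distrib]
    have b3 : ∑ m ∈ Finset.range (n + 1), F.ρ ^ 2 / (F.r₀ + F.ρ * t + 1 + m) ^ 2 =
        F.ρ ^ 2 * ∑ j ∈ Finset.range (n + 1), 1 / (F.r₀ + F.ρ * t + 1 + j) ^ 2 := by
      rw [Finset.mul_sum]
      exact Finset.sum_congr rfl fun m _ => by ring
    simp only [b3]
    rw [mul_add] at b1
    linarith

theorem two_point (h0 : 0 < F.r₀) (h1 : 0 < F.r₀ + F.ρ) {α : ℝ} (hα : α ∈ Icc (0:ℝ) 1) :
    (1 - α) * (Real.log (F.Z 0) - Real.log (Real.Gamma (F.r₀ + 1)))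
      + α * (Real.log (F.Z 1) - Real.log (Real.Gamma (F.r₀ + F.ρ + 1))) ≤
    Real.log (F.Z α) - Real.log (Real.Gamma (F.r₀ + F.ρ * α + 1)) := by
  have rpos : 0 < F.r₀ + F.ρ * α := by
    have : F.r₀ + F.ρ * α = (1 - α) * F.r₀ + α * (F.r₀ + F.ρ) := by ring
    rw [this]
    rcases eq_or_lt_of_le hα.1 with e | e
    · rw [← e]; simpa using h0
    · have : 0 ≤ (1 - α) * F.r₀ := mul_nonneg (by linarith [hα.2]) h0.le
      positivity
  have lim : ∀ t, 0 < F.r₀ + F.ρ * t → Tendsto (fun n : ℕ => Real.log (F.Z t)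
      - Real.BohrMollerup.logGammaSeq (F.r₀ + F.ρ * t + 1) n
      - F.ρ ^ 2 / (n + 1) * (t ^ 2 / 2)) atTop
      (𝓝 (Real.log (F.Z t) - Real.log (Real.Gamma (F.r₀ + F.ρ * t + 1)) - 0)) := by
    intro t ht
    refine (tendsto_const_nhds.sub
      (Real.BohrMollerup.tendsto_log_gamma (by linarith))).sub ?_
    have := (tendsto_one_div_add_atTop_nhds_zero_nat (𝕜 := ℝ)).const_mul (F.ρ ^ 2 * (t ^ 2 / 2))
    rw [mul_zero] at this
    refine this.congr fun n => ?_
    ring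
  have L0 := (lim 0 (by simpa using h0)).const_mul (1 - α)
  have L1 := (lim 1 (by simpa using h1)).const_mul α
  have Lα := lim α rpos
  have := le_of_tendsto_of_tendsto' (L0.add L1) Lα fun n => by
    have c := (F.concaveOn_log_Z_sub h0 h1 n).2 (left_mem_Icc.2 zero_le_one)
      (right_mem_Icc.2 zero_le_one) (sub_nonneg.2 hα.2) hα.1 (by ring)
    simpa only [smul_eq_mul, mul_zero, mul_one, zero_add] using c
  simpa using this

end LogAffineFamily

theorem ConcaveOn.exists_supergradient {E : Type*} [NormedAddCommGroup E] [NormedSpace ℝ E]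
    [FiniteDimensional ℝ E] {D : Set E} {f : E → ℝ} (hf : ConcaveOn ℝ D f) {p : E}
    (hp : p ∈ interior D) : ∃ φ : E →L[ℝ] ℝ, ∀ x ∈ D, f x ≤ f p + φ (x - p) := by
  have hfi : ConcaveOn ℝ (interior D) f := hf.subset interior_subset hf.1.interior
  have hcont : ContinuousOn f (interior D) := hfi.continuousOn isOpen_interior
  have conv := hfi.convex_strict_hypograph
  have hopen : IsOpen {q : E × ℝ | q.1 ∈ interior D ∧ q.2 < f q.1} := by
    have h1 : ContinuousOn (fun q : E × ℝ => f q.1 - q.2) (Prod.fst ⁻¹' interior D) :=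
      (hcont.comp continuousOn_fst fun q hq => hq).sub continuousOn_snd
    have h2 := h1.isOpen_inter_preimage (isOpen_interior.preimage continuous_fst) isOpen_Ioi
      (t := Ioi 0)
    convert h2 using 1
    ext q
    simp
  obtain ⟨Φ, hΦ⟩ := geometric_hahn_banach_open_point conv hopen (x := (p, f p))
    (fun h => lt_irrefl _ h.2)
  set c := Φ (0, 1) with hc
  have hdec : ∀ x y, Φ (x, y) = Φ (x, 0) + y * c := fun x y => by
    have : ((x, y) : E × ℝ) = (x, 0) + y • (0, 1) := by simp
    rw [this, map_add, map_smul, smul_eq_mul]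
  have cpos : 0 < c := by
    have := hΦ (p, f p - 1) ⟨hp, by simp⟩
    rw [hdec p (f p - 1), hdec p (f p)] at this
    linarith
  have key : ∀ x ∈ interior D, Φ (x, 0) + f x * c ≤ Φ (p, 0) + f p * c := by
    intro x hx
    refine le_of_forall_pos_le_add fun ε hε => ?_
    have := hΦ (x, f x - ε / c) ⟨hx, sub_lt_self _ (by positivity)⟩
    rw [hdec x, hdec p (f p), sub_mul, div_mul_cancel₀ _ cpos.ne'] at this
    linarith
  refine ⟨-(1 / c) • Φ.comp (ContinuousLinearMap.inl ℝ E ℝ), ?_⟩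
  have lin : ∀ x, (-(1 / c) • Φ.comp (ContinuousLinearMap.inl ℝ E ℝ)) (x - p) =
      -(1 / c) * (Φ (x, 0) - Φ (p, 0)) := fun x => by
    rw [← map_sub]
    simp
  have inter : ∀ x ∈ interior D, f x ≤ f p +
      (-(1 / c) • Φ.comp (ContinuousLinearMap.inl ℝ E ℝ)) (x - p) := by
    intro x hx
    have := key x hx
    rw [lin]
    have h : (f x - f p) * c ≤ -(Φ (x, 0) - Φ (p, 0)) := by linarith
    rw [← le_div_iff₀ cpos] at h
    have e : -(Φ (x, 0) - Φ (p, 0)) / c = -(1 / c) * (Φ (x, 0) - Φ (p, 0)) := by ring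
    linarith
  intro x hx
  have hD := hf.1.combo_interior_closure_mem_interior hp (subset_closure hx) (a := 1 / 2)
    (b := 1 / 2)
    (by norm_num) (by norm_num) (by norm_num)
  have h1 := inter _ hD
  have h2 := hf.2 (interior_subset hp) hx (show (0 : ℝ) ≤ 1 / 2 by norm_num)
    (show (0 : ℝ) ≤ 1 / 2 by norm_num) (by norm_num)
  have e : (1 / 2 : ℝ) • p + (1 / 2 : ℝ) • x - p = (1 / 2 : ℝ) • (x - p) := by
    rw [smul_sub]
    have : p = (1 / 2 : ℝ) • p + (1 / 2 : ℝ) • p := by rw [← add_smul]; norm_num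
    nth_rewrite 2 [this]
    abel
  rw [e, map_smul] at h1
  simp only [smul_eq_mul] at h1 h2
  linarith

/-- The perspective-type function whose concavity is the hypothesis on a log-profile `W`. -/
noncomputable def profileFun (r₀ ρ : ℝ) (W : ℝ → ℝ → ℝ) (p : ℝ × ℝ × ℝ) : ℝ :=
  W p.1 (p.2.1 / p.2.2) + (r₀ + ρ * p.1) * Real.log p.2.2
    - (r₀ + ρ * p.1) * Real.log (r₀ + ρ * p.1)

theorem exists_logAffine_tangent {r₀ ρ : ℝ} {W : ℝ → ℝ → ℝ} (h0 : 0 < r₀) (h1 : 0 < r₀ + ρ)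
    (conc : ConcaveOn ℝ (Icc 0 1 ×ˢ Ioi 0 ×ˢ Ioi 0) (profileFun r₀ ρ W))
    {α σ : ℝ} (hα : α ∈ Ioo (0:ℝ) 1) (hσ : 0 < σ) : ∃ c β l k : ℝ, 0 ≤ l ∧ 0 ≤ k ∧
      (∀ t ∈ Icc (0:ℝ) 1, ∀ s, 0 < s → 0 < l * s + k ∧
        W t s ≤ c + β * t + (r₀ + ρ * t) * Real.log (l * s + k)) ∧
      c + β * α + (r₀ + ρ * α) * Real.log (l * σ + k) ≤ W α σ := by
  have rpos : ∀ t ∈ Icc (0:ℝ) 1, 0 < r₀ + ρ * t := by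
    intro t ht
    have : r₀ + ρ * t = (1 - t) * r₀ + t * (r₀ + ρ) := by ring
    rw [this]
    rcases eq_or_lt_of_le ht.1 with e | e
    · rw [← e]; simpa using h0
    · have : 0 ≤ (1 - t) * r₀ := mul_nonneg (by linarith [ht.2]) h0.le
      positivity
  have hαI : α ∈ Icc (0:ℝ) 1 := Ioo_subset_Icc_self hα
  have hp : ((α, σ, 1) : ℝ × ℝ × ℝ) ∈ interior (Icc (0:ℝ) 1 ×ˢ Ioi (0:ℝ) ×ˢ Ioi (0:ℝ)) := by
    rw [interior_prod_eq, interior_prod_eq, interior_Icc, interior_Ioi]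
    exact ⟨hα, hσ, zero_lt_one (α := ℝ)⟩
  obtain ⟨φ, hφ⟩ := conc.exists_supergradient hp
  set β := φ (1, 0, 0) with hβ
  set l := φ (0, 1, 0) with hl
  set k := φ (0, 0, 1) with hk
  have dec : ∀ t s z : ℝ, φ (t, s, z) = β * t + l * s + k * z := fun t s z => by
    have : ((t, s, z) : ℝ × ℝ × ℝ) = t • (1, 0, 0) + s • (0, 1, 0) + z • (0, 0, 1) := by simp
    rw [this, map_add, map_add, map_smul, map_smul, map_smul]
    simp only [smul_eq_mul]
    ring
  set A := W α σ - (r₀ + ρ * α) * Real.log (r₀ + ρ * α) - β * α - l * σ - k with hA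
  have sup : ∀ t ∈ Icc (0:ℝ) 1, ∀ s z, 0 < s → 0 < z → W t s + (r₀ + ρ * t) * Real.log z
      - (r₀ + ρ * t) * Real.log (r₀ + ρ * t) ≤ A + β * t + (l * s + k) * z := by
    intro t ht s z hs hz
    have := hφ (t, s * z, z) ⟨ht, mul_pos hs hz, hz⟩
    simp only [profileFun, Prod.mk_sub_mk, dec, div_one, Real.log_one, mul_zero, add_zero,
      mul_div_cancel_right₀ _ hz.ne'] at this
    linarith
  have rα := rpos α hαI
  have hpos : ∀ s, 0 < s → 0 < l * s + k := by
    intro s hs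
    by_contra hneg
    push Not at hneg
    obtain ⟨z, hz, hz2⟩ : ∃ z : ℝ, 0 < z ∧ A + β * α + (r₀ + ρ * α) * Real.log (r₀ + ρ * α)
        - W α s + 1 ≤ (r₀ + ρ * α) * Real.log z := by
      refine ⟨Real.exp ((A + β * α + (r₀ + ρ * α) * Real.log (r₀ + ρ * α)
        - W α s + 1) / (r₀ + ρ * α)), Real.exp_pos _, ?_⟩
      rw [Real.log_exp, mul_div_cancel₀ _ rα.ne']
    have := sup α hαI s z hs hz
    have h3 : (l * s + k) * z ≤ 0 := mul_nonpos_of_nonpos_of_nonneg hneg hz.le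
    linarith
  have kn : 0 ≤ k := by
    by_contra hneg
    push Not at hneg
    have a1 : 0 < -k / (2 * (|l| + 1)) := div_pos (by linarith) (by positivity)
    have := hpos _ a1
    have a2 : l * (-k / (2 * (|l| + 1))) ≤ (|l| + 1) * (-k / (2 * (|l| + 1))) := by
      apply mul_le_mul_of_nonneg_right _ a1.le
      linarith [le_abs_self l]
    have a3 : (|l| + 1) * (-k / (2 * (|l| + 1))) = -k / 2 := by
      have : |l| + 1 ≠ 0 := by positivity
      field_simp
    linarith
  have ln : 0 ≤ l := by
    by_contra hneg
    push Not at hneg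
    have a1 : 0 < (k + 1) / (-l) := div_pos (by linarith) (by linarith)
    have := hpos _ a1
    have a3 : l * ((k + 1) / (-l)) = -(k + 1) := by
      have : l ≠ 0 := hneg.ne
      field_simp
    linarith
  refine ⟨A + r₀, β + ρ, l, k, ln, kn, fun t ht s hs => ⟨hpos s hs, ?_⟩, ?_⟩
  · have rt := rpos t ht
    have := sup t ht s ((r₀ + ρ * t) / (l * s + k)) hs (div_pos rt (hpos s hs))
    rw [Real.log_div rt.ne' (hpos s hs).ne', mul_div_cancel₀ _ (hpos s hs).ne'] at this
    linarith
  · have hx := hpos σ hσ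
    have := Real.log_le_sub_one_of_pos (div_pos hx rα)
    rw [Real.log_div hx.ne' rα.ne'] at this
    have h3 := mul_le_mul_of_nonneg_left this rα.le
    have h4 : (r₀ + ρ * α) * ((l * σ + k) / (r₀ + ρ * α) - 1) = l * σ + k - (r₀ + ρ * α) := by
      field_simp
    rw [h4] at h3
    linarith

theorem affine_pos_of_mem_Icc {r₀ ρ t : ℝ} (h0 : 0 < r₀) (h1 : 0 < r₀ + ρ) (ht : t ∈ Icc (0:ℝ) 1) :
    0 < r₀ + ρ * t := by
  have : r₀ + ρ * t = (1 - t) * r₀ + t * (r₀ + ρ) := by ring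
  rw [this]
  rcases eq_or_lt_of_le ht.1 with e | e
  · rw [← e]; simpa using h0
  · have : 0 ≤ (1 - t) * r₀ := mul_nonneg (by linarith [ht.2]) h0.le
    positivity

theorem continuousOn_of_profileFun_concave {r₀ ρ : ℝ} {W : ℝ → ℝ → ℝ}
    (conc : ConcaveOn ℝ (Icc 0 1 ×ˢ Ioi 0 ×ˢ Ioi 0) (profileFun r₀ ρ W)) {t : ℝ}
    (ht : t ∈ Icc (0:ℝ) 1) : ContinuousOn (W t) (Ioi 0) := by
  apply ConcaveOn.continuousOn isOpen_Ioi
  refine ⟨convex_Ioi 0, fun x hx y hy a b ha hb hab => ?_⟩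
  have mem : ∀ z ∈ Ioi (0:ℝ), ((t, z, 1) : ℝ × ℝ × ℝ) ∈ Icc (0:ℝ) 1 ×ˢ Ioi (0:ℝ) ×ˢ Ioi (0:ℝ) :=
    fun z hz => ⟨ht, hz, zero_lt_one (α := ℝ)⟩
  have := conc.2 (mem x hx) (mem y hy) ha hb hab
  simp only [profileFun, Prod.smul_mk, Prod.mk_add_mk, smul_eq_mul, mul_one, div_one, hab,
    ← add_mul, one_mul, Real.log_one, mul_zero, add_zero] at this
  simp only [smul_eq_mul]
  have e : a * (W t x - (r₀ + ρ * t) * Real.log (r₀ + ρ * t)) + b * (W t y -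
    (r₀ + ρ * t) * Real.log (r₀ + ρ * t)) = a * W t x + b * W t y -
    (a + b) * ((r₀ + ρ * t) * Real.log (r₀ + ρ * t)) := by ring
  rw [e, hab] at this
  linarith

theorem integral_Ioi_mul_exp_pos {f : ℝ → ℝ} (hf : ∀ s, 0 < s → 0 < f s)
    (hi : IntegrableOn f (Ioi 0)) : 0 < ∫ s in Ioi (0:ℝ), f s := by
  rw [setIntegral_pos_iff_support_of_nonneg_ae]
  · have : Function.support f ∩ Ioi 0 = Ioi 0 := by
      apply inter_eq_right.2
      intro s hs
      exact (hf s hs).ne'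
    rw [this]; simp
  · filter_upwards [ae_restrict_mem measurableSet_Ioi] with s hs
    exact (hf s hs).le
  · exact hi

theorem laplace_two_point {r₀ ρ : ℝ} {W : ℝ → ℝ → ℝ} (h0 : 0 < r₀) (h1 : 0 < r₀ + ρ)
    (conc : ConcaveOn ℝ (Icc 0 1 ×ˢ Ioi 0 ×ˢ Ioi 0) (profileFun r₀ ρ W))
    {α : ℝ} (hα : α ∈ Ioo (0:ℝ) 1) :
    (∀ t ∈ Icc (0:ℝ) 1, IntegrableOn (fun s => Real.exp (W t s) * Real.exp (-s)) (Ioi 0)) ∧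
    (1 - α) * (Real.log (∫ s in Ioi (0:ℝ), Real.exp (W 0 s) * Real.exp (-s))
        - Real.log (Real.Gamma (r₀ + 1)))
      + α * (Real.log (∫ s in Ioi (0:ℝ), Real.exp (W 1 s) * Real.exp (-s))
        - Real.log (Real.Gamma (r₀ + ρ + 1))) ≤
    Real.log (∫ s in Ioi (0:ℝ), Real.exp (W α s) * Real.exp (-s))
      - Real.log (Real.Gamma (r₀ + ρ * α + 1)) := by
  have hαI : α ∈ Icc (0:ℝ) 1 := Ioo_subset_Icc_self hα
  have m0 : (0:ℝ) ∈ Icc (0:ℝ) 1 := left_mem_Icc.2 zero_le_one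
  have m1 : (1:ℝ) ∈ Icc (0:ℝ) 1 := right_mem_Icc.2 zero_le_one
  have : Nonempty (Ioi (0:ℝ)) := ⟨⟨1, zero_lt_one (α := ℝ)⟩⟩
  set q : ℕ → Ioi (0:ℝ) := TopologicalSpace.denseSeq (Ioi (0:ℝ)) with hq
  have hqd : DenseRange q := TopologicalSpace.denseRange_denseSeq _
  have htan := fun n => exists_logAffine_tangent h0 h1 conc hα (q n).2
  choose c β l k ln kn up tg using htan
  have ηpos : ∀ J : ℕ, (0:ℝ) < 1 / (J + 1) := fun J => by positivity
  set F : ∀ J : ℕ, LogAffineFamily (Fin (J + 1)) := fun J =>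
    { c := fun j => c j, β := fun j => β j, l := fun j => l j + 1 / (J + 1)
      m := fun j => k j + 1 / (J + 1), r₀ := r₀, ρ := ρ, ε := 1 / (J + 1) ^ 2
      lpos := fun j => add_pos_of_nonneg_of_pos (ln j) (ηpos J)
      mpos := fun j => add_pos_of_nonneg_of_pos (kn j) (ηpos J)
      εpos := by positivity } with hF
  have hεlog : ∀ J : ℕ, (F J).ε * Real.log (Fintype.card (Fin (J + 1))) ≤ 1 / (J + 1) := by
    intro J
    simp only [hF, Fintype.card_fin]
    have : Real.log ((J + 1 : ℕ) : ℝ) ≤ J + 1 := by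
      have := Real.log_le_sub_one_of_pos (show (0:ℝ) < ((J + 1 : ℕ) : ℝ) by positivity)
      push_cast at this ⊢
      linarith
    calc 1 / ((J:ℝ) + 1) ^ 2 * Real.log ((J + 1 : ℕ) : ℝ) ≤ 1 / ((J:ℝ) + 1) ^ 2 * (J + 1) := by
          gcongr
      _ = _ := by field_simp
  have low : ∀ J : ℕ, ∀ t ∈ Icc (0:ℝ) 1, ∀ s, 0 < s →
      Real.exp (-(1 / ((J:ℝ) + 1))) * Real.exp (W t s) ≤ (F J).w t s := by
    intro J t ht s hs
    have hb : ∀ j, W t s ≤ (F J).T j t s := by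
      intro j
      obtain ⟨p, h⟩ := up j t ht s hs
      refine h.trans ?_
      have := affine_pos_of_mem_Icc h0 h1 ht
      simp only [LogAffineFamily.T, LogAffineFamily.y, hF]
      have := ηpos J
      gcongr
      · linarith
      · linarith
    refine le_trans ?_ ((F J).le_w hb)
    rw [← Real.exp_add]
    apply Real.exp_le_exp.2
    linarith [hεlog J]
  have cW : ∀ t ∈ Icc (0:ℝ) 1, ContinuousOn (W t) (Ioi 0) := fun t ht =>
    continuousOn_of_profileFun_concave conc ht
  have int : ∀ t ∈ Icc (0:ℝ) 1,
      IntegrableOn (fun s => Real.exp (W t s) * Real.exp (-s)) (Ioi 0) := by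
    intro t ht
    refine Integrable.mono' (((F 0).integrableOn_w t).const_mul (Real.exp 1)) ?_ ?_
    · have := cW t ht
      exact ContinuousOn.aestronglyMeasurable (by fun_prop) measurableSet_Ioi
    · filter_upwards [ae_restrict_mem measurableSet_Ioi] with s hs
      have := low 0 t ht s hs
      rw [Real.norm_eq_abs, abs_of_pos (by positivity), ← mul_assoc]
      gcongr
      simp only [Nat.cast_zero, zero_add, div_one] at this
      calc Real.exp (W t s) = Real.exp 1 * (Real.exp (-1) * Real.exp (W t s)) := by
            rw [← mul_assoc, ← Real.exp_add]; simp
        _ ≤ _ := by gcongr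
  refine ⟨int, ?_⟩
  have Zlow : ∀ J : ℕ, ∀ t ∈ Icc (0:ℝ) 1, Real.log (∫ s in Ioi (0:ℝ),
      Real.exp (W t s) * Real.exp (-s)) - 1 / ((J:ℝ) + 1) ≤ Real.log ((F J).Z t) := by
    intro J t ht
    have p1 := integral_Ioi_mul_exp_pos (fun s _ => by positivity) (int t ht)
    have : Real.exp (-(1 / ((J:ℝ) + 1))) * ∫ s in Ioi (0:ℝ), Real.exp (W t s) * Real.exp (-s)
        ≤ (F J).Z t := by
      unfold LogAffineFamily.Z
      rw [← MeasureTheory.integral_const_mul]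
      refine setIntegral_mono_on ((int t ht).const_mul _) ((F J).integrableOn_w t)
        measurableSet_Ioi fun s hs => ?_
      rw [← mul_assoc]
      have := low J t ht s hs
      gcongr
    have := Real.log_le_log (by positivity) this
    rw [Real.log_mul (Real.exp_pos _).ne' p1.ne', Real.log_exp] at this
    linarith
  set f : ℕ → ℝ → ℝ := fun J s => max ((F J).w α s) (Real.exp (W α s)) with hf
  have rα := affine_pos_of_mem_Icc h0 h1 hαI
  have Tlim : ∀ s, 0 < s → Tendsto (fun J => f J s) atTop (𝓝 (Real.exp (W α s))) := by
    intro s hs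
    rw [tendsto_order]
    refine ⟨fun a ha => Eventually.of_forall fun J => ha.trans_le (le_max_right _ _),
      fun a ha => ?_⟩
    have c1 : ContinuousAt (fun u => Real.exp (W α u)) s :=
      ((cW α hαI).continuousAt (Ioi_mem_nhds hs)).rexp
    have ev := c1.eventually (gt_mem_nhds ha)
    obtain ⟨δ, hδ, hball⟩ := Metric.eventually_nhds_iff.1 ev
    have hopen : IsOpen {x : Ioi (0:ℝ) | (x:ℝ) ∈ Ioo s (s + δ)} :=
      isOpen_Ioo.preimage continuous_subtype_val
    obtain ⟨j, hj⟩ := hqd.exists_mem_open hopen ⟨⟨s + δ / 2, by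
      show (0:ℝ) < _
      positivity⟩, by
      constructor
      · show s < s + δ / 2
        linarith
      · show s + δ / 2 < s + δ
        linarith⟩
    have hWq : Real.exp (W α (q j)) < a := hball (by
      rw [Real.dist_eq, abs_of_pos (by linarith [hj.1])]
      linarith [hj.2])
    have pj := (up j α hαI s hs).1
    have hlim : Tendsto (fun J : ℕ => Real.exp (c j + β j * α + (r₀ + ρ * α) *
        Real.log ((l j + 1 / ((J:ℝ) + 1)) * s + (k j + 1 / ((J:ℝ) + 1))))) atTop
        (𝓝 (Real.exp (c j + β j * α + (r₀ + ρ * α) *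
          Real.log ((l j + 0) * s + (k j + 0))))) := by
      have hz := tendsto_one_div_add_atTop_nhds_zero_nat (𝕜 := ℝ)
      refine (Real.continuous_exp.tendsto _).comp (tendsto_const_nhds.add
        (Tendsto.const_mul _ (Tendsto.log ?_ (by simpa using pj.ne'))))
      exact ((hz.const_add _).mul_const _).add (hz.const_add _)
    have hlt : Real.exp (c j + β j * α + (r₀ + ρ * α) *
          Real.log ((l j + 0) * s + (k j + 0))) < a := by
      refine lt_of_le_of_lt (Real.exp_le_exp.2 ?_) hWq
      refine le_trans ?_ (tg j)
      rw [add_zero, add_zero]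
      have := ln j
      have hs' := hj.1.le
      gcongr
    filter_upwards [hlim.eventually (gt_mem_nhds hlt), eventually_ge_atTop j] with J hJ hjJ
    refine max_lt ?_ ha
    refine lt_of_le_of_lt ((F J).w_le α s ⟨j, by omega⟩) ?_
    simpa only [LogAffineFamily.T, LogAffineFamily.y, hF] using hJ
  have dom : ∀ J, ∀ s, 0 < s → f J s ≤ Real.exp 1 * (F 0).w α s := by
    intro J s hs
    have a1 : Real.exp ((F 0).T 0 α s) ≤ (F 0).w α s := by
      have := (F 0).le_w (t := α) (s := s) (b := (F 0).T 0 α s)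
        (fun j => by
          obtain rfl : j = 0 := Fin.ext (by have := j.2; simp only [Fin.val_zero]; omega)
          exact le_rfl)
      simpa using this
    have a2 : (F J).w α s ≤ (F 0).w α s := by
      refine ((F J).w_le α s 0).trans (le_trans (Real.exp_le_exp.2 ?_) a1)
      simp only [LogAffineFamily.T, LogAffineFamily.y, hF, Fin.val_zero, Fin.val_zero,
        Nat.cast_zero, zero_add]
      have b1 : 1 / ((J:ℝ) + 1) ≤ 1 / 1 :=
        one_div_le_one_div_of_le one_pos (by linarith [Nat.cast_nonneg (α := ℝ) J])
      have b2 := ln 0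
      have b3 := kn 0
      have b4 := ηpos J
      have b5 : 0 < (l 0 + 1 / ((J:ℝ) + 1)) * s + (k 0 + 1 / ((J:ℝ) + 1)) := by positivity
      gcongr
    have a3 : (F 0).w α s ≤ Real.exp 1 * (F 0).w α s :=
      le_mul_of_one_le_left ((F 0).w_pos α s).le (Real.one_le_exp zero_le_one)
    refine max_le (a2.trans a3) ?_
    have := low 0 α hαI s hs
    simp only [Nat.cast_zero, zero_add, div_one] at this
    calc Real.exp (W α s) = Real.exp 1 * (Real.exp (-1) * Real.exp (W α s)) := by
          rw [← mul_assoc, ← Real.exp_add]; simp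
      _ ≤ _ := by gcongr
  have fpos : ∀ J s, 0 < f J s := fun J s => lt_max_of_lt_right (Real.exp_pos _)
  have fmeas : ∀ J, AEStronglyMeasurable (fun s => f J s * Real.exp (-s))
      (volume.restrict (Ioi (0:ℝ))) := by
    intro J
    have e1 := cW α hαI
    have e2 := ((F J).continuousOn_w α).mono Ioi_subset_Ici_self
    refine ContinuousOn.aestronglyMeasurable (ContinuousOn.mul ?_ (by fun_prop)) measurableSet_Ioi
    exact ContinuousOn.sup (show ContinuousOn ((F J).w α) (Ioi 0) from e2) e1.rexp
  have fint : ∀ J, IntegrableOn (fun s => f J s * Real.exp (-s)) (Ioi 0) := by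
    intro J
    refine Integrable.mono' (((F 0).integrableOn_w α).const_mul (Real.exp 1)) (fmeas J) ?_
    filter_upwards [ae_restrict_mem measurableSet_Ioi] with s hs
    rw [Real.norm_eq_abs, abs_of_pos (mul_pos (fpos J s) (Real.exp_pos _)), ← mul_assoc]
    gcongr
    exact dom J s hs
  have flim : Tendsto (fun J => ∫ s in Ioi (0:ℝ), f J s * Real.exp (-s)) atTop
      (𝓝 (∫ s in Ioi (0:ℝ), Real.exp (W α s) * Real.exp (-s))) := by
    refine tendsto_integral_of_dominated_convergence
      (fun s => Real.exp 1 * ((F 0).w α s * Real.exp (-s))) fmeas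
      (((F 0).integrableOn_w α).const_mul (Real.exp 1)) (fun J => ?_) ?_
    · filter_upwards [ae_restrict_mem measurableSet_Ioi] with s hs
      rw [Real.norm_eq_abs, abs_of_pos (mul_pos (fpos J s) (Real.exp_pos _)), ← mul_assoc]
      gcongr
      exact dom J s hs
    · filter_upwards [ae_restrict_mem measurableSet_Ioi] with s hs
      exact (Tlim s hs).mul_const _
  have ipos := integral_Ioi_mul_exp_pos (fun s _ => by positivity) (int α hαI)
  have L1 := (flim.log ipos.ne').sub_const (Real.log (Real.Gamma (r₀ + ρ * α + 1)))
  have L0 : Tendsto (fun J : ℕ =>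
      (1 - α) * (Real.log (∫ s in Ioi (0:ℝ), Real.exp (W 0 s) * Real.exp (-s))
        - 1 / ((J:ℝ) + 1) - Real.log (Real.Gamma (r₀ + 1)))
      + α * (Real.log (∫ s in Ioi (0:ℝ), Real.exp (W 1 s) * Real.exp (-s))
        - 1 / ((J:ℝ) + 1) - Real.log (Real.Gamma (r₀ + ρ + 1)))) atTop (𝓝 (
      (1 - α) * (Real.log (∫ s in Ioi (0:ℝ), Real.exp (W 0 s) * Real.exp (-s))
        - 0 - Real.log (Real.Gamma (r₀ + 1)))
      + α * (Real.log (∫ s in Ioi (0:ℝ), Real.exp (W 1 s) * Real.exp (-s))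
        - 0 - Real.log (Real.Gamma (r₀ + ρ + 1))))) := by
    have hz := tendsto_one_div_add_atTop_nhds_zero_nat (𝕜 := ℝ)
    exact (((hz.const_sub _).sub_const _).const_mul _).add
      (((hz.const_sub _).sub_const _).const_mul _)
  have := le_of_tendsto_of_tendsto' L0 L1 fun J => by
    have tp := (F J).two_point h0 h1 hαI
    have z0 := Zlow J 0 m0
    have z1 := Zlow J 1 m1
    have zα : Real.log ((F J).Z α) ≤ Real.log (∫ s in Ioi (0:ℝ), f J s * Real.exp (-s)) := by
      refine Real.log_le_log ((F J).Z_pos α) ?_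
      unfold LogAffineFamily.Z
      refine setIntegral_mono_on ((F J).integrableOn_w α) (fint J)
        measurableSet_Ioi fun s hs => ?_
      gcongr
      exact le_max_left _ _
    have g1 : 0 ≤ 1 - α := by linarith [hα.2]
    have g2 := hα.1.le
    refine le_trans ?_ (tp.trans (sub_le_sub_right zα _))
    have y1 : (F J).r₀ = r₀ := rfl
    have y2 : (F J).ρ = ρ := rfl
    rw [y1, y2]
    gcongr
  simpa only [sub_zero] using this

section

open scoped ENNReal

theorem volume_add_le_of_add_mem {A B S : Set ℝ} (hA : MeasurableSet A) (hB : MeasurableSet B)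
    (nA : A.Nonempty) (nB : B.Nonempty) (h : ∀ x ∈ A, ∀ y ∈ B, x + y ∈ S) :
    volume A + volume B ≤ volume S := by
  obtain ⟨a₀, ha₀⟩ := nA
  obtain ⟨b₀, hb₀⟩ := nB
  by_cases zA : volume A = 0
  · rw [zA, zero_add, ← measure_preimage_add volume (-a₀) B]
    exact measure_mono fun y hy => by simpa using h a₀ ha₀ _ hy
  by_cases zB : volume B = 0
  · rw [zB, add_zero, ← measure_preimage_add volume (-b₀) A]
    exact measure_mono fun y hy => by simpa [add_comm, add_left_comm] using h _ hy b₀ hb₀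
  refine le_of_forall_lt fun c hc => ?_
  obtain ⟨u, hu, v, hv, huv⟩ := ENNReal.exists_lt_add_of_lt_add hc zA zB
  obtain ⟨K, KA, cK, hK⟩ := hA.exists_lt_isCompact hu
  obtain ⟨L, LB, cL, hL⟩ := hB.exists_lt_isCompact hv
  have nK : K.Nonempty := nonempty_of_measure_ne_zero ((zero_le).trans_lt hK).ne'
  have nL : L.Nonempty := nonempty_of_measure_ne_zero ((zero_le).trans_lt hL).ne'
  obtain ⟨a, aK, ha⟩ := cK.exists_isGreatest nK
  obtain ⟨b, bL, hb⟩ := cL.exists_isLeast nL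
  have m1 : volume ((fun x => -b + x) ⁻¹' K) = volume K := measure_preimage_add volume (-b) K
  have m2 : volume ((fun x => -a + x) ⁻¹' L) = volume L := measure_preimage_add volume (-a) L
  have dis : AEDisjoint volume ((fun x => -b + x) ⁻¹' K) ((fun x => -a + x) ⁻¹' L) := by
    refine measure_mono_null (t := {a + b}) (fun x hx => ?_) (by simp)
    have h1 := ha hx.1
    have h2 := hb hx.2
    rw [mem_singleton_iff]
    simp only at h1 h2
    linarith
  calc c < volume K + volume L := huv.trans_le (by gcongr)
    _ = volume (((fun x => -b + x) ⁻¹' K) ∪ ((fun x => -a + x) ⁻¹' L)) := by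
        rw [measure_union₀ _ dis, m1, m2]
        exact ((measurable_const_add _) cL.measurableSet).nullMeasurableSet
    _ ≤ volume S := by
        refine measure_mono ?_
        rintro x (hx | hx)
        · have := h _ (KA hx) b (LB bL); simpa [add_comm, add_left_comm] using this
        · have := h a (KA aK) _ (LB hx); simpa using this

theorem volume_smul_add_smul_le {A B S : Set ℝ} {β γ : ℝ} (hβ : 0 < β) (hγ : 0 < γ)
    (hA : MeasurableSet A) (hB : MeasurableSet B)
    (nA : A.Nonempty) (nB : B.Nonempty) (h : ∀ x ∈ A, ∀ y ∈ B, β * x + γ * y ∈ S) :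
    ENNReal.ofReal β * volume A + ENNReal.ofReal γ * volume B ≤ volume S := by
  have e : ∀ {c : ℝ}, 0 < c → ∀ X : Set ℝ, volume ((fun x => c⁻¹ * x) ⁻¹' X)
      = ENNReal.ofReal c * volume X := by
    intro c hc X
    rw [Real.volume_preimage_mul_left (inv_ne_zero hc.ne'), inv_inv, abs_of_pos hc]
  rw [← e hβ, ← e hγ]
  refine volume_add_le_of_add_mem (measurable_const_mul _ hA) (measurable_const_mul _ hB) ?_ ?_ ?_
  · obtain ⟨x, hx⟩ := nA
    exact ⟨β * x, by simpa [hβ.ne'] using hx⟩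
  · obtain ⟨x, hx⟩ := nB
    exact ⟨γ * x, by simpa [hγ.ne'] using hx⟩
  · intro x hx y hy
    have := h _ hx _ hy
    simpa [hβ.ne', hγ.ne'] using this

theorem ENNReal.rpow_mul_rpow_le_add {β γ : ℝ} (hβ : 0 < β) (hγ : 0 < γ) (hβγ : β + γ = 1)
    (x y : ℝ≥0∞) : x ^ β * y ^ γ ≤ ENNReal.ofReal β * x + ENNReal.ofReal γ * y := by
  have b0 : ENNReal.ofReal β ≠ 0 := by simpa using hβ
  have g0 : ENNReal.ofReal γ ≠ 0 := by simpa using hγ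
  by_cases hx : x = ∞
  · rw [hx, ENNReal.mul_top b0, top_add]; exact le_top
  by_cases hy : y = ∞
  · rw [hy, ENNReal.mul_top g0, add_top]; exact le_top
  lift x to NNReal using hx
  lift y to NNReal using hy
  have := Real.geom_mean_le_arith_mean2_weighted hβ.le hγ.le x.2 y.2 hβγ
  rw [← ENNReal.ofReal_coe_nnreal, ← ENNReal.ofReal_coe_nnreal,
    ENNReal.ofReal_rpow_of_nonneg x.coe_nonneg hβ.le,
    ENNReal.ofReal_rpow_of_nonneg y.coe_nonneg hγ.le,
    ← ENNReal.ofReal_mul (by positivity), ← ENNReal.ofReal_mul hβ.le, ← ENNReal.ofReal_mul hγ.le,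
    ← ENNReal.ofReal_add (by positivity) (by positivity)]
  exact ENNReal.ofReal_le_ofReal this

theorem lintegral_add_le_of_normalized {f g h : ℝ → ℝ} {β γ : ℝ} (hβ : 0 < β) (hγ : 0 < γ)
    (hβγ : β + γ = 1) (mf : Measurable f) (mg : Measurable g) (mh : Measurable h)
    (f0 : ∀ x, 0 ≤ f x) (g0 : ∀ x, 0 ≤ g x) (h0 : ∀ x, 0 ≤ h x)
    (f1 : ∀ x, f x ≤ 1) (g1 : ∀ x, g x ≤ 1)
    (fs : ∀ l < 1, ∃ x, l < f x) (gs : ∀ l < 1, ∃ x, l < g x)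
    (H : ∀ x y, f x ^ β * g y ^ γ ≤ h (β * x + γ * y)) :
    ENNReal.ofReal β * (∫⁻ x, ENNReal.ofReal (f x)) + ENNReal.ofReal γ *
      (∫⁻ x, ENNReal.ofReal (g x)) ≤ ∫⁻ x, ENNReal.ofReal (h x) := by
  have cake : ∀ {k : ℝ → ℝ}, Measurable k → (∀ x, 0 ≤ k x) →
      ∫⁻ x, ENNReal.ofReal (k x) = ∫⁻ t in Ioi 0, volume {x | t < k x} := fun mk k0 =>
    lintegral_eq_lintegral_meas_lt _ (Eventually.of_forall k0) mk.aemeasurable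
  have mm : ∀ k : ℝ → ℝ, Measurable fun t : ℝ => volume {x | t < k x} := fun k =>
    Antitone.measurable fun a b hab => measure_mono fun x hx => lt_of_le_of_lt hab hx
  rw [cake mf f0, cake mg g0, cake mh h0, ← lintegral_const_mul _ (mm f),
    ← lintegral_const_mul _ (mm g), ← lintegral_add_left ((mm f).const_mul _)]
  refine setLIntegral_mono (mm h) fun t ht => ?_
  have ht : 0 < t := ht
  by_cases t1 : t < 1
  · refine volume_smul_add_smul_le hβ hγ (measurableSet_lt measurable_const mf)
      (measurableSet_lt measurable_const mg) (fs t t1) (gs t t1) fun x hx y hy => ?_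
    have hx : t < f x := hx
    have hy : t < g y := hy
    refine lt_of_lt_of_le ?_ (H x y)
    calc t = t ^ β * t ^ γ := by rw [← Real.rpow_add ht, hβγ, Real.rpow_one]
      _ < f x ^ β * g y ^ γ := by
        have := Real.rpow_lt_rpow ht.le hx hβ
        have := Real.rpow_lt_rpow ht.le hy hγ
        have := Real.rpow_pos_of_pos ht β
        have := Real.rpow_pos_of_pos ht γ
        gcongr
  · have e1 : {x | t < f x} = ∅ := eq_empty_of_forall_notMem fun x hx =>
      t1 (lt_of_lt_of_le hx (f1 x))
    have e2 : {x | t < g x} = ∅ := eq_empty_of_forall_notMem fun x hx =>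
      t1 (lt_of_lt_of_le hx (g1 x))
    simp [e1, e2]

theorem prekopa_leindler_of_bounded {f g h : ℝ → ℝ≥0∞} {β γ : ℝ} (hβ : 0 < β) (hγ : 0 < γ)
    (hβγ : β + γ = 1) (mf : Measurable f) (mg : Measurable g) (mh : Measurable h)
    {M : ℝ≥0∞} (hM : M ≠ ∞) (fM : ∀ x, f x ≤ M) (gM : ∀ x, g x ≤ M)
    (H : ∀ x y, f x ^ β * g y ^ γ ≤ h (β * x + γ * y)) :
    (∫⁻ x, f x) ^ β * (∫⁻ x, g x) ^ γ ≤ ∫⁻ x, h x := by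
  set a := ⨆ x, f x with ha
  set b := ⨆ x, g x with hb
  have aT : a ≠ ∞ := ((iSup_le fM).trans_lt hM.lt_top).ne
  have bT : b ≠ ∞ := ((iSup_le gM).trans_lt hM.lt_top).ne
  by_cases a0 : a = 0
  · have : ∀ x, f x = 0 := fun x => le_antisymm (a0 ▸ le_iSup f x) zero_le
    simp [this, hβ]
  by_cases b0 : b = 0
  · have : ∀ x, g x = 0 := fun x => le_antisymm (b0 ▸ le_iSup g x) zero_le
    simp [this, hγ]
  set c := a ^ β * b ^ γ with hc
  have c0 : c ≠ 0 := mul_ne_zero (by simp [a0, aT]) (by simp [b0, bT])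
  have cT : c ≠ ∞ := ENNReal.mul_ne_top (ENNReal.rpow_ne_top_of_nonneg hβ.le aT)
    (ENNReal.rpow_ne_top_of_nonneg hγ.le bT)
  have fle : ∀ x, f x / a ≤ 1 := fun x => ENNReal.div_le_of_le_mul (by simpa using le_iSup f x)
  have gle : ∀ x, g x / b ≤ 1 := fun x => ENNReal.div_le_of_le_mul (by simpa using le_iSup g x)
  have ft : ∀ x, f x / a ≠ ∞ := fun x => ((fle x).trans_lt ENNReal.one_lt_top).ne
  have gt : ∀ x, g x / b ≠ ∞ := fun x => ((gle x).trans_lt ENNReal.one_lt_top).ne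
  have ht : ∀ x, min 1 (h x / c) ≠ ∞ := fun x =>
    ((min_le_left _ _).trans_lt ENNReal.one_lt_top).ne
  have sup : ∀ {k : ℝ → ℝ≥0∞} {s : ℝ≥0∞}, s = ⨆ x, k x → s ≠ 0 → s ≠ ∞ →
      (∀ x, k x / s ≠ ∞) → ∀ l : ℝ, l < 1 → ∃ x, l < (k x / s).toReal := by
    intro k s hs s0 sT kT l hl
    rcases lt_or_ge l 0 with l0 | l0
    · exact ⟨0, l0.trans_le ENNReal.toReal_nonneg⟩
    have : ENNReal.ofReal l * s < s := by
      calc ENNReal.ofReal l * s < 1 * s := by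
            rw [mul_comm, mul_comm 1]
            exact ENNReal.mul_lt_mul_right s0 sT (by simpa using hl)
        _ = s := one_mul s
    obtain ⟨x, hx⟩ := lt_iSup_iff.1 (this.trans_eq hs)
    refine ⟨x, (ENNReal.ofReal_lt_iff_lt_toReal l0 (kT x)).1 ?_⟩
    exact (ENNReal.lt_div_iff_mul_lt (Or.inl s0) (Or.inl sT)).2 hx
  have key := lintegral_add_le_of_normalized (f := fun x => (f x / a).toReal)
    (g := fun x => (g x / b).toReal) (h := fun x => (min 1 (h x / c)).toReal) hβ hγ hβγ
    (mf.div_const a).ennreal_toReal (mg.div_const b).ennreal_toReal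
    (measurable_const.min (mh.div_const c)).ennreal_toReal
    (fun _ => ENNReal.toReal_nonneg) (fun _ => ENNReal.toReal_nonneg)
    (fun _ => ENNReal.toReal_nonneg)
    (fun x => ENNReal.toReal_le_of_le_ofReal zero_le_one (by simpa using fle x))
    (fun x => ENNReal.toReal_le_of_le_ofReal zero_le_one (by simpa using gle x))
    (sup ha a0 aT ft) (sup hb b0 bT gt) (by
      intro x y
      rw [ENNReal.toReal_rpow, ENNReal.toReal_rpow, ← ENNReal.toReal_mul]
      refine ENNReal.toReal_mono (ht _) (le_min ?_ ?_)
      · calc _ ≤ (1:ℝ≥0∞) ^ β * 1 ^ γ := by gcongr; exacts [fle x, gle y]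
          _ = 1 := by simp
      · rw [ENNReal.div_rpow_of_nonneg _ _ hβ.le, ENNReal.div_rpow_of_nonneg _ _ hγ.le,
          ENNReal.le_div_iff_mul_le (Or.inl c0) (Or.inl cT), hc]
        have A0 : a ^ β ≠ 0 := by simp [a0, aT]
        have B0 : b ^ γ ≠ 0 := by simp [b0, bT]
        have AT : a ^ β ≠ ∞ := ENNReal.rpow_ne_top_of_nonneg hβ.le aT
        have BT : b ^ γ ≠ ∞ := ENNReal.rpow_ne_top_of_nonneg hγ.le bT
        calc f x ^ β / a ^ β * (g y ^ γ / b ^ γ) * (a ^ β * b ^ γ)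
            = (f x ^ β / a ^ β * a ^ β) * (g y ^ γ / b ^ γ * b ^ γ) := by ring
          _ = f x ^ β * g y ^ γ := by
            rw [ENNReal.div_mul_cancel A0 AT, ENNReal.div_mul_cancel B0 BT]
          _ ≤ _ := H x y)
  simp only [ENNReal.ofReal_toReal (ft _), ENNReal.ofReal_toReal (gt _),
    ENNReal.ofReal_toReal (ht _)] at key
  have k2 := (ENNReal.rpow_mul_rpow_le_add hβ hγ hβγ _ _).trans key
  have ld : ∀ {k : ℝ → ℝ≥0∞}, Measurable k → ∀ s, ∫⁻ x, k x / s = (∫⁻ x, k x) / s := by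
    intro k mk s
    simp only [div_eq_mul_inv]
    exact lintegral_mul_const _ mk
  have k3 : ∫⁻ x, min 1 (h x / c) ≤ (∫⁻ x, h x) / c := by
    rw [← ld mh]
    exact lintegral_mono fun x => min_le_right _ _
  have k4 := k2.trans k3
  rw [ld mf, ld mg, ENNReal.div_rpow_of_nonneg _ _ hβ.le,
    ENNReal.div_rpow_of_nonneg _ _ hγ.le, ENNReal.le_div_iff_mul_le (Or.inl c0) (Or.inl cT),
    hc] at k4
  have A0 : a ^ β ≠ 0 := by simp [a0, aT]
  have B0 : b ^ γ ≠ 0 := by simp [b0, bT]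
  have AT : a ^ β ≠ ∞ := ENNReal.rpow_ne_top_of_nonneg hβ.le aT
  have BT : b ^ γ ≠ ∞ := ENNReal.rpow_ne_top_of_nonneg hγ.le bT
  calc (∫⁻ x, f x) ^ β * (∫⁻ x, g x) ^ γ
      = ((∫⁻ x, f x) ^ β / a ^ β * a ^ β) * ((∫⁻ x, g x) ^ γ / b ^ γ * b ^ γ) := by
        rw [ENNReal.div_mul_cancel A0 AT, ENNReal.div_mul_cancel B0 BT]
    _ = (∫⁻ x, f x) ^ β / a ^ β * ((∫⁻ x, g x) ^ γ / b ^ γ) * (a ^ β * b ^ γ) := by ring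
    _ ≤ _ := k4

/-- A measure satisfies the Prékopa–Leindler inequality. -/
def IsPrekopaLeindler {E : Type*} [AddCommGroup E] [Module ℝ E] [MeasurableSpace E]
    (ν : Measure E) : Prop :=
  ∀ β γ : ℝ, 0 < β → 0 < γ → β + γ = 1 → ∀ f g h : E → ℝ≥0∞,
    Measurable f → Measurable g → Measurable h →
    (∀ x y, f x ^ β * g y ^ γ ≤ h (β • x + γ • y)) →
    (∫⁻ x, f x ∂ν) ^ β * (∫⁻ x, g x ∂ν) ^ γ ≤ ∫⁻ x, h x ∂ν

theorem isPrekopaLeindler_volume : IsPrekopaLeindler (volume : Measure ℝ) := by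
  intro β γ hβ hγ hβγ f g h mf mg mh H
  have tr : ∀ k : ℝ → ℝ≥0∞, Measurable k → Tendsto (fun n : ℕ => ∫⁻ x, min (k x) n) atTop
      (𝓝 (∫⁻ x, k x)) := by
    intro k mk
    refine lintegral_tendsto_of_tendsto_of_monotone
      (fun n => (mk.min measurable_const).aemeasurable)
      (Eventually.of_forall fun x i j hij => ?_) (Eventually.of_forall fun x => ?_)
    · exact min_le_min_left _ (by exact_mod_cast hij)
    · have := ENNReal.tendsto_nat_nhds_top
      have t : Tendsto (fun n : ℕ => min (k x) (n:ℝ≥0∞)) atTop (𝓝 (min (k x) ⊤)) :=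
        tendsto_const_nhds.min this
      simpa using t
  have bd : ∀ n : ℕ, (∫⁻ x, min (f x) n) ^ β * (∫⁻ x, min (g x) n) ^ γ ≤ ∫⁻ x, h x := fun n =>
    prekopa_leindler_of_bounded hβ hγ hβγ (mf.min measurable_const) (mg.min measurable_const) mh
      (ENNReal.natCast_ne_top n) (fun x => min_le_right _ _) (fun x => min_le_right _ _)
      fun x y => le_trans (by gcongr <;> exact min_le_left _ _) (H x y)
  by_cases fz : ∫⁻ x, f x = 0
  · simp [fz, hβ]
  by_cases gz : ∫⁻ x, g x = 0
  · simp [gz, hγ]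
  refine le_of_tendsto' (ENNReal.Tendsto.mul
    ((ENNReal.continuous_rpow_const.tendsto _).comp (tr f mf)) (Or.inl ?_)
    ((ENNReal.continuous_rpow_const.tendsto _).comp (tr g mg)) (Or.inl ?_)) bd
  · simp [fz, hβ.le]
  · simp [gz, hγ.le]

theorem IsPrekopaLeindler.withDensity {E : Type*} [AddCommGroup E] [Module ℝ E]
    [MeasurableSpace E] {ν : Measure E} (hν : IsPrekopaLeindler ν) {ρ : E → ℝ≥0∞}
    (mρ : Measurable ρ)
    (hρ : ∀ β γ : ℝ, 0 < β → 0 < γ → β + γ = 1 → ∀ x y, ρ x ^ β * ρ y ^ γ ≤ ρ (β • x + γ • y)) :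
    IsPrekopaLeindler (ν.withDensity ρ) := by
  intro β γ hβ hγ hβγ f g h mf mg mh H
  rw [lintegral_withDensity_eq_lintegral_mul _ mρ mf,
    lintegral_withDensity_eq_lintegral_mul _ mρ mg,
    lintegral_withDensity_eq_lintegral_mul _ mρ mh]
  refine hν β γ hβ hγ hβγ _ _ _ (mρ.mul mf) (mρ.mul mg) (mρ.mul mh) fun x y => ?_
  simp only [Pi.mul_apply]
  rw [ENNReal.mul_rpow_of_nonneg _ _ hβ.le, ENNReal.mul_rpow_of_nonneg _ _ hγ.le]
  calc ρ x ^ β * f x ^ β * (ρ y ^ γ * g y ^ γ) = (ρ x ^ β * ρ y ^ γ) * (f x ^ β * g y ^ γ) := by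
        ring
    _ ≤ _ := mul_le_mul' (hρ β γ hβ hγ hβγ x y) (H x y)

theorem IsPrekopaLeindler.prod {E F : Type*} [AddCommGroup E] [Module ℝ E]
    [MeasurableSpace E] [AddCommGroup F] [Module ℝ F] [MeasurableSpace F]
    {ν : Measure E} {ξ : Measure F} [SFinite ν] [SFinite ξ]
    (hν : IsPrekopaLeindler ν) (hξ : IsPrekopaLeindler ξ) : IsPrekopaLeindler (ν.prod ξ) := by
  intro β γ hβ hγ hβγ f g h mf mg mh H
  rw [lintegral_prod _ mf.aemeasurable, lintegral_prod _ mg.aemeasurable,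
    lintegral_prod _ mh.aemeasurable]
  refine hν β γ hβ hγ hβγ _ _ _ mf.lintegral_prod_right' mg.lintegral_prod_right'
    mh.lintegral_prod_right' fun x y => ?_
  exact hξ β γ hβ hγ hβγ _ _ _ (mf.comp measurable_prodMk_left) (mg.comp measurable_prodMk_left)
    (mh.comp measurable_prodMk_left) fun u v => H (x, u) (y, v)

theorem IsPrekopaLeindler.pi {E : Type*} [AddCommGroup E] [Module ℝ E]
    [MeasurableSpace E] {ν : Measure E} [SigmaFinite ν] (hν : IsPrekopaLeindler ν) :
    ∀ n : ℕ, IsPrekopaLeindler (Measure.pi fun _ : Fin n => ν)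
  | 0 => by
    intro β γ hβ hγ hβγ f g h mf mg mh H
    rw [Measure.pi_of_empty _ 0, lintegral_dirac' _ mf, lintegral_dirac' _ mg,
      lintegral_dirac' _ mh]
    simpa using H 0 0
  | n + 1 => by
    intro β γ hβ hγ hβγ f g h mf mg mh H
    have mp := (measurePreserving_piFinSuccAbove (fun _ : Fin (n + 1) => ν) 0).symm
    have e := MeasurableEquiv.piFinSuccAbove (fun _ : Fin (n + 1) => E) 0
    rw [← mp.lintegral_comp mf, ← mp.lintegral_comp mg, ← mp.lintegral_comp mh]
    have me : Measurable (MeasurableEquiv.piFinSuccAbove (fun _ : Fin (n + 1) => E) 0).symm :=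
      MeasurableEquiv.measurable _
    refine (hν.prod (IsPrekopaLeindler.pi hν n)) β γ hβ hγ hβγ _ _ _ (mf.comp me) (mg.comp me)
      (mh.comp me) fun x y => ?_
    convert H _ _ using 2
    ext i
    refine Fin.cases ?_ (fun j => ?_) i <;> simp [MeasurableEquiv.piFinSuccAbove]

/-- The standard exponential distribution. -/
noncomputable def stdExp : Measure ℝ :=
  volume.withDensity ((Ioi 0).indicator fun s => ENNReal.ofReal (Real.exp (-s)))

theorem stdExp_eq : stdExp =
    (volume.restrict (Ioi 0)).withDensity fun s => ENNReal.ofReal (Real.exp (-s)) :=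
  withDensity_indicator measurableSet_Ioi _

theorem isPrekopaLeindler_stdExp : IsPrekopaLeindler stdExp := by
  refine isPrekopaLeindler_volume.withDensity
    (Measurable.indicator (by fun_prop) measurableSet_Ioi) fun β γ hβ hγ hβγ x y => ?_
  by_cases hx : 0 < x
  · by_cases hy : 0 < y
    · have hxy : 0 < β • x + γ • y := by simp only [smul_eq_mul]; positivity
      rw [indicator_of_mem (mem_Ioi.2 hx), indicator_of_mem (mem_Ioi.2 hy),
        indicator_of_mem (mem_Ioi.2 hxy),
        ENNReal.ofReal_rpow_of_nonneg (Real.exp_pos _).le hβ.le,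
        ENNReal.ofReal_rpow_of_nonneg (Real.exp_pos _).le hγ.le,
        ← ENNReal.ofReal_mul (by positivity), ← Real.exp_mul, ← Real.exp_mul, ← Real.exp_add]
      refine ENNReal.ofReal_le_ofReal (Real.exp_le_exp.2 (le_of_eq ?_))
      simp only [smul_eq_mul]; ring
    · rw [indicator_of_notMem (s := Ioi 0) (a := y) hy]
      simp [hγ]
  · rw [indicator_of_notMem (s := Ioi 0) (a := x) hx]
    simp [hβ]

theorem lintegral_stdExp {f : ℝ → ℝ≥0∞} (hf : AEMeasurable f (volume.restrict (Ioi 0))) :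
    ∫⁻ s, f s ∂stdExp = ∫⁻ s in Ioi 0, f s * ENNReal.ofReal (Real.exp (-s)) := by
  rw [stdExp_eq, lintegral_withDensity_eq_lintegral_mul₀ (by fun_prop) hf]
  simp only [Pi.mul_apply, mul_comm]

theorem integral_stdExp (f : ℝ → ℝ) :
    ∫ s, f s ∂stdExp = ∫ s in Ioi 0, f s * Real.exp (-s) := by
  rw [stdExp_eq, integral_withDensity_eq_integral_toReal_smul (by fun_prop)
    (Eventually.of_forall fun _ => ENNReal.ofReal_lt_top)]
  simp only [ENNReal.toReal_ofReal (Real.exp_pos _).le, smul_eq_mul, mul_comm]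

theorem stdExp_Ioi {a : ℝ} (ha : 0 ≤ a) : stdExp (Ioi a) = ENNReal.ofReal (Real.exp (-a)) := by
  rw [stdExp_eq, withDensity_apply _ measurableSet_Ioi, Measure.restrict_restrict measurableSet_Ioi,
    inter_eq_left.2 (Ioi_subset_Ioi ha), ← ofReal_integral_eq_lintegral_ofReal
      (integrableOn_exp_neg_Ioi a) (Eventually.of_forall fun _ => (Real.exp_pos _).le),
      integral_exp_neg_Ioi]

theorem ae_stdExp_pos : ∀ᵐ s ∂stdExp, 0 < s := by
  rw [stdExp_eq]
  exact (withDensity_absolutelyContinuous _ _).ae_le (ae_restrict_mem measurableSet_Ioi)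

instance isProbabilityMeasure_stdExp : IsProbabilityMeasure stdExp := by
  refine ⟨?_⟩
  have h : stdExp (Ioi 0)ᶜ = 0 := ae_stdExp_pos
  have := measure_add_measure_compl (μ := stdExp) (measurableSet_Ioi (a := (0:ℝ)))
  rw [h, stdExp_Ioi le_rfl] at this
  simpa using this.symm

theorem integral_pow_stdExp (d : ℕ) : ∫ s, s ^ d ∂stdExp = d.factorial := by
  rw [integral_stdExp]
  have := Real.Gamma_eq_integral (s := d + 1) (by positivity)
  rw [Real.Gamma_nat_eq_factorial] at this
  rw [this]
  refine setIntegral_congr_fun measurableSet_Ioi fun s hs => ?_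
  simp [mul_comm]

theorem integrable_pow_stdExp (d : ℕ) : Integrable (fun s => s ^ d) stdExp := by
  refine .of_integral_ne_zero ?_
  rw [integral_pow_stdExp]
  positivity

/-- The law of a vector with independent standard exponential entries. -/
noncomputable def stdExpVec (n : ℕ) : Measure (Fin n → ℝ) := Measure.pi fun _ => stdExp

instance (n : ℕ) : IsProbabilityMeasure (stdExpVec n) := by
  unfold stdExpVec; infer_instance

theorem isPrekopaLeindler_stdExpVec (n : ℕ) : IsPrekopaLeindler (stdExpVec n) :=
  isPrekopaLeindler_stdExp.pi n

/-- The open positive orthant. -/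
def orthant (n : ℕ) : Set (Fin n → ℝ) := {u | ∀ i, 0 < u i}

theorem ae_stdExpVec (n : ℕ) : ∀ᵐ u ∂stdExpVec n, u ∈ orthant n := by
  have : ∀ᵐ u ∂stdExpVec n, ∀ i, 0 < u i := by
    rw [ae_all_iff]
    intro i
    exact (Measure.tendsto_eval_ae_ae (μ := fun _ : Fin n => stdExp) (i := i)).eventually
      ae_stdExp_pos
  exact this

theorem isOpen_orthant (n : ℕ) : IsOpen (orthant n) := by
  simp only [orthant, ofPred_forall]
  exact isOpen_iInter_of_finite fun i => isOpen_lt continuous_const (continuous_apply i)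

theorem convex_orthant (n : ℕ) : Convex ℝ (orthant n) := by
  intro x hx y hy a b ha hb hab i
  rcases eq_or_lt_of_le ha with rfl | ha
  · simp only [zero_add] at hab; subst hab; simpa using hy i
  · have := hx i
    have := hy i
    simp only [Pi.add_apply, Pi.smul_apply, smul_eq_mul]
    positivity

theorem smul_mem_orthant {n : ℕ} {u : Fin n → ℝ} (hu : u ∈ orthant n) {z : ℝ} (hz : 0 < z) :
    z • u ∈ orthant n := fun i => mul_pos hz (hu i)

/-- The part of the orthant where `φ` exceeds `l`. -/
def superlevel {n : ℕ} (φ : (Fin n → ℝ) → ℝ) (l : ℝ) : Set (Fin n → ℝ) :=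
  {u | u ∈ orthant n ∧ l < φ u}

/-- The upper quantile of `φ` under the exponential law, at tail probability `exp (-s)`. -/
noncomputable def upperQuantile {n : ℕ} (φ : (Fin n → ℝ) → ℝ) (s : ℝ) : ℝ :=
  sSup {l | ENNReal.ofReal (Real.exp (-s)) < stdExpVec n (superlevel φ l)}

section Quantile

variable {n : ℕ} {φ : (Fin n → ℝ) → ℝ}

theorem superlevel_antitone : Antitone (superlevel φ) := fun _ _ hab _ hu =>
  ⟨hu.1, hab.trans_lt hu.2⟩

theorem isOpen_superlevel (hφ : ContinuousOn φ (orthant n)) (l : ℝ) : IsOpen (superlevel φ l) :=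
  hφ.isOpen_inter_preimage (isOpen_orthant n) isOpen_Ioi

theorem stdExpVec_orthant (n : ℕ) : stdExpVec n (orthant n) = 1 := by
  rw [(prob_compl_eq_zero_iff (isOpen_orthant n).measurableSet).1]
  exact ae_stdExpVec n

theorem exists_lt_superlevel {s : ℝ} (hs : 0 < s) :
    ∃ l, ENNReal.ofReal (Real.exp (-s)) < stdExpVec n (superlevel φ l) := by
  have t := tendsto_measure_iUnion_atTop (μ := stdExpVec n)
    (s := fun k : ℕ => superlevel φ (-k))
    (fun i j hij => superlevel_antitone (by simpa using hij))
  have e : ⋃ k : ℕ, superlevel φ (-k) = orthant n := by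
    ext u
    simp only [mem_iUnion, superlevel, mem_ofPred_eq, exists_and_left, and_iff_left_iff_imp]
    intro _
    obtain ⟨k, hk⟩ := exists_nat_gt (-φ u)
    exact ⟨k, by linarith⟩
  rw [e, stdExpVec_orthant] at t
  have lt : ENNReal.ofReal (Real.exp (-s)) < 1 := by simpa using hs
  obtain ⟨k, hk⟩ := (t.eventually (lt_mem_nhds lt)).exists
  exact ⟨_, hk⟩

theorem bddAbove_quantile (hφ : ContinuousOn φ (orthant n)) (s : ℝ) :
    BddAbove {l | ENNReal.ofReal (Real.exp (-s)) < stdExpVec n (superlevel φ l)} := by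
  have t := tendsto_measure_iInter_atTop (μ := stdExpVec n)
    (s := fun k : ℕ => superlevel φ k)
    (fun k => (isOpen_superlevel hφ _).measurableSet.nullMeasurableSet)
    (fun i j hij => superlevel_antitone (by simpa using hij)) ⟨0, measure_ne_top _ _⟩
  have e : ⋂ k : ℕ, superlevel φ k = ∅ := by
    refine eq_empty_of_forall_notMem fun u hu => ?_
    obtain ⟨k, hk⟩ := exists_nat_gt (φ u)
    exact lt_asymm hk (mem_iInter.1 hu k).2
  rw [e, measure_empty] at t
  have lt : 0 < ENNReal.ofReal (Real.exp (-s)) := by simpa using Real.exp_pos _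
  obtain ⟨k, hk⟩ := (t.eventually (gt_mem_nhds lt)).exists
  refine ⟨k, fun l hl => ?_⟩
  by_contra! h
  exact absurd (hl.trans_le (measure_mono (superlevel_antitone h.le))) (lt_asymm hk)

theorem lt_upperQuantile_iff (hφ : ContinuousOn φ (orthant n)) {s : ℝ} (hs : 0 < s) {l : ℝ} :
    l < upperQuantile φ s ↔ ENNReal.ofReal (Real.exp (-s)) < stdExpVec n (superlevel φ l) := by
  constructor
  · intro h
    obtain ⟨l', hl', hll⟩ := exists_lt_of_lt_csSup (exists_lt_superlevel hs) h
    exact lt_of_lt_of_le hl' (measure_mono (superlevel_antitone hll.le))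
  · intro h
    have t := tendsto_measure_iUnion_atTop (μ := stdExpVec n)
      (s := fun k : ℕ => superlevel φ (l + 1 / ((k:ℝ) + 1)))
      (fun i j hij => superlevel_antitone (by
        have : (i:ℝ) ≤ j := by exact_mod_cast hij
        have : 1 / ((j:ℝ) + 1) ≤ 1 / ((i:ℝ) + 1) :=
          one_div_le_one_div_of_le (by positivity) (by linarith)
        linarith))
    have e : ⋃ k : ℕ, superlevel φ (l + 1 / ((k:ℝ) + 1)) = superlevel φ l := by
      ext u
      simp only [mem_iUnion, superlevel, mem_ofPred_eq, exists_and_left, and_congr_right_iff]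
      intro _
      constructor
      · rintro ⟨k, hk⟩
        have : 0 < 1 / ((k:ℝ) + 1) := by positivity
        linarith
      · intro h
        obtain ⟨k, hk⟩ := exists_nat_one_div_lt (sub_pos.2 h)
        exact ⟨k, by linarith⟩
    rw [e] at t
    obtain ⟨k, hk⟩ := (t.eventually (lt_mem_nhds h)).exists
    have := le_csSup (bddAbove_quantile hφ s) hk
    have pk : 0 < 1 / ((k:ℝ) + 1) := by positivity
    unfold upperQuantile
    linarith

theorem upperQuantile_monotoneOn (hφ : ContinuousOn φ (orthant n)) :
    MonotoneOn (upperQuantile φ) (Ioi 0) := by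
  intro a ha b hb hab
  refine csSup_le_csSup (bddAbove_quantile hφ b) (exists_lt_superlevel ha) fun l hl => ?_
  refine lt_of_le_of_lt (ENNReal.ofReal_le_ofReal (Real.exp_le_exp.2 ?_)) hl
  linarith

theorem aemeasurable_of_continuousOn_orthant (hφ : ContinuousOn φ (orthant n)) :
    AEMeasurable φ (stdExpVec n) := by
  have := hφ.aemeasurable (μ := stdExpVec n) (isOpen_orthant n).measurableSet
  rwa [Measure.restrict_eq_self_of_ae_mem (ae_stdExpVec n)] at this

theorem lintegral_exp_upperQuantile (hφ : ContinuousOn φ (orthant n)) :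
    ∫⁻ s in Ioi 0, ENNReal.ofReal (Real.exp (upperQuantile φ s)) * ENNReal.ofReal (Real.exp (-s))
      = ∫⁻ u, ENNReal.ofReal (Real.exp (φ u)) ∂stdExpVec n := by
  have mq : AEMeasurable (upperQuantile φ) (volume.restrict (Ioi 0)) :=
    aemeasurable_restrict_of_monotoneOn measurableSet_Ioi (upperQuantile_monotoneOn hφ)
  have mq' : AEMeasurable (upperQuantile φ) stdExp := by
    refine mq.mono_ac ?_
    rw [stdExp_eq]
    exact withDensity_absolutelyContinuous _ _
  rw [← lintegral_stdExp (f := fun s => ENNReal.ofReal (Real.exp (upperQuantile φ s)))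
      mq.exp.ennreal_ofReal,
    lintegral_eq_lintegral_meas_lt _ (Eventually.of_forall fun _ => (Real.exp_pos _).le) mq'.exp,
    lintegral_eq_lintegral_meas_lt _ (Eventually.of_forall fun _ => (Real.exp_pos _).le)
      (aemeasurable_of_continuousOn_orthant hφ).exp]
  refine setLIntegral_congr_fun measurableSet_Ioi fun t ht => ?_
  have ht : 0 < t := ht
  have e1 : stdExpVec n {u | t < Real.exp (φ u)} = stdExpVec n (superlevel φ (Real.log t)) := by
    refine measure_congr ?_
    filter_upwards [ae_stdExpVec n] with u hu
    refine propext ?_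
    show t < Real.exp (φ u) ↔ u ∈ orthant n ∧ Real.log t < φ u
    rw [Real.log_lt_iff_lt_exp ht]
    exact ⟨fun h => ⟨hu, h⟩, fun h => h.2⟩
  simp only [e1]
  set M := stdExpVec n (superlevel φ (Real.log t)) with hM
  have MT : M ≠ ∞ := measure_ne_top _ _
  have M1 : M ≤ 1 := prob_le_one
  have e2 : stdExp {s | t < Real.exp (upperQuantile φ s)}
      = stdExp {s | 0 < s ∧ ENNReal.ofReal (Real.exp (-s)) < M} := by
    refine measure_congr ?_
    filter_upwards [ae_stdExp_pos] with s hs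
    refine propext ?_
    show t < Real.exp (upperQuantile φ s) ↔ 0 < s ∧ _
    rw [← Real.log_lt_iff_lt_exp ht, lt_upperQuantile_iff hφ hs]
    exact ⟨fun h => ⟨hs, h⟩, fun h => h.2⟩
  rw [e2]
  by_cases M0 : M = 0
  · simp [M0]
  have Mp : 0 < M.toReal := ENNReal.toReal_pos M0 MT
  have M1' : M.toReal ≤ 1 := ENNReal.toReal_le_of_le_ofReal zero_le_one (by simpa using M1)
  have lM : 0 ≤ -Real.log M.toReal := by linarith [Real.log_nonpos Mp.le M1']
  have e3 : {s : ℝ | 0 < s ∧ ENNReal.ofReal (Real.exp (-s)) < M} = Ioi (-Real.log M.toReal) := by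
    ext s
    simp only [mem_ofPred_eq, mem_Ioi]
    rw [ENNReal.ofReal_lt_iff_lt_toReal (Real.exp_pos _).le MT, ← Real.lt_log_iff_exp_lt Mp]
    constructor
    · rintro ⟨_, h⟩; linarith
    · intro h; exact ⟨by linarith, by linarith⟩
  rw [e3, stdExp_Ioi lM, neg_neg, Real.exp_log Mp, ENNReal.ofReal_toReal MT]

end Quantile

section Row

variable {n : ℕ} {r₀ ρ : ℝ} {L : ℝ → (Fin n → ℝ) → ℝ}

theorem continuousOn_of_concave_slice {E F : Type*} [AddCommGroup E] [Module ℝ E]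
    [NormedAddCommGroup F] [NormedSpace ℝ F] [FiniteDimensional ℝ F] {S : Set E} {K : Set F}
    {f : E → F → ℝ} {N : E → ℝ} (hK : IsOpen K) (cK : Convex ℝ K)
    (conc : ConcaveOn ℝ (S ×ˢ K) fun p => f p.1 p.2 - N p.1) {t : E} (ht : t ∈ S) :
    ContinuousOn (f t) K := by
  refine ConcaveOn.continuousOn hK ⟨cK, fun x hx y hy a b ha hb hab => ?_⟩
  have := conc.2 (show (t, x) ∈ S ×ˢ K from ⟨ht, hx⟩) (show (t, y) ∈ S ×ˢ K from ⟨ht, hy⟩)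
    ha hb hab
  simp only [Prod.smul_mk, Prod.mk_add_mk, smul_eq_mul, ← add_smul, hab, one_smul] at this ⊢
  have e : a * (f t x - N t) + b * (f t y - N t) = a * f t x + b * f t y - (a + b) * N t := by ring
  rw [e, hab] at this
  linarith

theorem superlevel_rpow_mul_rpow_le
    (conc : ConcaveOn ℝ (Icc (0:ℝ) 1 ×ˢ orthant n) fun p =>
      L p.1 p.2 - (r₀ + ρ * p.1) * Real.log (r₀ + ρ * p.1))
    (hom : ∀ t ∈ Icc (0:ℝ) 1, ∀ u ∈ orthant n, ∀ z : ℝ, 0 < z →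
      L t (z • u) = L t u + (r₀ + ρ * t) * Real.log z)
    {t₀ t₁ z₀ z₁ a b l₀ l₁ : ℝ} (ht₀ : t₀ ∈ Icc (0:ℝ) 1) (ht₁ : t₁ ∈ Icc (0:ℝ) 1)
    (hz₀ : 0 < z₀) (hz₁ : 0 < z₁) (ha : 0 < a) (hb : 0 < b) (hab : a + b = 1) :
    stdExpVec n (superlevel (L t₀) l₀) ^ (a * z₀ / (a * z₀ + b * z₁)) *
      stdExpVec n (superlevel (L t₁) l₁) ^ (b * z₁ / (a * z₀ + b * z₁)) ≤
    stdExpVec n (superlevel (L (a * t₀ + b * t₁))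
      (a * (l₀ + (r₀ + ρ * t₀) * Real.log z₀ - (r₀ + ρ * t₀) * Real.log (r₀ + ρ * t₀)) +
       b * (l₁ + (r₀ + ρ * t₁) * Real.log z₁ - (r₀ + ρ * t₁) * Real.log (r₀ + ρ * t₁)) -
       (r₀ + ρ * (a * t₀ + b * t₁)) * Real.log (a * z₀ + b * z₁) +
       (r₀ + ρ * (a * t₀ + b * t₁)) * Real.log (r₀ + ρ * (a * t₀ + b * t₁)))) := by
  have hz : 0 < a * z₀ + b * z₁ := by positivity
  set β := a * z₀ / (a * z₀ + b * z₁) with hβ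
  set γ := b * z₁ / (a * z₀ + b * z₁) with hγ
  have β0 : 0 < β := by positivity
  have γ0 : 0 < γ := by positivity
  have βγ : β + γ = 1 := by rw [hβ, hγ]; field_simp
  have ht : a * t₀ + b * t₁ ∈ Icc (0:ℝ) 1 := convex_Icc 0 1 ht₀ ht₁ ha.le hb.le hab
  have ms : ∀ t ∈ Icc (0:ℝ) 1, ∀ l, MeasurableSet (superlevel (L t) l) := fun t ht l =>
    (isOpen_superlevel (continuousOn_of_concave_slice (isOpen_orthant n) (convex_orthant n)
      (f := L) (N := fun t => (r₀ + ρ * t) * Real.log (r₀ + ρ * t)) conc ht) l).measurableSet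
  have m₀ := ms _ ht₀ l₀
  have m₁ := ms _ ht₁ l₁
  obtain ⟨l, hl⟩ : ∃ l, l = a * (l₀ + (r₀ + ρ * t₀) * Real.log z₀ -
      (r₀ + ρ * t₀) * Real.log (r₀ + ρ * t₀)) +
    b * (l₁ + (r₀ + ρ * t₁) * Real.log z₁ - (r₀ + ρ * t₁) * Real.log (r₀ + ρ * t₁)) -
    (r₀ + ρ * (a * t₀ + b * t₁)) * Real.log (a * z₀ + b * z₁) +
    (r₀ + ρ * (a * t₀ + b * t₁)) * Real.log (r₀ + ρ * (a * t₀ + b * t₁)) := ⟨_, rfl⟩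
  rw [← hl]
  have m := ms _ ht l
  have pl := isPrekopaLeindler_stdExpVec n β γ β0 γ0 βγ _ _ _ (measurable_one.indicator m₀)
    (measurable_one.indicator m₁) (measurable_one.indicator m) (by
      intro x y
      by_cases hx : x ∈ superlevel (L t₀) l₀
      swap
      · simp [indicator_of_notMem hx, β0]
      by_cases hy : y ∈ superlevel (L t₁) l₁
      swap
      · simp [indicator_of_notMem hy, γ0]
      rw [indicator_of_mem hx, indicator_of_mem hy, indicator_of_mem]
      · simp
      have hxy : β • x + γ • y ∈ orthant n := convex_orthant n hx.1 hy.1 β0.le γ0.le βγ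
      refine ⟨hxy, ?_⟩
      have c := conc.2 (show (t₀, z₀ • x) ∈ Icc (0:ℝ) 1 ×ˢ orthant n from
        ⟨ht₀, smul_mem_orthant hx.1 hz₀⟩) (show (t₁, z₁ • y) ∈ Icc (0:ℝ) 1 ×ˢ orthant n from
        ⟨ht₁, smul_mem_orthant hy.1 hz₁⟩) ha.le hb.le hab
      have e : a • z₀ • x + b • z₁ • y = (a * z₀ + b * z₁) • (β • x + γ • y) := by
        rw [smul_add, smul_smul, smul_smul, smul_smul, smul_smul, hβ, hγ,
          mul_div_cancel₀ _ hz.ne', mul_div_cancel₀ _ hz.ne']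
      simp only [Prod.smul_mk, Prod.mk_add_mk, smul_eq_mul, e] at c
      rw [hom _ ht _ hxy _ hz, hom _ ht₀ _ hx.1 _ hz₀, hom _ ht₁ _ hy.1 _ hz₁] at c
      have h₀ := mul_lt_mul_of_pos_left hx.2 ha
      have h₁ := mul_lt_mul_of_pos_left hy.2 hb
      nlinarith [c, h₀, h₁])
  simpa only [lintegral_indicator_one m₀, lintegral_indicator_one m₁,
    lintegral_indicator_one m] using pl

theorem profileFun_upperQuantile_concave
    (conc : ConcaveOn ℝ (Icc (0:ℝ) 1 ×ˢ orthant n) fun p =>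
      L p.1 p.2 - (r₀ + ρ * p.1) * Real.log (r₀ + ρ * p.1))
    (hom : ∀ t ∈ Icc (0:ℝ) 1, ∀ u ∈ orthant n, ∀ z : ℝ, 0 < z →
      L t (z • u) = L t u + (r₀ + ρ * t) * Real.log z) :
    ConcaveOn ℝ (Icc 0 1 ×ˢ Ioi 0 ×ˢ Ioi 0) (profileFun r₀ ρ fun t => upperQuantile (L t)) := by
  have cL : ∀ t ∈ Icc (0:ℝ) 1, ContinuousOn (L t) (orthant n) := fun t ht =>
    continuousOn_of_concave_slice (isOpen_orthant n) (convex_orthant n)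
      (f := L) (N := fun t => (r₀ + ρ * t) * Real.log (r₀ + ρ * t)) conc ht
  rw [concaveOn_iff_forall_pos]
  refine ⟨(convex_Icc 0 1).prod ((convex_Ioi 0).prod (convex_Ioi 0)), ?_⟩
  rintro ⟨t₀, s₀, z₀⟩ ⟨ht₀, hs₀, hz₀⟩ ⟨t₁, s₁, z₁⟩ ⟨ht₁, hs₁, hz₁⟩ a b ha hb hab
  simp only [mem_Ioi] at ht₀ ht₁ hs₀ hs₁ hz₀ hz₁
  simp only [profileFun, Prod.smul_mk, Prod.mk_add_mk, smul_eq_mul]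
  refine le_of_forall_pos_le_add fun ε hε => ?_
  set t := a * t₀ + b * t₁
  set z := a * z₀ + b * z₁ with hzdef
  set s := a * s₀ + b * s₁ with hsdef
  have hz : 0 < z := by positivity
  have hs : 0 < s := by positivity
  have ht : t ∈ Icc (0:ℝ) 1 := convex_Icc 0 1 ht₀ ht₁ ha.le hb.le hab
  set q₀ := upperQuantile (L t₀) (s₀ / z₀)
  set q₁ := upperQuantile (L t₁) (s₁ / z₁)
  have l₀ := (lt_upperQuantile_iff (cL _ ht₀) (div_pos hs₀ hz₀)).1 (sub_lt_self q₀ hε)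
  have l₁ := (lt_upperQuantile_iff (cL _ ht₁) (div_pos hs₁ hz₁)).1 (sub_lt_self q₁ hε)
  have pl := superlevel_rpow_mul_rpow_le conc hom (l₀ := q₀ - ε) (l₁ := q₁ - ε) ht₀ ht₁ hz₀ hz₁
    ha hb hab
  have lt : ENNReal.ofReal (Real.exp (-(s / z))) <
      stdExpVec n (superlevel (L t₀) (q₀ - ε)) ^ (a * z₀ / z) *
      stdExpVec n (superlevel (L t₁) (q₁ - ε)) ^ (b * z₁ / z) := by
    have x₀ := ENNReal.rpow_lt_rpow l₀ (show 0 < a * z₀ / z by positivity)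
    have x₁ := ENNReal.rpow_lt_rpow l₁ (show 0 < b * z₁ / z by positivity)
    refine lt_of_eq_of_lt ?_ (ENNReal.mul_lt_mul x₀ x₁)
    rw [ENNReal.ofReal_rpow_of_pos (Real.exp_pos _), ENNReal.ofReal_rpow_of_pos (Real.exp_pos _),
      ← ENNReal.ofReal_mul (by positivity), ← Real.exp_mul, ← Real.exp_mul, ← Real.exp_add]
    congr 2
    rw [hsdef]
    field_simp
    ring
  have fin := (lt_upperQuantile_iff (cL _ ht) (div_pos hs hz)).2 (lt.trans_le pl)
  have e : a * (q₀ - ε) + b * (q₁ - ε) = a * q₀ + b * q₁ - (a + b) * ε := by ring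
  rw [hab] at e
  nlinarith [fin, e]

theorem row_two_point (h0 : 0 < r₀) (h1 : 0 < r₀ + ρ)
    (conc : ConcaveOn ℝ (Icc (0:ℝ) 1 ×ˢ orthant n) fun p =>
      L p.1 p.2 - (r₀ + ρ * p.1) * Real.log (r₀ + ρ * p.1))
    (hom : ∀ t ∈ Icc (0:ℝ) 1, ∀ u ∈ orthant n, ∀ z : ℝ, 0 < z →
      L t (z • u) = L t u + (r₀ + ρ * t) * Real.log z) {α : ℝ} (hα : α ∈ Ioo (0:ℝ) 1) :
    (∀ t ∈ Icc (0:ℝ) 1, Integrable (fun u => Real.exp (L t u)) (stdExpVec n)) ∧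
    (1 - α) * (Real.log (∫ u, Real.exp (L 0 u) ∂stdExpVec n) - Real.log (Real.Gamma (r₀ + 1)))
      + α * (Real.log (∫ u, Real.exp (L 1 u) ∂stdExpVec n) - Real.log (Real.Gamma (r₀ + ρ + 1))) ≤
    Real.log (∫ u, Real.exp (L α u) ∂stdExpVec n) - Real.log (Real.Gamma (r₀ + ρ * α + 1)) := by
  have cL : ∀ t ∈ Icc (0:ℝ) 1, ContinuousOn (L t) (orthant n) := fun t ht =>
    continuousOn_of_concave_slice (isOpen_orthant n) (convex_orthant n)
      (f := L) (N := fun t => (r₀ + ρ * t) * Real.log (r₀ + ρ * t)) conc ht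
  obtain ⟨int, two⟩ := laplace_two_point h0 h1 (profileFun_upperQuantile_concave conc hom) hα
  have le : ∀ t ∈ Icc (0:ℝ) 1, ∫⁻ s in Ioi 0, ENNReal.ofReal
      (Real.exp (upperQuantile (L t) s) * Real.exp (-s)) =
      ∫⁻ u, ENNReal.ofReal (Real.exp (L t u)) ∂stdExpVec n := by
    intro t ht
    rw [← lintegral_exp_upperQuantile (cL t ht)]
    simp only [ENNReal.ofReal_mul (Real.exp_pos _).le]
  have me : ∀ t ∈ Icc (0:ℝ) 1, AEStronglyMeasurable (fun u => Real.exp (L t u)) (stdExpVec n) :=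
    fun t ht => (aemeasurable_of_continuousOn_orthant (cL t ht)).exp.aestronglyMeasurable
  have ieq : ∀ t ∈ Icc (0:ℝ) 1, ∫ s in Ioi 0, Real.exp (upperQuantile (L t) s) * Real.exp (-s)
      = ∫ u, Real.exp (L t u) ∂stdExpVec n := by
    intro t ht
    rw [integral_eq_lintegral_of_nonneg_ae (Eventually.of_forall fun _ => by positivity)
      (int t ht).aestronglyMeasurable,
      integral_eq_lintegral_of_nonneg_ae (Eventually.of_forall fun _ => by positivity) (me t ht),
      le t ht]
  constructor
  · intro t ht
    refine ⟨me t ht, ?_⟩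
    rw [hasFiniteIntegral_iff_ofReal (Eventually.of_forall fun _ => by positivity), ← le t ht]
    exact (hasFiniteIntegral_iff_ofReal (Eventually.of_forall fun _ => by positivity)).1
      (int t ht).2
  · rw [← ieq 0 (left_mem_Icc.2 zero_le_one), ← ieq 1 (right_mem_Icc.2 zero_le_one),
      ← ieq α (Ioo_subset_Icc_self hα)]
    exact two

end Row

theorem concaveOn_log_integral_row {n : ℕ} {Q : Type*} [AddCommGroup Q] [Module ℝ Q] {S : Set Q}
    (hS : Convex ℝ S) {L : Q → (Fin n → ℝ) → ℝ} {N : Q → ℝ} (r : Q →ₗ[ℝ] ℝ)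
    (hr : ∀ q ∈ S, 0 < r q)
    (conc : ConcaveOn ℝ (S ×ˢ orthant n) fun p =>
      L p.1 p.2 - N p.1 - r p.1 * Real.log (r p.1))
    (hom : ∀ q ∈ S, ∀ u ∈ orthant n, ∀ z : ℝ, 0 < z →
      L q (z • u) = L q u + r q * Real.log z) :
    (∀ q ∈ S, Integrable (fun u => Real.exp (L q u)) (stdExpVec n)) ∧
    ConcaveOn ℝ S fun q => Real.log (∫ u, Real.exp (L q u) ∂stdExpVec n) - N q -
      Real.log (Real.Gamma (r q + 1)) := by
  have main : ∀ q₀ ∈ S, ∀ q₁ ∈ S, ∀ α ∈ Ioo (0:ℝ) 1,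
      Integrable (fun u => Real.exp (L q₀ u)) (stdExpVec n) ∧
      (1 - α) * (Real.log (∫ u, Real.exp (L q₀ u) ∂stdExpVec n) - N q₀ -
        Real.log (Real.Gamma (r q₀ + 1))) + α * (Real.log (∫ u, Real.exp (L q₁ u) ∂stdExpVec n) -
          N q₁ - Real.log (Real.Gamma (r q₁ + 1))) ≤
      Real.log (∫ u, Real.exp (L ((1 - α) • q₀ + α • q₁) u) ∂stdExpVec n) -
        N ((1 - α) • q₀ + α • q₁) - Real.log (Real.Gamma (r ((1 - α) • q₀ + α • q₁) + 1)) := by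
    intro q₀ hq₀ q₁ hq₁ α hα
    obtain ⟨c, hc⟩ : ∃ c : ℝ → Q, c = fun t => (1 - t) • q₀ + t • q₁ := ⟨_, rfl⟩
    have cS : ∀ t ∈ Icc (0:ℝ) 1, c t ∈ S := fun t ht => by
      rw [hc]; exact hS hq₀ hq₁ (by linarith [ht.2]) ht.1 (by ring)
    have caff : ∀ s t a b : ℝ, a + b = 1 → c (a * s + b * t) = a • c s + b • c t := by
      intro s t a b hab
      obtain rfl : b = 1 - a := by linarith
      simp only [hc]
      module
    have rc : ∀ t, r (c t) = r q₀ + (r q₁ - r q₀) * t := by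
      intro t; simp only [hc, map_add, map_smul, smul_eq_mul]; ring
    have c0 : c 0 = q₀ := by simp [hc]
    have c1 : c 1 = q₁ := by simp [hc]
    have cα : c α = (1 - α) • q₀ + α • q₁ := by rw [hc]
    obtain ⟨int, two⟩ := row_two_point (r₀ := r q₀) (ρ := r q₁ - r q₀) (hr _ hq₀)
      (by simpa using hr _ hq₁) (L := fun t u => L (c t) u - N (c t)) (by
        refine ⟨(convex_Icc 0 1).prod (convex_orthant n), ?_⟩
        rintro ⟨s, u⟩ ⟨hs, hu⟩ ⟨t, v⟩ ⟨ht, hv⟩ a b ha hb hab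
        have := conc.2 (show (c s, u) ∈ S ×ˢ orthant n from ⟨cS s hs, hu⟩)
          (show (c t, v) ∈ S ×ˢ orthant n from ⟨cS t ht, hv⟩) ha hb hab
        simp only [Prod.smul_mk, Prod.mk_add_mk, smul_eq_mul, ← caff s t a b hab, rc] at this ⊢
        exact this) (by
        intro t ht u hu z hz
        rw [hom _ (cS t ht) u hu z hz, rc]
        ring) hα
    have sub : ∀ t, ∀ u, Real.exp (L (c t) u - N (c t)) =
        Real.exp (-N (c t)) * Real.exp (L (c t) u) := by
      intro t u; rw [← Real.exp_add]; congr 1; ring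
    simp only [sub] at int two
    have i' : ∀ t ∈ Icc (0:ℝ) 1, Integrable (fun u => Real.exp (L (c t) u)) (stdExpVec n) := by
      intro t ht
      refine ((int t ht).const_mul (Real.exp (N (c t)))).congr (Eventually.of_forall fun u => ?_)
      simp only
      rw [← mul_assoc, ← Real.exp_add]; simp
    have lg : ∀ t ∈ Icc (0:ℝ) 1, Real.log (∫ u, Real.exp (-N (c t)) * Real.exp (L (c t) u)
        ∂stdExpVec n) = Real.log (∫ u, Real.exp (L (c t) u) ∂stdExpVec n) - N (c t) := by
      intro t ht
      rw [MeasureTheory.integral_const_mul, Real.log_mul (Real.exp_pos _).ne'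
        (integral_exp_pos (i' t ht)).ne', Real.log_exp]
      ring
    have m0 : (0:ℝ) ∈ Icc (0:ℝ) 1 := left_mem_Icc.2 zero_le_one
    have m1 : (1:ℝ) ∈ Icc (0:ℝ) 1 := right_mem_Icc.2 zero_le_one
    rw [lg 0 m0, lg 1 m1, lg α (Ioo_subset_Icc_self hα), ← rc α, cα, c0, c1, add_sub_cancel] at two
    have i0 := i' 0 m0
    rw [c0] at i0
    exact ⟨i0, two⟩
  refine ⟨fun q hq => (main q hq q hq (1/2) (by constructor <;> norm_num)).1, ?_⟩
  rw [concaveOn_iff_forall_pos]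
  refine ⟨hS, fun x hx y hy a b ha hb hab => ?_⟩
  obtain rfl : a = 1 - b := by linarith
  exact (main x hx y hy b ⟨hb, by linarith⟩).2

/-- Tuples of vectors with positive entries. -/
def orthants (m n : ℕ) : Set (Fin m → Fin n → ℝ) := {G | ∀ i, G i ∈ orthant n}

theorem isOpen_orthants (m n : ℕ) : IsOpen (orthants m n) := by
  simp only [orthants, ofPred_forall]
  exact isOpen_iInter_of_finite fun i => (isOpen_orthant n).preimage (continuous_apply i)

theorem convex_orthants (m n : ℕ) : Convex ℝ (orthants m n) := fun _ hx _ hy _ _ ha hb hab i =>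
  convex_orthant n (hx i) (hy i) ha hb hab

/-- The law of a matrix with independent standard exponential entries. -/
noncomputable def stdExpMat (m n : ℕ) : Measure (Fin m → Fin n → ℝ) :=
  Measure.pi fun _ => stdExpVec n

instance (m n : ℕ) : IsProbabilityMeasure (stdExpMat m n) := by
  unfold stdExpMat; infer_instance

theorem ae_stdExpMat (m n : ℕ) : ∀ᵐ G ∂stdExpMat m n, G ∈ orthants m n := by
  have : ∀ᵐ G ∂stdExpMat m n, ∀ i, G i ∈ orthant n := by
    rw [ae_all_iff]
    intro i
    exact (Measure.tendsto_eval_ae_ae (μ := fun _ : Fin m => stdExpVec n) (i := i)).eventually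
      (ae_stdExpVec n)
  exact this

theorem cons_mem_orthants {m n : ℕ} {u : Fin n → ℝ} {G : Fin m → Fin n → ℝ} (hu : u ∈ orthant n)
    (hG : G ∈ orthants m n) : (Fin.cons u G : Fin (m + 1) → Fin n → ℝ) ∈ orthants (m + 1) n :=
  fun i => by
    refine Fin.cases ?_ (fun j => ?_) i
    · simpa using hu
    · simpa using hG j

theorem measurePreserving_cons (m n : ℕ) : MeasurePreserving
    (fun p : (Fin n → ℝ) × (Fin m → Fin n → ℝ) => (Fin.cons p.1 p.2 : Fin (m + 1) → Fin n → ℝ))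
    ((stdExpVec n).prod (stdExpMat m n)) (stdExpMat (m + 1) n) := by
  have := (measurePreserving_piFinSuccAbove (fun _ : Fin (m + 1) => stdExpVec n) 0).symm
  convert this using 1
  swap; · rfl
  swap; · rfl
  ext p i
  refine Fin.cases ?_ (fun j => ?_) i <;> simp [MeasurableEquiv.piFinSuccAbove]

theorem concaveOn_log_integral_rows {n : ℕ} {P : Type*} [AddCommGroup P] [Module ℝ P] {S : Set P}
    (hS : Convex ℝ S) : ∀ (m : ℕ) (L : P → (Fin m → Fin n → ℝ) → ℝ) (r : Fin m → P →ₗ[ℝ] ℝ),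
    (∀ i, ∀ p ∈ S, 0 < r i p) →
    (ConcaveOn ℝ (S ×ˢ orthants m n) fun p =>
      L p.1 p.2 - ∑ i, r i p.1 * Real.log (r i p.1)) →
    (∀ p ∈ S, ∀ G ∈ orthants m n, ∀ i, ∀ z : ℝ, 0 < z →
      L p (Function.update G i (z • G i)) = L p G + r i p * Real.log z) →
    (∀ p ∈ S, Integrable (fun G => Real.exp (L p G)) (stdExpMat m n)) ∧
    ConcaveOn ℝ S fun p => Real.log (∫ G, Real.exp (L p G) ∂stdExpMat m n) -
      ∑ i, Real.log (Real.Gamma (r i p + 1))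
  | 0, L, r, hr, conc, hom => by
    have e : stdExpMat 0 n = Measure.dirac default := Measure.pi_of_empty _ _
    constructor
    · intro p hp
      rw [e]
      exact integrable_dirac (by simp)
    · refine ⟨hS, fun x hx y hy a b ha hb hab => ?_⟩
      have m0 : (default : Fin 0 → Fin n → ℝ) ∈ orthants 0 n := fun i => i.elim0
      have := conc.2 (show (x, default) ∈ S ×ˢ orthants 0 n from ⟨hx, m0⟩)
        (show (y, default) ∈ S ×ˢ orthants 0 n from ⟨hy, m0⟩) ha hb hab
      simp only [e, integral_dirac, Real.log_exp, Finset.univ_eq_empty, Finset.sum_empty,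
        sub_zero] at this ⊢
      convert this using 2
      rfl
  | m + 1, L, r, hr, conc, hom => by
    have row := concaveOn_log_integral_row (n := n) (hS.prod (convex_orthants m n))
      (L := fun q u => L q.1 (Fin.cons u q.2))
      (N := fun q => ∑ i : Fin m, r i.succ q.1 * Real.log (r i.succ q.1))
      (r 0 ∘ₗ LinearMap.fst ℝ P (Fin m → Fin n → ℝ)) (fun q hq => hr 0 q.1 hq.1) (by
        refine ⟨(hS.prod (convex_orthants m n)).prod (convex_orthant n), ?_⟩
        rintro ⟨⟨p, G⟩, u⟩ ⟨⟨hp, hG⟩, hu⟩ ⟨⟨q, H⟩, v⟩ ⟨⟨hq, hH⟩, hv⟩ a b ha hb hab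
        have := conc.2 (show (p, Fin.cons u G) ∈ S ×ˢ orthants (m + 1) n from
          ⟨hp, cons_mem_orthants hu hG⟩) (show (q, Fin.cons v H) ∈ S ×ˢ orthants (m + 1) n from
          ⟨hq, cons_mem_orthants hv hH⟩) ha hb hab
        have e : a • (Fin.cons u G : Fin (m + 1) → Fin n → ℝ) +
            b • (Fin.cons v H : Fin (m + 1) → Fin n → ℝ) =
            (Fin.cons (a • u + b • v) (a • G + b • H) : Fin (m + 1) → Fin n → ℝ) := by
          ext i
          refine Fin.cases ?_ (fun j => ?_) i <;> simp
        simp only [Prod.smul_mk, Prod.mk_add_mk, e, Fin.sum_univ_succ, LinearMap.comp_apply,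
          LinearMap.fst_apply] at this ⊢
        simp only [sub_sub, add_comm] at this ⊢
        exact this) (by
        intro q hq u hu z hz
        have := hom q.1 hq.1 _ (cons_mem_orthants hu hq.2) 0 z hz
        simp only [Fin.update_cons_zero, Fin.cons_zero] at this
        exact this)
    obtain ⟨rint, rconc⟩ := row
    have ih := concaveOn_log_integral_rows hS m
      (fun p G => Real.log (∫ u, Real.exp (L p (Fin.cons u G)) ∂stdExpVec n) -
        Real.log (Real.Gamma (r 0 p + 1))) (fun i => r i.succ) (fun i => hr i.succ) (by
        refine rconc.congr fun q hq => ?_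
        simp only [LinearMap.comp_apply, LinearMap.fst_apply]
        ring) (by
        intro p hp G hG i z hz
        have hi := rint (p, G) ⟨hp, hG⟩
        have : ∀ᵐ u ∂stdExpVec n, Real.exp (L p (Fin.cons u (Function.update G i (z • G i)))) =
            Real.exp (r i.succ p * Real.log z) * Real.exp (L p (Fin.cons u G)) := by
          filter_upwards [ae_stdExpVec n] with u hu
          have := hom p hp _ (cons_mem_orthants hu hG) i.succ z hz
          rw [Fin.cons_succ, ← Fin.cons_update] at this
          rw [this, ← Real.exp_add, add_comm]
        rw [integral_congr_ae this, MeasureTheory.integral_const_mul, Real.log_mul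
          (Real.exp_pos _).ne' (integral_exp_pos hi).ne', Real.log_exp]
        ring)
    obtain ⟨iint, iconc⟩ := ih
    have cL : ∀ p ∈ S, ContinuousOn (L p) (orthants (m + 1) n) := fun p hp =>
      continuousOn_of_concave_slice (isOpen_orthants _ n) (convex_orthants _ n)
        (N := fun p => ∑ i, r i p * Real.log (r i p)) conc hp
    have mL : ∀ p ∈ S, AEStronglyMeasurable (fun G => Real.exp (L p G)) (stdExpMat (m + 1) n) := by
      intro p hp
      have := (cL p hp).aemeasurable (μ := stdExpMat (m + 1) n) (isOpen_orthants _ n).measurableSet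
      rw [Measure.restrict_eq_self_of_ae_mem (ae_stdExpMat _ n)] at this
      exact this.exp.aestronglyMeasurable
    have mp := measurePreserving_cons m n
    have gpos : ∀ p ∈ S, 0 < Real.Gamma (r 0 p + 1) := fun p hp =>
      Real.Gamma_pos_of_pos (by linarith [hr 0 p hp])
    have inner : ∀ p ∈ S, ∀ᵐ G ∂stdExpMat m n,
        ∫ u, Real.exp (L p (Fin.cons u G)) ∂stdExpVec n = Real.Gamma (r 0 p + 1) *
          Real.exp (Real.log (∫ u, Real.exp (L p (Fin.cons u G)) ∂stdExpVec n) -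
        Real.log (Real.Gamma (r 0 p + 1))) := by
      intro p hp
      filter_upwards [ae_stdExpMat m n] with G hG
      rw [Real.exp_sub, Real.exp_log (integral_exp_pos (rint (p, G) ⟨hp, hG⟩)),
        Real.exp_log (gpos p hp), mul_div_cancel₀ _ (gpos p hp).ne']
    have pint : ∀ p ∈ S, Integrable (fun q : (Fin n → ℝ) × (Fin m → Fin n → ℝ) =>
        Real.exp (L p (Fin.cons q.1 q.2))) ((stdExpVec n).prod (stdExpMat m n)) := by
      intro p hp
      have ms : AEStronglyMeasurable (fun q : (Fin n → ℝ) × (Fin m → Fin n → ℝ) =>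
        Real.exp (L p (Fin.cons q.1 q.2))) ((stdExpVec n).prod (stdExpMat m n)) :=
        (mL p hp).comp_measurePreserving mp
      rw [integrable_prod_iff' ms]
      constructor
      · filter_upwards [ae_stdExpMat m n] with G hG
        exact rint (p, G) ⟨hp, hG⟩
      · simp only [Real.norm_eq_abs, Real.abs_exp]
        exact ((iint p hp).const_mul _).congr ((inner p hp).mono fun G h => h.symm)
    have tot : ∀ p ∈ S, ∫ G, Real.exp (L p G) ∂stdExpMat (m + 1) n =
        Real.Gamma (r 0 p + 1) * ∫ G,
          Real.exp (Real.log (∫ u, Real.exp (L p (Fin.cons u G)) ∂stdExpVec n) -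
        Real.log (Real.Gamma (r 0 p + 1))) ∂stdExpMat m n := by
      intro p hp
      rw [← MeasureTheory.integral_const_mul, ← integral_congr_ae (inner p hp)]
      rw [← integral_prod_symm (fun q : (Fin n → ℝ) × (Fin m → Fin n → ℝ) =>
        Real.exp (L p (Fin.cons q.1 q.2))) (pint p hp)]
      rw [← mp.map_eq, integral_map mp.measurable.aemeasurable]
      rw [mp.map_eq]
      exact mL p hp
    refine ⟨fun p hp => ?_, iconc.congr fun p hp => ?_⟩
    · rw [← mp.map_eq, integrable_map_measure (by rw [mp.map_eq]; exact mL p hp)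
        mp.measurable.aemeasurable]
      exact pint p hp
    · simp only
      rw [tot p hp, Real.log_mul (gpos p hp).ne' (integral_exp_pos (iint p hp)).ne',
        Fin.sum_univ_succ]
      ring

end

theorem mul_log_sub_perspective_le {r₀ r₁ A₀ A₁ a b : ℝ} (hr₀ : 0 < r₀) (hr₁ : 0 < r₁)
    (hA₀ : 0 < A₀) (hA₁ : 0 < A₁) (ha : 0 ≤ a) (hb : 0 ≤ b) (hab : a + b = 1) :
    a * (r₀ * Real.log A₀ - r₀ * Real.log r₀) + b * (r₁ * Real.log A₁ - r₁ * Real.log r₁) ≤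
      (a * r₀ + b * r₁) * Real.log (a * A₀ + b * A₁) -
      (a * r₀ + b * r₁) * Real.log (a * r₀ + b * r₁) := by
  have comb : ∀ {x y : ℝ}, 0 < x → 0 < y → 0 < a * x + b * y := fun hx hy => by
    have := convex_Ioi (0:ℝ) (mem_Ioi.2 hx) (mem_Ioi.2 hy) ha hb hab
    simpa using this
  have hr := comb hr₀ hr₁
  have hA := comb hA₀ hA₁
  set r := a * r₀ + b * r₁ with hrd
  set A := a * A₀ + b * A₁ with hAd
  have key : ∀ {s B : ℝ}, 0 < s → 0 < B → s * Real.log B - s * Real.log s ≤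
      s * (Real.log A - Real.log r) + B * r / A - s := by
    intro s B hs hB
    have := Real.log_le_sub_one_of_pos (show 0 < B * r / (s * A) by positivity)
    rw [Real.log_div (by positivity) (by positivity), Real.log_mul hB.ne' hr.ne',
      Real.log_mul hs.ne' hA.ne'] at this
    have h := mul_le_mul_of_nonneg_left this hs.le
    have e : s * (B * r / (s * A) - 1) = B * r / A - s := by field_simp
    rw [e] at h
    linarith
  have k₀ := mul_le_mul_of_nonneg_left (key hr₀ hA₀) ha
  have k₁ := mul_le_mul_of_nonneg_left (key hr₁ hA₁) hb
  refine (add_le_add k₀ k₁).trans (le_of_eq ?_)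
  have e : a * (A₀ * r / A) + b * (A₁ * r / A) = r := by
    rw [← mul_div_assoc, ← mul_div_assoc, ← add_div, div_eq_iff hA.ne', hAd]; ring
  have : a * (r₀ * (Real.log A - Real.log r) + A₀ * r / A - r₀) +
    b * (r₁ * (Real.log A - Real.log r) + A₁ * r / A - r₁) =
    (a * r₀ + b * r₁) * (Real.log A - Real.log r) + (a * (A₀ * r / A) + b * (A₁ * r / A))
     - (a * r₀ + b * r₁) := by ring
  rw [this, e, ← hrd]
  ring

/-- Pairs of positive margins with equal totals. -/
def margins (m n : ℕ) : Set ((Fin m → ℝ) × (Fin n → ℝ)) :=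
  {p | (∀ i, 0 < p.1 i) ∧ (∀ j, 0 < p.2 j) ∧ ∑ i, p.1 i = ∑ j, p.2 j}

theorem convex_margins (m n : ℕ) : Convex ℝ (margins m n) := by
  intro x hx y hy a b ha hb hab
  refine ⟨convex_orthant m hx.1 hy.1 ha hb hab, convex_orthant n hx.2.1 hy.2.1 ha hb hab, ?_⟩
  simp [Finset.sum_add_distrib, ← Finset.mul_sum, hx.2.2, hy.2.2]

/-- The objective whose infimum over `y` is the logarithmic capacity. -/
noncomputable def capObjective {m n : ℕ} (W : Fin m → Fin n → ℝ)
    (p : (Fin m → ℝ) × (Fin n → ℝ)) (G : Fin m → Fin n → ℝ) (y : Fin n → ℝ) : ℝ :=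
  ∑ i, p.1 i * Real.log (∑ j, G i j * W i j * Real.exp (y j)) - ∑ j, p.2 j * y j

/-- The logarithmic capacity of a product of linear forms. -/
noncomputable def logCap {m n : ℕ} (W : Fin m → Fin n → ℝ)
    (p : (Fin m → ℝ) × (Fin n → ℝ)) (G : Fin m → Fin n → ℝ) : ℝ :=
  ⨅ y, capObjective W p G y

section Capacity

variable {m n : ℕ} {W : Fin m → Fin n → ℝ}

theorem linearForm_pos (hn : 0 < n) (hW : ∀ i j, 0 < W i j) {G : Fin m → Fin n → ℝ}
    (hG : G ∈ orthants m n) (i : Fin m) (y : Fin n → ℝ) :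
    0 < ∑ j, G i j * W i j * Real.exp (y j) := by
  have : Nonempty (Fin n) := ⟨⟨0, hn⟩⟩
  refine Finset.sum_pos (fun j _ => ?_) Finset.univ_nonempty
  exact mul_pos (mul_pos (hG i j) (hW i j)) (Real.exp_pos _)

theorem bddBelow_capObjective (hn : 0 < n) (hW : ∀ i j, 0 < W i j)
    {p : (Fin m → ℝ) × (Fin n → ℝ)} (hp : p ∈ margins m n) {G : Fin m → Fin n → ℝ}
    (hG : G ∈ orthants m n) : BddBelow (range (capObjective W p G)) := by
  have : Nonempty (Fin n) := ⟨⟨0, hn⟩⟩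
  obtain ⟨hr, hc, hs⟩ := hp
  set N := ∑ j, p.2 j with hN
  have Np : 0 < N := Finset.sum_pos (fun j _ => hc j) Finset.univ_nonempty
  refine ⟨∑ i, p.1 i * ∑ j, p.2 j / N * Real.log (G i j * W i j), ?_⟩
  rintro _ ⟨y, rfl⟩
  have key : ∀ i, ∑ j, p.2 j / N * Real.log (G i j * W i j) + ∑ j, p.2 j / N * y j ≤
      Real.log (∑ j, G i j * W i j * Real.exp (y j)) := by
    intro i
    have pos : ∀ j, 0 < G i j * W i j * Real.exp (y j) := fun j =>
      mul_pos (mul_pos (hG i j) (hW i j)) (Real.exp_pos _)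
    have jensen := strictConcaveOn_log_Ioi.concaveOn.le_map_sum (t := Finset.univ)
      (w := fun j => p.2 j / N) (p := fun j => G i j * W i j * Real.exp (y j))
      (fun j _ => (div_pos (hc j) Np).le) (by rw [← Finset.sum_div, ← hN, div_self Np.ne'])
      (fun j _ => pos j)
    simp only [smul_eq_mul] at jensen
    have e : ∑ j, p.2 j / N * Real.log (G i j * W i j) + ∑ j, p.2 j / N * y j =
        ∑ j, p.2 j / N * Real.log (G i j * W i j * Real.exp (y j)) := by
      rw [← Finset.sum_add_distrib]
      refine Finset.sum_congr rfl fun j _ => ?_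
      rw [Real.log_mul (mul_pos (hG i j) (hW i j)).ne' (Real.exp_pos _).ne', Real.log_exp]
      ring
    rw [e]
    refine jensen.trans (Real.log_le_log (Finset.sum_pos (fun j _ => mul_pos (div_pos (hc j) Np)
      (pos j)) Finset.univ_nonempty) (Finset.sum_le_sum fun j _ => ?_))
    refine mul_le_of_le_one_left (pos j).le ((div_le_one Np).2 ?_)
    exact Finset.single_le_sum (fun k _ => (hc k).le) (Finset.mem_univ j)
  have tot := Finset.sum_le_sum fun i (_ : i ∈ Finset.univ) =>
    mul_le_mul_of_nonneg_left (key i) (hr i).le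
  have e : ∑ i, p.1 i * ∑ j, p.2 j / N * y j = ∑ j, p.2 j * y j := by
    rw [← Finset.sum_mul, hs, Finset.mul_sum]
    refine Finset.sum_congr rfl fun j _ => ?_
    field_simp
  simp only [mul_add, Finset.sum_add_distrib, e] at tot
  unfold capObjective
  linarith

theorem concaveOn_logCap (hn : 0 < n) (hW : ∀ i j, 0 < W i j) :
    ConcaveOn ℝ (margins m n ×ˢ orthants m n) fun p =>
      logCap W p.1 p.2 - ∑ i, p.1.1 i * Real.log (p.1.1 i) := by
  refine ⟨(convex_margins m n).prod (convex_orthants m n), ?_⟩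
  rintro ⟨p, G⟩ ⟨hp, hG⟩ ⟨q, H⟩ ⟨hq, hH⟩ a b ha hb hab
  simp only [Prod.smul_mk, Prod.mk_add_mk, smul_eq_mul] at hp hq hG hH ⊢
  rw [le_sub_iff_add_le]
  refine le_ciInf fun y => ?_
  have l₀ : a * logCap W p G ≤ a * capObjective W p G y :=
    mul_le_mul_of_nonneg_left (ciInf_le (bddBelow_capObjective hn hW hp hG) y) ha
  have l₁ : b * logCap W q H ≤ b * capObjective W q H y :=
    mul_le_mul_of_nonneg_left (ciInf_le (bddBelow_capObjective hn hW hq hH) y) hb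
  have row := Finset.sum_le_sum fun i (_ : i ∈ Finset.univ) => mul_log_sub_perspective_le
    (hp.1 i) (hq.1 i) (linearForm_pos hn hW hG i y) (linearForm_pos hn hW hH i y) ha hb hab
  have e : ∀ i, a * ∑ j, G i j * W i j * Real.exp (y j) + b * ∑ j, H i j * W i j * Real.exp (y j)
      = ∑ j, (a • G + b • H) i j * W i j * Real.exp (y j) := by
    intro i
    rw [Finset.mul_sum, Finset.mul_sum, ← Finset.sum_add_distrib]
    refine Finset.sum_congr rfl fun j _ => ?_
    simp only [Pi.add_apply, Pi.smul_apply, smul_eq_mul]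
    ring
  have c : ∑ j, (a • p + b • q).2 j * y j = a * ∑ j, p.2 j * y j + b * ∑ j, q.2 j * y j := by
    rw [Finset.mul_sum, Finset.mul_sum, ← Finset.sum_add_distrib]
    refine Finset.sum_congr rfl fun j _ => ?_
    simp only [Prod.snd_add, Prod.smul_snd, Pi.add_apply, Pi.smul_apply, smul_eq_mul]
    ring
  simp only [e, Finset.sum_add_distrib, Finset.sum_sub_distrib, ← Finset.mul_sum] at row
  simp only [capObjective, mul_sub] at l₀ l₁ ⊢
  rw [c]
  simp only [Prod.fst_add, Prod.smul_fst, Pi.add_apply, Pi.smul_apply, smul_eq_mul] at row ⊢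
  linarith

theorem capObjective_update (hn : 0 < n) (hW : ∀ i j, 0 < W i j)
    (p : (Fin m → ℝ) × (Fin n → ℝ)) {G : Fin m → Fin n → ℝ} (hG : G ∈ orthants m n) (i : Fin m)
    {z : ℝ} (hz : 0 < z) (y : Fin n → ℝ) :
    capObjective W p (Function.update G i (z • G i)) y =
      capObjective W p G y + p.1 i * Real.log z := by
  have : ∀ k, p.1 k * Real.log (∑ j, Function.update G i (z • G i) k j * W k j * Real.exp (y j)) =
      p.1 k * Real.log (∑ j, G k j * W k j * Real.exp (y j)) +
        if k = i then p.1 i * Real.log z else 0 := by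
    intro k
    rcases eq_or_ne k i with rfl | h
    · simp only [Function.update_self, Pi.smul_apply, smul_eq_mul, mul_assoc, ← Finset.mul_sum,
        if_true]
      have := (linearForm_pos hn hW hG k y).ne'
      simp only [mul_assoc] at this
      rw [Real.log_mul hz.ne' this]
      ring
    · simp [h]
  unfold capObjective
  simp only [this, Finset.sum_add_distrib, Finset.sum_ite_eq', Finset.mem_univ, if_true]
  ring

theorem logCap_update (hn : 0 < n) (hW : ∀ i j, 0 < W i j)
    {p : (Fin m → ℝ) × (Fin n → ℝ)} (hp : p ∈ margins m n) {G : Fin m → Fin n → ℝ}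
    (hG : G ∈ orthants m n) (i : Fin m) {z : ℝ} (hz : 0 < z) :
    logCap W p (Function.update G i (z • G i)) = logCap W p G + p.1 i * Real.log z := by
  unfold logCap
  rw [ciInf_add (bddBelow_capObjective hn hW hp hG)]
  exact iInf_congr fun y => capObjective_update hn hW p hG i hz y

theorem concaveOn_log_integral_cap (hn : 0 < n) (hW : ∀ i j, 0 < W i j) :
    (∀ p ∈ margins m n, Integrable (fun G => Real.exp (logCap W p G)) (stdExpMat m n)) ∧
    ConcaveOn ℝ (margins m n) fun p => Real.log (∫ G, Real.exp (logCap W p G) ∂stdExpMat m n) -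
      ∑ i, Real.log (Real.Gamma (p.1 i + 1)) := by
  obtain ⟨r, hr⟩ : ∃ r : Fin m → ((Fin m → ℝ) × (Fin n → ℝ)) →ₗ[ℝ] ℝ, ∀ i p, r i p = p.1 i :=
    ⟨fun i => LinearMap.proj i ∘ₗ LinearMap.fst ℝ (Fin m → ℝ) (Fin n → ℝ), fun _ _ => rfl⟩
  have := concaveOn_log_integral_rows (n := n) (convex_margins m n) m (logCap W) r
    (fun i p hp => by rw [hr]; exact hp.1 i)
    (by simp only [hr]; exact concaveOn_logCap hn hW)
    (fun p hp G hG i z hz => by rw [hr]; exact logCap_update hn hW hp hG i hz)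
  simpa only [hr] using this

end Capacity

/-- The polynomial has degree at most `d` and its normalised coefficients form a positive
log-concave sequence. -/
def IsUltraLogConcave (d : ℕ) (u : Polynomial ℝ) : Prop :=
  ∃ b : ℕ → ℝ, (∀ k ≤ d, 0 < b k) ∧ (∀ k, k + 2 ≤ d → b k * b (k + 2) ≤ b (k + 1) ^ 2) ∧
    ∀ k, u.coeff k = d.choose k * b k

theorem IsUltraLogConcave.mul_X_add_C {d : ℕ} {u : Polynomial ℝ} (h : IsUltraLogConcave d u)
    {ρ : ℝ} (hρ : 0 < ρ) : IsUltraLogConcave (d + 1) (u * (Polynomial.X + Polynomial.C ρ)) := by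
  obtain ⟨b, pos, lc, hb⟩ := h
  have dp : (0:ℝ) < d + 1 := by positivity
  refine ⟨fun k => ((d + 1 - k : ℝ) * ρ * b k + k * b (k - 1)) / (d + 1), ?_, ?_, ?_⟩
  · intro k hk
    refine div_pos ?_ dp
    rcases Nat.lt_or_ge d k with h | h
    · obtain rfl : k = d + 1 := by omega
      have := pos d le_rfl
      simp only [Nat.cast_add, Nat.cast_one, sub_self, zero_mul, zero_add, Nat.add_sub_cancel]
      positivity
    · have h1 : (k:ℝ) ≤ d := by exact_mod_cast h
      have h2 : 0 < (d + 1 - k : ℝ) * ρ * b k :=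
        mul_pos (mul_pos (by linarith) hρ) (pos k h)
      have h3 : 0 ≤ (k:ℝ) * b (k - 1) := mul_nonneg (by positivity) (pos _ (by omega)).le
      linarith
  · intro k hk
    obtain ⟨e, rfl⟩ : ∃ e, d = k + 1 + e := ⟨d - (k + 1), by omega⟩
    simp only [div_pow, div_mul_div_comm, ← sq]
    refine div_le_div_of_nonneg_right ?_ (by positivity)
    have h1 : 0 ≤ (e:ℝ) * (b (k + 1) ^ 2 - b k * b (k + 2)) := by
      rcases Nat.eq_zero_or_pos e with rfl | h
      · simp
      · exact mul_nonneg (by positivity) (sub_nonneg.2 (lc k (by omega)))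
    have h2 : 0 ≤ (k:ℝ) * (b k ^ 2 - b (k - 1) * b (k + 1)) := by
      rcases Nat.eq_zero_or_pos k with rfl | h
      · simp
      · obtain ⟨l, rfl⟩ : ∃ l, k = l + 1 := ⟨k - 1, by omega⟩
        exact mul_nonneg (by positivity) (sub_nonneg.2 (lc l (by omega)))
    have h3 : 0 ≤ (k:ℝ) * e * (b k * b (k + 1) - b (k - 1) * b (k + 2)) := by
      rcases Nat.eq_zero_or_pos k with rfl | h
      · simp
      rcases Nat.eq_zero_or_pos e with rfl | h'
      · simp
      refine mul_nonneg (by positivity) (sub_nonneg.2 ?_)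
      obtain ⟨l, rfl⟩ : ∃ l, k = l + 1 := ⟨k - 1, by omega⟩
      have a1 := lc l (by omega)
      have a2 := lc (l + 1) (by omega)
      have p0 := pos l (by omega)
      have p1 := pos (l + 1) (by omega)
      have p2 := pos (l + 1 + 1) (by omega)
      have p3 := pos (l + 1 + 2) (by omega)
      simp only [Nat.add_sub_cancel]
      have := mul_le_mul a1 a2 (by positivity) (by positivity)
      have e : b l * b (l + 2) * (b (l + 1) * b (l + 1 + 2)) =
        (b (l + 1) * b (l + 1 + 1)) * (b l * b (l + 1 + 2)) := by
          rw [show l + 2 = l + 1 + 1 from rfl]; ring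
      rw [e, show b (l + 1) ^ 2 * b (l + 1 + 1) ^ 2 =
        (b (l + 1) * b (l + 1 + 1)) * (b (l + 1) * b (l + 1 + 1)) by ring] at this
      exact le_of_mul_le_mul_left this (by positivity)
    have e1 : k + 1 - 1 = k := rfl
    have e2 : k + 2 - 1 = k + 1 := rfl
    rw [e1, e2]
    push_cast
    have k0 : (0:ℝ) ≤ k := by positivity
    have e0 : (0:ℝ) ≤ e := by positivity
    have m1 := mul_nonneg (sq_nonneg ρ) (mul_nonneg (by linarith : (0:ℝ) ≤ e + 2) h1)
    have m2 := mul_nonneg (by linarith : (0:ℝ) ≤ k + 2) h2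
    have m3 := mul_nonneg hρ.le h3
    have m4 := sq_nonneg (ρ * b (k + 1) - b k)
    linarith
  · intro k
    rw [mul_add, Polynomial.coeff_add, Polynomial.coeff_mul_C, hb k]
    rcases k with _ | k
    · simp only [Polynomial.coeff_mul_X_zero, Nat.choose_zero_right, Nat.cast_zero, Nat.cast_one]
      field_simp
      ring
    · rw [Polynomial.coeff_mul_X, hb k]
      have c1 : ((d + 1).choose (k + 1) : ℝ) * (k + 1) = (d + 1) * d.choose k := by
        exact_mod_cast (Nat.add_one_mul_choose_eq d k).symm
      have c2 : ((d + 1).choose (k + 1) : ℝ) * (d + 1 - (k + 1)) =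
          (d + 1) * d.choose (k + 1) := by
        have : ((d + 1).choose (k + 1) : ℝ) = d.choose k + d.choose (k + 1) := by
          exact_mod_cast Nat.choose_succ_succ d k
        rw [this] at c1 ⊢
        linarith
      simp only [Nat.add_sub_cancel]
      push_cast
      rw [← mul_div_assoc, eq_div_iff dp.ne', mul_add]
      linear_combination (-ρ * b (k + 1)) * c2 - b k * c1

theorem isUltraLogConcave_prod {a : ℝ} (ha : 0 < a) (s : Multiset ℝ) (hs : ∀ x ∈ s, x < 0) :
    IsUltraLogConcave (Multiset.card s)
      (Polynomial.C a * (s.map fun x => Polynomial.X - Polynomial.C x).prod) := by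
  induction s using Multiset.induction_on with
  | empty =>
    refine ⟨fun _ => a, fun _ _ => ha, fun k hk => by simp at hk, fun k => ?_⟩
    rcases k with _ | k <;> simp [Polynomial.coeff_C]
  | cons x s ih =>
    have := (ih fun y hy => hs y (Multiset.mem_cons_of_mem hy)).mul_X_add_C
      (ρ := -x) (by linarith [hs x (Multiset.mem_cons_self x s)])
    rw [Multiset.card_cons, Multiset.map_cons, Multiset.prod_cons]
    convert this using 1
    rw [Polynomial.C_neg]
    ring

theorem IsUltraLogConcave.natDegree_le {d : ℕ} {u : Polynomial ℝ} (h : IsUltraLogConcave d u) :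
    u.natDegree ≤ d := by
  obtain ⟨b, -, -, hb⟩ := h
  refine Polynomial.natDegree_le_iff_coeff_eq_zero.2 fun k hk => ?_
  rw [hb, Nat.choose_eq_zero_of_lt hk]
  simp

theorem IsUltraLogConcave.le_coeff {d : ℕ} {u : Polynomial ℝ} (h : IsUltraLogConcave d u)
    {c : ℕ} (hc : 0 < c) (hcd : c < d) {K : ℝ} (hK : ∀ t : ℝ, 0 < t → K * t ^ c ≤ u.eval t) :
    K * (d.choose c * (c:ℝ) ^ c * ((d - c : ℕ):ℝ) ^ (d - c) / (d:ℝ) ^ d) ≤ u.coeff c := by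
  have deg := h.natDegree_le
  obtain ⟨b, pos, lc, hb⟩ := h
  have bc := pos c hcd.le
  obtain ⟨r, hr⟩ : ∃ r, r = b (c + 1) / b c := ⟨_, rfl⟩
  have rp : 0 < r := hr ▸ div_pos (pos (c + 1) hcd) bc
  have r1 : b (c + 1) = r * b c := by rw [hr]; field_simp
  have up : ∀ j : ℕ, c + j + 1 ≤ d → b (c + j + 1) ≤ r * b (c + j) := by
    intro j
    induction j with
    | zero => intro _; exact r1.le
    | succ j ih =>
      intro hj
      have i := ih (by omega)
      have l := lc (c + j) (by omega)
      have p0 := pos (c + j) (by omega)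
      have p1 := pos (c + j + 1) (by omega)
      have : b (c + j) * b (c + j + 2) ≤ b (c + j) * (r * b (c + j + 1)) := by nlinarith
      exact le_of_mul_le_mul_left this p0
  have up' : ∀ j : ℕ, c + j ≤ d → b (c + j) ≤ b c * r ^ j := by
    intro j
    induction j with
    | zero => intro _; simp
    | succ j ih =>
      intro hj
      have := mul_le_mul_of_nonneg_left (ih (by omega)) rp.le
      have := up j hj
      calc b (c + (j + 1)) ≤ r * b (c + j) := this
        _ ≤ r * (b c * r ^ j) := by assumption
        _ = b c * r ^ (j + 1) := by ring
  have down : ∀ j k : ℕ, k + j = c → r * b k ≤ b (k + 1) := by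
    intro j
    induction j with
    | zero => rintro k rfl; exact r1.ge
    | succ j ih =>
      intro k hk
      have i := ih (k + 1) (by omega)
      have l := lc k (by omega)
      have p0 := pos k (by omega)
      have p1 := pos (k + 1) (by omega)
      have i' := mul_le_mul_of_nonneg_left i p0.le
      have : b (k + 1) * (r * b k) ≤ b (k + 1) * b (k + 1) := by
        rw [show k + 1 + 1 = k + 2 from rfl] at i'
        nlinarith
      exact le_of_mul_le_mul_left this p1
  have down' : ∀ j k : ℕ, k + j = c → b k * r ^ j ≤ b c := by
    intro j
    induction j with
    | zero => rintro k rfl; simp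
    | succ j ih =>
      intro k hk
      have i := ih (k + 1) (by omega)
      have l := mul_le_mul_of_nonneg_right (down (j + 1) k hk) (pow_pos rp j).le
      calc b k * r ^ (j + 1) = r * b k * r ^ j := by ring
        _ ≤ b (k + 1) * r ^ j := l
        _ ≤ b c := i
  have key : ∀ k ≤ d, b k * r ^ c ≤ b c * r ^ k := by
    intro k hk
    rcases le_total c k with h | h
    · obtain ⟨j, rfl⟩ := Nat.exists_eq_add_of_le h
      have := mul_le_mul_of_nonneg_right (up' j hk) (pow_pos rp c).le
      rw [pow_add]
      linarith
    · obtain ⟨j, hj⟩ := Nat.exists_eq_add_of_le h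
      have := mul_le_mul_of_nonneg_right (down' j k hj.symm) (pow_pos rp k).le
      rw [hj, pow_add] at *
      linarith
  have bound : ∀ t : ℝ, 0 < t → u.eval t * r ^ c ≤ b c * (1 + r * t) ^ d := by
    intro t ht
    rw [Polynomial.eval_eq_sum_range' (Nat.lt_succ_of_le deg), add_comm, add_pow,
      Finset.sum_mul, Finset.mul_sum]
    refine Finset.sum_le_sum fun k hk => ?_
    have hk' := key k (Nat.lt_succ_iff.1 (Finset.mem_range.1 hk))
    have := mul_le_mul_of_nonneg_left hk' (show 0 ≤ (d.choose k:ℝ) * t ^ k by positivity)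
    rw [hb]
    simp only [one_pow, mul_one, mul_pow]
    linarith
  obtain ⟨e, rfl⟩ := Nat.exists_eq_add_of_lt hcd
  have cp : (0:ℝ) < c := by exact_mod_cast hc
  have sub : c + e + 1 - c = e + 1 := by omega
  rw [hb, sub]
  have tp : 0 < (c:ℝ) / ((e + 1) * r) := by positivity
  have k1 := mul_le_mul_of_nonneg_right (hK _ tp) (pow_pos rp c).le
  have k2 := k1.trans (bound _ tp)
  have e1 : 1 + r * ((c:ℝ) / ((e + 1) * r)) = (c + e + 1) / (e + 1) := by field_simp; ring
  rw [e1, mul_assoc, ← mul_pow, show (c:ℝ) / ((e + 1) * r) * r = c / (e + 1) by field_simp,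
    div_pow, div_pow, ← mul_div_assoc, ← mul_div_assoc, div_le_div_iff₀ (by positivity)
    (by positivity)] at k2
  have k3 : K * (c:ℝ) ^ c * (e + 1) ^ (e + 1) ≤ b c * (c + e + 1) ^ (c + e + 1) := by
    have : (0:ℝ) < (e + 1) ^ c := by positivity
    refine le_of_mul_le_mul_right ?_ this
    calc _ = K * (c:ℝ) ^ c * (e + 1) ^ (c + e + 1) := by ring
      _ ≤ _ := k2
  push_cast
  rw [← mul_div_assoc, div_le_iff₀ (by positivity)]
  have := mul_le_mul_of_nonneg_left k3 (show (0:ℝ) ≤ ((c + e + 1).choose c : ℕ) by positivity)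
  linarith

theorem le_coeff_of_forall_le_eval {d : ℕ} {u : Polynomial ℝ} (hd : u.natDegree ≤ d) {K : ℝ}
    (hK : ∀ t : ℝ, 0 < t → K * t ^ d ≤ u.eval t) : K ≤ u.coeff d := by
  have lim : Tendsto (fun t : ℝ => (u.eval t) / t ^ d) atTop (𝓝 (u.coeff d)) := by
    rcases hd.lt_or_eq with h | h
    · rw [Polynomial.coeff_eq_zero_of_natDegree_lt h]
      have := Polynomial.div_tendsto_atTop_zero_of_degree_lt u (Polynomial.X ^ d : Polynomial ℝ)
        (by rw [Polynomial.degree_X_pow]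
            exact (Polynomial.degree_le_natDegree).trans_lt (by exact_mod_cast h))
      simpa using this
    · rcases eq_or_ne u 0 with rfl | h0
      · simp
      have := Polynomial.div_tendsto_atTop_leadingCoeff_div_of_degree_eq u (Polynomial.X ^ d)
        (by rw [Polynomial.degree_X_pow, Polynomial.degree_eq_natDegree h0, h])
      simpa [Polynomial.leadingCoeff, h] using this
  refine ge_of_tendsto lim ?_
  filter_upwards [eventually_gt_atTop 0] with t ht
  rw [le_div_iff₀ (by positivity)]
  exact hK t ht

section Stability

open MvPolynomial

/-- A real polynomial which has no zero at nonzero points all of whose coordinates are either zero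
or have positive real part. -/
def IsHurwitzStable {n : ℕ} (p : MvPolynomial (Fin n) ℝ) : Prop :=
  ∀ z : Fin n → ℂ, z ≠ 0 → (∀ i, z i = 0 ∨ 0 < (z i).re) → aeval z p ≠ 0

theorem aeval_smul_of_isHomogeneous {n d : ℕ} {p : MvPolynomial (Fin n) ℝ}
    (hp : p.IsHomogeneous d) (c : ℂ) (z : Fin n → ℂ) :
    aeval (c • z) p = c ^ d * aeval z p := by
  simp only [aeval_def, eval₂_eq', Finset.mul_sum]
  refine Finset.sum_congr rfl fun s hs => ?_
  have := hp.degree_eq_sum_deg_support hs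
  simp only [Pi.smul_apply, smul_eq_mul, mul_pow, Finset.prod_mul_distrib,
    Finset.prod_pow_eq_pow_sum]
  rw [show ∑ i, s i = d by
    rw [this]; exact (Finset.sum_subset (Finset.subset_univ _) (by simp)).symm]
  ring

/-- The univariate polynomial obtained by specialising all variables but the first. -/
noncomputable def slice {n : ℕ} (p : MvPolynomial (Fin (n + 1)) ℝ) (z : Fin n → ℂ) :
    Polynomial ℂ :=
  (finSuccEquiv ℝ n p).map (aeval z : MvPolynomial (Fin n) ℝ →ₐ[ℝ] ℂ).toRingHom

theorem coeff_slice {n : ℕ} (p : MvPolynomial (Fin (n + 1)) ℝ) (z : Fin n → ℂ) (k : ℕ) :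
    (slice p z).coeff k = aeval z ((finSuccEquiv ℝ n p).coeff k) := by
  simp [slice]

theorem eval_slice {n : ℕ} (p : MvPolynomial (Fin (n + 1)) ℝ) (z : Fin n → ℂ) (t : ℂ) :
    (slice p z).eval t = aeval (Fin.cons t z : Fin (n + 1) → ℂ) p := by
  unfold slice
  induction p using MvPolynomial.induction_on with
  | C a => simp [finSuccEquiv_apply]
  | add p q hp hq => simp only [map_add, Polynomial.map_add, Polynomial.eval_add, hp, hq]
  | mul_X p i hp =>
    simp only [map_mul, Polynomial.map_mul, Polynomial.eval_mul, hp]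
    congr 1
    refine Fin.cases ?_ (fun j => ?_) i
    · simp [finSuccEquiv_X_zero]
    · simp [finSuccEquiv_X_succ]

theorem natDegree_slice {n d : ℕ} {p : MvPolynomial (Fin (n + 1)) ℝ} (hp : p.IsHomogeneous d)
    (hs : IsHurwitzStable p) (z : Fin n → ℂ) : (slice p z).natDegree = d := by
  have big : ∀ k, d < k → (finSuccEquiv ℝ n p).coeff k = 0 := by
    intro k hk
    ext m
    rw [finSuccEquiv_coeff_coeff, coeff_zero]
    refine hp.coeff_eq_zero fun h => ?_
    have : (Finsupp.cons k m) 0 ≤ (Finsupp.cons k m).degree := Finsupp.le_degree 0 _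
    rw [h, Finsupp.cons_zero] at this
    omega
  have le : ∀ z : Fin n → ℂ, (slice p z).natDegree ≤ d := fun z =>
    Polynomial.natDegree_le_iff_coeff_eq_zero.2 fun k hk => by
      rw [coeff_slice, big k hk, map_zero]
  refine le_antisymm (le z) (Polynomial.le_natDegree_of_ne_zero ?_)
  have hom := hp.finSuccEquiv_coeff_isHomogeneous d 0 (add_zero d)
  have const : (slice p z).coeff d = (slice p 0).coeff d := by
    have h := totalDegree_eq_zero_iff_eq_C.1 (hom.totalDegree_le.antisymm (Nat.zero_le _))
    rw [coeff_slice, coeff_slice, h]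
    simp
  have low : ∀ k < d, (slice p 0).coeff k = 0 := by
    intro k hk
    have := aeval_smul_of_isHomogeneous
      (hp.finSuccEquiv_coeff_isHomogeneous k (d - k) (by omega)) 0 (0 : Fin n → ℂ)
    rw [zero_smul, zero_pow (by omega), zero_mul] at this
    rw [coeff_slice, this]
  have ne := hs (Fin.cons (1:ℂ) (0 : Fin n → ℂ)) (fun h => by simpa using congrFun h 0)
    (Fin.cases (by simp) (by simp))
  rw [← eval_slice, Polynomial.eval_eq_sum_range' (Nat.lt_succ_of_le (le 0)),
    Finset.sum_range_succ, Finset.sum_eq_zero fun k hk => by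
      rw [low k (Finset.mem_range.1 hk), zero_mul]] at ne
  rw [const]
  simpa using ne

theorem re_neg_of_isRoot_slice {n d : ℕ} {p : MvPolynomial (Fin (n + 1)) ℝ}
    (hp : p.IsHomogeneous d) (hs : IsHurwitzStable p) {z : Fin n → ℂ} (hz : z ≠ 0)
    (hz' : ∀ i, z i = 0 ∨ 0 < (z i).re) {t : ℂ} (ht : (slice p z).eval t = 0) : t.re < 0 := by
  by_contra! h
  rw [eval_slice] at ht
  have nz : ∀ t : ℂ, (Fin.cons t z : Fin (n + 1) → ℂ) ≠ 0 := fun t h =>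
    hz (funext fun i => by simpa using congrFun h i.succ)
  rcases h.lt_or_eq with h | h
  · exact hs _ (nz t) (Fin.cases (Or.inr h) hz') ht
  rcases eq_or_ne t 0 with rfl | t0
  · exact hs _ (nz 0) (Fin.cases (Or.inl rfl) hz') ht
  have τ0 : t.im ≠ 0 := fun h' => t0 (Complex.ext h.symm h')
  have ev : ∀ᶠ ε : ℝ in 𝓝[>] 0, ∀ i, z i = 0 ∨ 0 < (z i).re + ε * t.im * (z i).im := by
    refine eventually_all.2 fun i => ?_
    rcases hz' i with h0 | h0
    · exact Eventually.of_forall fun _ => Or.inl h0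
    · have c : Tendsto (fun ε : ℝ => (z i).re + ε * t.im * (z i).im) (𝓝[>] 0)
          (𝓝 ((z i).re + 0 * t.im * (z i).im)) :=
        (Continuous.tendsto (by fun_prop) 0).mono_left nhdsWithin_le_nhds
      rw [zero_mul, zero_mul, add_zero] at c
      filter_upwards [c.eventually_const_lt h0] with ε hε using Or.inr hε
  obtain ⟨ε, hε, ε0⟩ := (ev.and self_mem_nhdsWithin).exists
  have ω0 : (⟨1, -(ε * t.im)⟩ : ℂ) ≠ 0 := fun h => by simpa using congrArg Complex.re h
  have := hs ((⟨1, -(ε * t.im)⟩ : ℂ) • (Fin.cons t z : Fin (n + 1) → ℂ))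
    (smul_ne_zero ω0 (nz t)) ?_
  · rw [aeval_smul_of_isHomogeneous hp, ht, mul_zero] at this
    exact this rfl
  · refine Fin.cases ?_ fun i => ?_
    · right
      simp only [Pi.smul_apply, Fin.cons_zero, smul_eq_mul, Complex.mul_re, ← h]
      have : 0 < t.im * t.im := mul_self_pos.2 τ0
      have := mul_pos (mem_Ioi.1 ε0) this
      linarith
    · simp only [Pi.smul_apply, Fin.cons_succ, smul_eq_mul, Complex.mul_re]
      rcases hε i with h | h
      · left; rw [h, mul_zero]
      · right; linarith

theorem natDegree_and_re_neg_iterate_derivative {u : Polynomial ℂ}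
    (hu : ∀ z, u.eval z = 0 → z.re < 0) : ∀ k ≤ u.natDegree,
    (Polynomial.derivative^[k] u).natDegree = u.natDegree - k ∧ ∀ z,
      (Polynomial.derivative^[k] u).eval z = 0 → z.re < 0 := by
  intro k
  induction k with
  | zero => exact fun _ => ⟨rfl, hu⟩
  | succ k ih =>
    intro hk
    obtain ⟨vd, i⟩ := ih (by omega)
    set v := Polynomial.derivative^[k] u with hv
    have vpos : 0 < v.degree := Polynomial.natDegree_pos_iff_degree_pos.1 (by omega)
    rw [Function.iterate_succ_apply', ← hv]
    have dd : (Polynomial.derivative v).natDegree = v.natDegree - 1 :=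
      Polynomial.natDegree_eq_of_degree_eq_some (Polynomial.degree_derivative (by omega))
    refine ⟨by omega, fun z hz => ?_⟩
    have d0 : Polynomial.derivative v ≠ 0 := fun h => by
      have := Polynomial.derivative_eq_zero.1 h
      omega
    have mem : z ∈ (Polynomial.derivative v).rootSet ℂ := by
      rw [Polynomial.mem_rootSet]
      exact ⟨d0, by simpa using hz⟩
    have hull := Polynomial.rootSet_derivative_subset_convexHull_rootSet vpos mem
    have half : Convex ℝ {z : ℂ | z.re < 0} := convex_halfSpace_re_lt 0
    refine convexHull_min ?_ half hull
    intro w hw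
    rw [Polynomial.mem_rootSet] at hw
    exact i w (by simpa using hw.2)

theorem IsHurwitzStable.coeff_finSuccEquiv {n d : ℕ} {p : MvPolynomial (Fin (n + 1)) ℝ}
    (hs : IsHurwitzStable p) (hp : p.IsHomogeneous d) {c : ℕ} (hc : c ≤ d) :
    IsHurwitzStable ((finSuccEquiv ℝ n p).coeff c) := by
  intro z hz hz' h0
  rw [← coeff_slice] at h0
  have := (natDegree_and_re_neg_iterate_derivative
    (fun t => re_neg_of_isRoot_slice hp hs hz hz') c (by rwa [natDegree_slice hp hs z])).2 0 (by
      rw [← Polynomial.coeff_zero_eq_eval_zero, Polynomial.coeff_iterate_derivative, zero_add, h0,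
        smul_zero])
  simp at this

theorem root_slice_eq {n d : ℕ} {p : MvPolynomial (Fin (n + 1)) ℝ}
    (hp : p.IsHomogeneous d) (hs : IsHurwitzStable p) (hn : 0 < n) {y : Fin n → ℝ}
    (hy : ∀ i, 0 < y i) {t : ℂ} (ht : (slice p fun i => (y i : ℂ)).eval t = 0) :
    ∃ ρ : ℝ, 0 < ρ ∧ t = ((-ρ : ℝ) : ℂ) := by
  have hy' : ∀ i, (y i : ℂ) = 0 ∨ 0 < (y i : ℂ).re := fun i => Or.inr (by simpa using hy i)
  have nzy : (fun i => (y i : ℂ)) ≠ 0 := fun h => by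
    have := congrFun h ⟨0, hn⟩
    simp only [Pi.zero_apply, Complex.ofReal_eq_zero] at this
    exact (hy _).ne' this
  have tneg := re_neg_of_isRoot_slice hp hs nzy hy' ht
  rw [eval_slice] at ht
  have t0 : 0 < ‖t‖ := norm_pos_iff.2 (by rintro rfl; simp at tneg)
  have low : -‖t‖ ≤ t.re := (abs_le.1 (Complex.abs_re_le_norm t)).1
  rcases low.eq_or_lt with h | h
  · refine ⟨‖t‖, t0, Complex.ext (by simp [h]) ?_⟩
    have e := Complex.sq_norm_sub_sq_re t
    rw [← h] at e
    have : t.im ^ 2 = 0 := by linarith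
    simpa using this
  exfalso
  have := hs (((‖t‖:ℂ) + (starRingEnd ℂ) t) • (Fin.cons t (fun i => (y i : ℂ)) : Fin (n + 1) → ℂ))
    (smul_ne_zero ?_ ?_) ?_
  · rw [aeval_smul_of_isHomogeneous hp, ht, mul_zero] at this
    exact this rfl
  · intro h'
    have := congrArg Complex.re h'
    simp at this
    linarith
  · intro h
    exact nzy (funext fun i => by simpa using congrFun h i.succ)
  · refine Fin.cases ?_ fun i => ?_
    · right
      simp only [Pi.smul_apply, Fin.cons_zero, smul_eq_mul, Complex.mul_re, Complex.add_re,
        Complex.add_im, Complex.ofReal_re, Complex.ofReal_im, Complex.conj_re, Complex.conj_im]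
      have e : t.re * t.re + t.im * t.im = ‖t‖ * ‖t‖ := by
        rw [← Complex.normSq_apply, Complex.normSq_eq_norm_sq, sq]
      have := mul_pos t0 (show 0 < ‖t‖ + t.re by linarith)
      linarith
    · right
      simp only [Pi.smul_apply, Fin.cons_succ, smul_eq_mul, Complex.mul_re, Complex.add_re,
        Complex.ofReal_re, Complex.ofReal_im, Complex.conj_re, mul_zero, sub_zero]
      exact mul_pos (by linarith) (hy i)

theorem isUltraLogConcave_slice {n d : ℕ} {p : MvPolynomial (Fin (n + 1)) ℝ}
    (hp : p.IsHomogeneous d) (hs : IsHurwitzStable p) (hn : 0 < n) {y : Fin n → ℝ}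
    (hy : ∀ i, 0 < y i) {u : Polynomial ℝ} (hu : u = (finSuccEquiv ℝ n p).map (eval y))
    (pos : 0 < u.eval 1) : IsUltraLogConcave d u := by
  have cu : u.map (algebraMap ℝ ℂ) = slice p fun i => (y i : ℂ) := by
    ext k
    rw [coeff_slice, hu, Polynomial.coeff_map, Polynomial.coeff_map]
    rw [← MvPolynomial.coe_aeval_eq_eval]
    exact (MvPolynomial.aeval_algebraMap_apply ℂ y _).symm
  have deg : u.natDegree = d := by
    rw [← natDegree_slice hp hs fun i => (y i : ℂ), ← cu, Polynomial.natDegree_map]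
  have u0 : u ≠ 0 := by rintro rfl; simp at pos
  have cu0 : u.map (algebraMap ℝ ℂ) ≠ 0 := (Polynomial.map_ne_zero_iff
    (algebraMap ℝ ℂ).injective).2 u0
  have sp : u.Splits := by
    refine Polynomial.Splits.of_splits_map (algebraMap ℝ ℂ) (IsAlgClosed.splits _) fun a ha => ?_
    rw [Polynomial.mem_roots cu0, Polynomial.IsRoot, cu] at ha
    obtain ⟨ρ, -, h⟩ := root_slice_eq hp hs hn hy ha
    exact ⟨-ρ, h.symm⟩
  have neg : ∀ x ∈ u.roots, x < 0 := by
    intro x hx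
    rw [Polynomial.mem_roots u0, Polynomial.IsRoot] at hx
    have : (slice p fun i => (y i : ℂ)).eval (x:ℂ) = 0 := by
      rw [← cu]
      have := Polynomial.eval_map_algebraMap u (x:ℂ)
      rw [this, show (x:ℂ) = algebraMap ℝ ℂ x from rfl, Polynomial.aeval_algebraMap_apply]
      simp [hx]
    obtain ⟨ρ, h, e⟩ := root_slice_eq hp hs hn hy this
    have : x = -ρ := by exact_mod_cast e
    linarith
  have fac := sp.eq_prod_roots
  have card := sp.natDegree_eq_card_roots
  have lead : 0 < u.leadingCoeff := by
    rw [fac, Polynomial.eval_mul, Polynomial.eval_C, Polynomial.eval_multiset_prod] at pos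
    refine pos_of_mul_pos_left pos (Multiset.prod_nonneg ?_)
    intro a ha
    simp only [Multiset.mem_map] at ha
    obtain ⟨v, ⟨x, hx, rfl⟩, rfl⟩ := ha
    have := neg x hx
    simp only [Polynomial.eval_sub, Polynomial.eval_X, Polynomial.eval_C]
    linarith
  have := isUltraLogConcave_prod lead u.roots neg
  rwa [← fac, ← card, deg] at this

/-- Gurvits' capacity bound for the coefficients of a stable homogeneous polynomial. -/
theorem IsHurwitzStable.le_coeff : ∀ (n : ℕ) (p : MvPolynomial (Fin n) ℝ) (c : Fin n →₀ ℕ) (d : ℕ),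
    IsHurwitzStable p → p.IsHomogeneous d → (∀ j, 0 < c j) → ∑ j, c j = d →
    ∀ K : ℝ, 0 < K → (∀ y : Fin n → ℝ, (∀ j, 0 < y j) → K * ∏ j, y j ^ c j ≤ eval y p) →
    K * (d.factorial / (d:ℝ) ^ d * ∏ j, (c j:ℝ) ^ c j / (c j).factorial) ≤ p.coeff c
  | 0, p, c, d, _, _, _, hd, K, _, hK => by
    have := hK 0 (fun j => j.elim0)
    have c0 : c = 0 := Subsingleton.elim _ _
    subst hd
    rw [eq_C_of_isEmpty p] at this ⊢
    simpa [c0] using this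
  | n + 1, p, c, d, hs, hp, hc, hd, K, K0, hK => by
    have hd' : c 0 + ∑ j, Finsupp.tail c j = d := by
      rw [← hd, Fin.sum_univ_succ]; rfl
    have le : c 0 ≤ d := by omega
    have ih := IsHurwitzStable.le_coeff n ((finSuccEquiv ℝ n p).coeff (c 0)) (Finsupp.tail c)
      (d - c 0) (hs.coeff_finSuccEquiv hp le)
      (hp.finSuccEquiv_coeff_isHomogeneous (c 0) (d - c 0) (by omega))
      (fun j => hc j.succ) (by omega)
      (K * (d.choose (c 0) * (c 0:ℝ) ^ c 0 * ((d - c 0 : ℕ):ℝ) ^ (d - c 0) / (d:ℝ) ^ d))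
    have c0 := hc 0
    have cf : ((d - c 0 : ℕ):ℝ) ^ (d - c 0) ≠ 0 := by
      rcases Nat.eq_zero_or_pos (d - c 0) with h | h
      · rw [h]; simp
      · positivity
    have cf' : 0 < ((d - c 0 : ℕ):ℝ) ^ (d - c 0) := lt_of_le_of_ne (by positivity) cf.symm
    have dp : 0 < d := by omega
    have ch : (0:ℝ) < d.choose (c 0) := by exact_mod_cast Nat.choose_pos le
    have c0' : (0:ℝ) < c 0 := by exact_mod_cast c0
    have dp' : (0:ℝ) < d := by exact_mod_cast dp
    specialize ih (by positivity) ?_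
    · intro y hy
      rw [← coeff_eval_eq_eval_coeff]
      obtain ⟨u, hu⟩ : ∃ u, u = (finSuccEquiv ℝ n p).map (eval y) := ⟨_, rfl⟩
      rw [← hu]
      have yp : 0 < ∏ j, y j ^ Finsupp.tail c j := Finset.prod_pos fun j _ => pow_pos (hy j) _
      have bound : ∀ t : ℝ, 0 < t → K * (∏ j, y j ^ Finsupp.tail c j) * t ^ c 0 ≤ u.eval t := by
        intro t ht
        rw [hu, ← eval_eq_eval_mv_eval']
        refine le_trans (le_of_eq ?_) (hK (Fin.cons t y : Fin (n + 1) → ℝ) (Fin.cases ht hy))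
        rw [Fin.prod_univ_succ]
        simp only [Fin.cons_zero, Fin.cons_succ, Finsupp.tail_apply]
        ring
      rcases le.eq_or_lt with h | h
      · rw [h] at bound ⊢
        have deg : u.natDegree ≤ d := by
          have := natDegree_slice hp hs fun i => (y i : ℂ)
          refine Polynomial.natDegree_le_iff_coeff_eq_zero.2 fun k hk => ?_
          have := Polynomial.coeff_eq_zero_of_natDegree_lt (this.trans_lt hk)
          rw [coeff_slice] at this
          rw [hu, Polynomial.coeff_map]
          have e := MvPolynomial.aeval_algebraMap_apply ℂ y ((finSuccEquiv ℝ n p).coeff k)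
          rw [show (aeval fun i => (y i : ℂ)) ((finSuccEquiv ℝ n p).coeff k) = _ from e] at this
          rw [← MvPolynomial.coe_aeval_eq_eval]
          exact (algebraMap ℝ ℂ).injective (by rw [map_zero]; exact this)
        have := le_coeff_of_forall_le_eval deg bound
        refine le_trans (le_of_eq ?_) this
        simp only [Nat.choose_self, Nat.sub_self, pow_zero]
        field_simp
        simp
      · have hn : 0 < n := by
          rcases Nat.eq_zero_or_pos n with rfl | h'
          · simp at hd'; omega
          · exact h'
        have ulc := isUltraLogConcave_slice hp hs hn hy hu (by
          refine lt_of_lt_of_le ?_ (bound 1 one_pos)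
          positivity)
        have := ulc.le_coeff c0 h bound
        linarith
    · rw [finSuccEquiv_coeff_coeff, Finsupp.cons_tail] at ih
      refine le_trans (le_of_eq ?_) ih
      rw [Fin.prod_univ_succ, Nat.cast_choose ℝ le]
      simp only [Finsupp.tail_apply]
      have f1 : ((d - c 0).factorial : ℝ) ≠ 0 := by positivity
      have f2 : ((c 0).factorial : ℝ) ≠ 0 := by positivity
      generalize ((d - c 0 : ℕ):ℝ) ^ (d - c 0) = A at *
      generalize ((d - c 0).factorial : ℝ) = B at *
      field_simp

end Stability

section Tables

variable {m n : ℕ}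

/-- The finite set of contingency tables with given margins. -/
def tables (R : Fin m → ℕ) (C : Fin n → ℕ) : Finset (Fin m → Fin n → ℕ) :=
  (Fintype.piFinset fun i => Finset.piAntidiag Finset.univ (R i)).filter
    fun D => ∀ j, ∑ i, D i j = C j

theorem mem_tables {R : Fin m → ℕ} {C : Fin n → ℕ} {D : Fin m → Fin n → ℕ} :
    D ∈ tables R C ↔ (∀ i, ∑ j, D i j = R i) ∧ (∀ j, ∑ i, D i j = C j) := by
  simp [tables, Finset.mem_piAntidiag]

theorem tableWeight_eq_sum (R : Fin m → ℕ) (C : Fin n → ℕ) (W : Fin m → Fin n → ℝ) :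
    tableWeight R C W = ∑ D ∈ tables R C, ∏ i, ∏ j, W i j ^ D i j := by
  unfold tableWeight
  rw [← Finset.tsum_subtype (tables R C) fun D => ∏ i, ∏ j, W i j ^ D i j]
  exact ((Equiv.subtypeEquivRight fun D => mem_tables).symm.tsum_eq
    fun D : {D // D ∈ tables R C} => ∏ i, ∏ j, W i j ^ D.1 i j)

theorem tableWeight_transpose (R : Fin m → ℕ) (C : Fin n → ℕ) (W : Fin m → Fin n → ℝ) :
    tableWeight C R (fun j i => W i j) = tableWeight R C W := by
  rw [tableWeight_eq_sum, tableWeight_eq_sum]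
  refine Finset.sum_nbij' (fun D i j => D j i) (fun D j i => D i j) ?_ ?_ ?_ ?_ ?_
  · intro D hD
    rw [mem_tables] at hD ⊢
    exact hD.symm
  · intro D hD
    rw [mem_tables] at hD ⊢
    exact hD.symm
  · intro D _; rfl
  · intro D _; rfl
  · intro D _
    exact Finset.prod_comm

theorem tableWeight_nonneg (R : Fin m → ℕ) (C : Fin n → ℕ) {W : Fin m → Fin n → ℝ}
    (hW : ∀ i j, 0 ≤ W i j) : 0 ≤ tableWeight R C W := by
  rw [tableWeight_eq_sum]
  exact Finset.sum_nonneg fun D _ => Finset.prod_nonneg fun i _ => Finset.prod_nonneg fun j _ =>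
    pow_nonneg (hW i j) _

theorem continuous_tableWeight (R : Fin m → ℕ) (C : Fin n → ℕ) :
    Continuous fun W : Fin m → Fin n → ℝ => tableWeight R C W := by
  simp only [tableWeight_eq_sum]
  fun_prop

open MvPolynomial

/-- The product of powers of linear forms whose coefficients count weighted tables. -/
noncomputable def linearFormProd (A : Fin m → Fin n → ℝ) (r : Fin m → ℕ) :
    MvPolynomial (Fin n) ℝ :=
  ∏ i, (∑ j, C (A i j) * X j) ^ r i

theorem isHomogeneous_linearFormProd (A : Fin m → Fin n → ℝ) (r : Fin m → ℕ) :
    (linearFormProd A r).IsHomogeneous (∑ i, r i) := by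
  refine IsHomogeneous.prod _ _ _ fun i _ => ?_
  have h : (∑ j, C (A i j) * X j : MvPolynomial (Fin n) ℝ).IsHomogeneous 1 :=
    IsHomogeneous.sum _ _ _ fun j _ => isHomogeneous_C_mul_X _ _
  simpa using h.pow (r i)

theorem isHurwitzStable_linearFormProd {A : Fin m → Fin n → ℝ} (hA : ∀ i j, 0 < A i j)
    (r : Fin m → ℕ) : IsHurwitzStable (linearFormProd A r) := by
  intro z hz hz'
  simp only [linearFormProd, map_prod, map_pow, map_sum, map_mul, aeval_C, aeval_X]
  refine Finset.prod_ne_zero_iff.2 fun i _ => pow_ne_zero _ fun h => ?_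
  obtain ⟨k, hk⟩ := Function.ne_iff.1 hz
  have nonneg : ∀ j, 0 ≤ (z j).re := fun j => (hz' j).elim (fun h => by simp [h]) le_of_lt
  have : (∑ j, (algebraMap ℝ ℂ (A i j)) * z j).re = ∑ j, A i j * (z j).re := by
    simp
  rw [h] at this
  have pos : 0 < ∑ j, A i j * (z j).re :=
    Finset.sum_pos' (fun j _ => mul_nonneg (hA i j).le (nonneg j))
      ⟨k, Finset.mem_univ k, mul_pos (hA i k) ((hz' k).resolve_left hk)⟩
  simp at this
  linarith

theorem eval_linearFormProd (A : Fin m → Fin n → ℝ) (r : Fin m → ℕ) (y : Fin n → ℝ) :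
    eval y (linearFormProd A r) = ∏ i, (∑ j, A i j * y j) ^ r i := by
  simp [linearFormProd]

theorem coeff_linearFormProd (A : Fin m → Fin n → ℝ) (r : Fin m → ℕ) (c : Fin n →₀ ℕ) :
    coeff c (linearFormProd A r) = ∑ D ∈ tables r c,
      ∏ i, (Nat.multinomial Finset.univ (D i) : ℝ) * ∏ j, A i j ^ D i j := by
  unfold linearFormProd tables
  simp only [Finset.sum_pow_eq_sum_piAntidiag]
  rw [Finset.prod_univ_sum, coeff_sum, Finset.sum_filter]
  refine Finset.sum_congr rfl fun D _ => ?_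
  have e : (∏ i, ((Nat.multinomial Finset.univ (D i) : ℕ) : MvPolynomial (Fin n) ℝ) *
      ∏ j, (C (A i j) * X j) ^ D i j) =
      C (∏ i, (Nat.multinomial Finset.univ (D i) : ℝ) * ∏ j, A i j ^ D i j) *
        ∏ j, X j ^ (∑ i, D i j) := by
    simp only [map_prod, map_mul, map_pow, mul_pow, Finset.prod_mul_distrib, map_natCast,
      ← Finset.prod_pow_eq_pow_sum]
    rw [mul_assoc]
    congr 2
    exact Finset.prod_comm
  rw [e, coeff_C_mul, coeff_prod_X_pow]
  have iff : c = Finsupp.indicator Finset.univ (fun j _ => ∑ i, D i j) ↔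
      ∀ j, ∑ i, D i j = c j := by
    rw [Finsupp.ext_iff]
    simp [eq_comm]
  simp only [iff]
  split_ifs <;> simp

theorem coeff_linearFormProd_nonneg {A : Fin m → Fin n → ℝ} (hA : ∀ i j, 0 ≤ A i j)
    (r : Fin m → ℕ) (c : Fin n →₀ ℕ) : 0 ≤ coeff c (linearFormProd A r) := by
  rw [coeff_linearFormProd]
  exact Finset.sum_nonneg fun D _ => Finset.prod_nonneg fun i _ => mul_nonneg (by positivity)
    (Finset.prod_nonneg fun j _ => pow_nonneg (hA i j) _)

theorem coeff_mul_le_eval {A : Fin m → Fin n → ℝ} (hA : ∀ i j, 0 ≤ A i j)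
    (r : Fin m → ℕ) (c : Fin n →₀ ℕ) {y : Fin n → ℝ} (hy : ∀ j, 0 < y j) :
    coeff c (linearFormProd A r) * ∏ j, y j ^ c j ≤ eval y (linearFormProd A r) := by
  have nn : ∀ s : Fin n →₀ ℕ, 0 ≤ coeff s (linearFormProd A r) * ∏ j, y j ^ s j := fun s =>
    mul_nonneg (coeff_linearFormProd_nonneg hA r s)
      (Finset.prod_nonneg fun j _ => pow_nonneg (hy j).le _)
  rw [eval_eq']
  by_cases h : c ∈ (linearFormProd A r).support
  · exact Finset.single_le_sum (f := fun s : Fin n →₀ ℕ =>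
      coeff s (linearFormProd A r) * ∏ j, y j ^ s j) (fun s _ => nn s) h
  · rw [notMem_support_iff.1 h, zero_mul]
    exact Finset.sum_nonneg fun s _ => nn s

theorem integrable_prod_pow_stdExpMat (D : Fin m → Fin n → ℕ) :
    Integrable (fun G : Fin m → Fin n → ℝ => ∏ i, ∏ j, G i j ^ D i j) (stdExpMat m n) := by
  have row : ∀ i, Integrable (fun g : Fin n → ℝ => ∏ j, g j ^ D i j) (stdExpVec n) := fun i =>
    Integrable.fintype_prod (f := fun j g => g ^ D i j) fun j => integrable_pow_stdExp _
  exact Integrable.fintype_prod (f := fun i (g : Fin n → ℝ) => ∏ j, g j ^ D i j) row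

theorem integral_prod_pow_stdExpMat (D : Fin m → Fin n → ℕ) :
    ∫ G : Fin m → Fin n → ℝ, ∏ i, ∏ j, G i j ^ D i j ∂stdExpMat m n =
      ∏ i, ∏ j, ((D i j).factorial : ℝ) := by
  unfold stdExpMat
  rw [integral_fintype_prod_eq_prod fun i (g : Fin n → ℝ) => ∏ j, g j ^ D i j]
  refine Finset.prod_congr rfl fun i _ => ?_
  unfold stdExpVec
  rw [integral_fintype_prod_eq_prod fun j (g : ℝ) => g ^ D i j]
  exact Finset.prod_congr rfl fun j _ => integral_pow_stdExp _

theorem integrable_coeff_linearFormProd (W : Fin m → Fin n → ℝ) (r : Fin m → ℕ)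
    (c : Fin n →₀ ℕ) : Integrable (fun G : Fin m → Fin n → ℝ =>
      coeff c (linearFormProd (fun i j => G i j * W i j) r)) (stdExpMat m n) := by
  simp only [coeff_linearFormProd, mul_pow, Finset.prod_mul_distrib]
  exact integrable_finsetSum _ fun D _ =>
    ((integrable_prod_pow_stdExpMat D).mul_const _).const_mul _

theorem integral_coeff_linearFormProd (W : Fin m → Fin n → ℝ) (r : Fin m → ℕ)
    (c : Fin n →₀ ℕ) : ∫ G : Fin m → Fin n → ℝ,
      coeff c (linearFormProd (fun i j => G i j * W i j) r) ∂stdExpMat m n =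
      (∏ i, ((r i).factorial : ℝ)) * tableWeight r c W := by
  simp only [coeff_linearFormProd, mul_pow, Finset.prod_mul_distrib]
  rw [integral_finsetSum _ fun D _ =>
    ((integrable_prod_pow_stdExpMat D).mul_const _).const_mul _, tableWeight_eq_sum,
    Finset.mul_sum]
  refine Finset.sum_congr rfl fun D hD => ?_
  rw [MeasureTheory.integral_const_mul, MeasureTheory.integral_mul_const,
    integral_prod_pow_stdExpMat, ← mul_assoc, ← Finset.prod_mul_distrib]
  congr 1
  refine Finset.prod_congr rfl fun i _ => ?_
  rw [← (mem_tables.1 hD).1 i, ← Nat.multinomial_spec]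
  push_cast
  ring

end Tables

section CapacityBounds

variable {m n : ℕ} {W : Fin m → Fin n → ℝ}

/-- A pair of integral margins, viewed as a pair of real vectors. -/
def castMargins (R : Fin m → ℕ) (C : Fin n → ℕ) : (Fin m → ℝ) × (Fin n → ℝ) :=
  (fun i => (R i : ℝ), fun j => (C j : ℝ))

theorem castMargins_mem {R : Fin m → ℕ} {C : Fin n → ℕ} (hR : ∀ i, 0 < R i) (hC : ∀ j, 0 < C j)
    (h : ∑ i, R i = ∑ j, C j) : castMargins R C ∈ margins m n :=
  ⟨fun i => Nat.cast_pos.2 (hR i), fun j => Nat.cast_pos.2 (hC j), by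
    simp only [castMargins]; exact_mod_cast h⟩

theorem exp_capObjective_mul (hn : 0 < n) (hW : ∀ i j, 0 < W i j) {G : Fin m → Fin n → ℝ}
    (hG : G ∈ orthants m n) (R : Fin m → ℕ) (C : Fin n → ℕ) (x : Fin n → ℝ) :
    Real.exp (capObjective W (castMargins R C) G x) * ∏ j, Real.exp (x j) ^ C j =
      MvPolynomial.eval (fun j => Real.exp (x j))
        (linearFormProd (fun i j => G i j * W i j) R) := by
  rw [eval_linearFormProd]
  unfold capObjective castMargins
  rw [sub_eq_add_neg, Real.exp_add, Real.exp_neg, Real.exp_sum, Real.exp_sum, mul_assoc]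
  have e : ∏ j, Real.exp (x j) ^ C j = ∏ j, Real.exp ((C j : ℝ) * x j) :=
    Finset.prod_congr rfl fun j _ => by rw [Real.exp_nat_mul]
  rw [e, inv_mul_cancel₀ (Finset.prod_pos fun j _ => Real.exp_pos _).ne', mul_one]
  exact Finset.prod_congr rfl fun i _ => by
    rw [Real.exp_nat_mul, Real.exp_log (linearForm_pos hn hW hG i x)]

theorem coeff_le_exp_logCap (hn : 0 < n) (hW : ∀ i j, 0 < W i j) {G : Fin m → Fin n → ℝ}
    (hG : G ∈ orthants m n) (R : Fin m → ℕ) (C : Fin n →₀ ℕ) :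
    MvPolynomial.coeff C (linearFormProd (fun i j => G i j * W i j) R) ≤
      Real.exp (logCap W (castMargins R C) G) := by
  set a := MvPolynomial.coeff C (linearFormProd (fun i j => G i j * W i j) R) with ha
  rcases le_or_gt a 0 with h | h
  · exact h.trans (Real.exp_pos _).le
  rw [← Real.log_le_iff_le_exp h]
  refine le_ciInf fun x => ?_
  rw [Real.log_le_iff_le_exp h]
  have := coeff_mul_le_eval (fun i j => (mul_pos (hG i j) (hW i j)).le) R C
    (y := fun j => Real.exp (x j)) fun j => Real.exp_pos _
  rw [← exp_capObjective_mul hn hW hG] at this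
  exact le_of_mul_le_mul_right this (Finset.prod_pos fun j _ => pow_pos (Real.exp_pos _) _)

theorem exp_logCap_le_coeff (hn : 0 < n) (hW : ∀ i j, 0 < W i j) {G : Fin m → Fin n → ℝ}
    (hG : G ∈ orthants m n) {R : Fin m → ℕ} {C : Fin n →₀ ℕ} (hR : ∀ i, 0 < R i)
    (hC : ∀ j, 0 < C j) {N : ℕ} (hRN : ∑ i, R i = N) (hCN : ∑ j, C j = N) :
    Real.exp (logCap W (castMargins R C) G) *
      (N.factorial / (N:ℝ) ^ N * ∏ j, (C j:ℝ) ^ C j / (C j).factorial) ≤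
      MvPolynomial.coeff C (linearFormProd (fun i j => G i j * W i j) R) := by
  refine IsHurwitzStable.le_coeff n _ C N
    (isHurwitzStable_linearFormProd (fun i j => mul_pos (hG i j) (hW i j)) R)
    (hRN ▸ isHomogeneous_linearFormProd _ R) hC hCN _ (Real.exp_pos _) fun y hy => ?_
  have e : (fun j => Real.exp (Real.log (y j))) = y := funext fun j => Real.exp_log (hy j)
  have h := exp_capObjective_mul hn hW hG R C fun j => Real.log (y j)
  rw [e] at h
  rw [← h]
  have e' : ∀ j, Real.exp (Real.log (y j)) = y j := fun j => Real.exp_log (hy j)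
  simp only [e']
  refine mul_le_mul_of_nonneg_right (Real.exp_le_exp.2 ?_)
    (Finset.prod_nonneg fun j _ => pow_nonneg (hy j).le _)
  exact ciInf_le (bddBelow_capObjective hn hW
    (castMargins_mem hR hC (hRN.trans hCN.symm)) hG) _

/-- The normalised average capacity. -/
noncomputable def capIntegral (W : Fin m → Fin n → ℝ) (R : Fin m → ℕ) (C : Fin n → ℕ) : ℝ :=
  (∫ G, Real.exp (logCap W (castMargins R C) G) ∂stdExpMat m n) / ∏ i, ((R i).factorial : ℝ)

theorem tableWeight_le_capIntegral (hn : 0 < n) (hW : ∀ i j, 0 < W i j) {R : Fin m → ℕ}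
    {C : Fin n → ℕ} (hR : ∀ i, 0 < R i) (hC : ∀ j, 0 < C j) (h : ∑ i, R i = ∑ j, C j) :
    tableWeight R C W ≤ capIntegral W R C := by
  obtain ⟨C, rfl⟩ : ∃ c : Fin n →₀ ℕ, ⇑c = C := ⟨Finsupp.equivFunOnFinite.symm C, rfl⟩
  unfold capIntegral
  rw [le_div_iff₀' (Finset.prod_pos fun i _ => by positivity), ← integral_coeff_linearFormProd]
  refine integral_mono_ae (integrable_coeff_linearFormProd W R C)
    ((concaveOn_log_integral_cap hn hW).1 _ (castMargins_mem hR hC h)) ?_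
  filter_upwards [ae_stdExpMat m n] with G hG using coeff_le_exp_logCap hn hW hG R C

theorem capIntegral_le_tableWeight (hn : 0 < n) (hW : ∀ i j, 0 < W i j) {R : Fin m → ℕ}
    {C : Fin n → ℕ} (hR : ∀ i, 0 < R i) (hC : ∀ j, 0 < C j) {N : ℕ} (hRN : ∑ i, R i = N)
    (hCN : ∑ j, C j = N) :
    capIntegral W R C * (N.factorial / (N:ℝ) ^ N * ∏ j, (C j:ℝ) ^ C j / (C j).factorial) ≤
      tableWeight R C W := by
  obtain ⟨C, rfl⟩ : ∃ c : Fin n →₀ ℕ, ⇑c = C := ⟨Finsupp.equivFunOnFinite.symm C, rfl⟩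
  unfold capIntegral
  have fp : (0:ℝ) < ∏ i, ((R i).factorial : ℝ) := Finset.prod_pos fun i _ => by positivity
  rw [div_mul_eq_mul_div, div_le_iff₀' fp, ← integral_coeff_linearFormProd,
    ← MeasureTheory.integral_mul_const]
  refine integral_mono_ae (((concaveOn_log_integral_cap hn hW).1 _
    (castMargins_mem hR hC (hRN.trans hCN.symm))).mul_const _)
    (integrable_coeff_linearFormProd W R C) ?_
  filter_upwards [ae_stdExpMat m n] with G hG using exp_logCap_le_coeff hn hW hG hR hC hRN hCN

theorem integral_exp_logCap_pos (hn : 0 < n) (hW : ∀ i j, 0 < W i j) {R : Fin m → ℕ}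
    {C : Fin n → ℕ} (hR : ∀ i, 0 < R i) (hC : ∀ j, 0 < C j) (h : ∑ i, R i = ∑ j, C j) :
    0 < ∫ G, Real.exp (logCap W (castMargins R C) G) ∂stdExpMat m n :=
  integral_exp_pos ((concaveOn_log_integral_cap hn hW).1 _ (castMargins_mem hR hC h))

theorem capIntegral_pos (hn : 0 < n) (hW : ∀ i j, 0 < W i j) {R : Fin m → ℕ}
    {C : Fin n → ℕ} (hR : ∀ i, 0 < R i) (hC : ∀ j, 0 < C j) (h : ∑ i, R i = ∑ j, C j) :
    0 < capIntegral W R C :=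
  div_pos (integral_exp_logCap_pos hn hW hR hC h) (Finset.prod_pos fun i _ => by positivity)

theorem log_capIntegral (hn : 0 < n) (hW : ∀ i j, 0 < W i j) {R : Fin m → ℕ}
    {C : Fin n → ℕ} (hR : ∀ i, 0 < R i) (hC : ∀ j, 0 < C j) (h : ∑ i, R i = ∑ j, C j) :
    Real.log (capIntegral W R C) =
      Real.log (∫ G, Real.exp (logCap W (castMargins R C) G) ∂stdExpMat m n) -
        ∑ i, Real.log (Real.Gamma ((castMargins R C).1 i + 1)) := by
  unfold capIntegral
  rw [Real.log_div (integral_exp_logCap_pos hn hW hR hC h).ne'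
    (Finset.prod_pos fun i _ => by positivity).ne', Real.log_prod fun i _ => by positivity]
  simp only [castMargins, Real.Gamma_nat_eq_factorial]

theorem prod_capIntegral_rpow_le (hn : 0 < n) (hW : ∀ i j, 0 < W i j) {p : ℕ}
    {Rk : Fin p → Fin m → ℕ} {Ck : Fin p → Fin n → ℕ}
    (hRk : ∀ k i, 0 < Rk k i) (hCk : ∀ k j, 0 < Ck k j)
    (hk : ∀ k, ∑ i, Rk k i = ∑ j, Ck k j) {α : Fin p → ℝ} (hα : ∀ k, 0 ≤ α k)
    (hα1 : ∑ k, α k = 1) {R : Fin m → ℕ} {C : Fin n → ℕ}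
    (hR : ∀ i, 0 < R i) (hC : ∀ j, 0 < C j) (h : ∑ i, R i = ∑ j, C j)
    (hRα : ∀ i, (R i : ℝ) = ∑ k, α k * Rk k i) (hCα : ∀ j, (C j : ℝ) = ∑ k, α k * Ck k j) :
    ∏ k, capIntegral W (Rk k) (Ck k) ^ α k ≤ capIntegral W R C := by
  have pos : ∀ k, 0 < capIntegral W (Rk k) (Ck k) := fun k =>
    capIntegral_pos hn hW (hRk k) (hCk k) (hk k)
  rw [← Real.log_le_log_iff (Finset.prod_pos fun k _ => Real.rpow_pos_of_pos (pos k) _)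
    (capIntegral_pos hn hW hR hC h), Real.log_prod fun k _ => (Real.rpow_pos_of_pos (pos k) _).ne']
  have jensen := (concaveOn_log_integral_cap hn hW).2.le_map_sum (t := Finset.univ) (w := α)
    (p := fun k => castMargins (Rk k) (Ck k)) (fun k _ => hα k) hα1
    (fun k _ => castMargins_mem (hRk k) (hCk k) (hk k))
  have e : ∑ k, α k • castMargins (Rk k) (Ck k) = castMargins R C := by
    refine Prod.ext (funext fun i => ?_) (funext fun j => ?_)
    · simp [castMargins, Prod.fst_sum, hRα]
    · simp [castMargins, Prod.snd_sum, hCα]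
  rw [e, ← log_capIntegral hn hW hR hC h] at jensen
  refine le_trans (le_of_eq (Finset.sum_congr rfl fun k _ => ?_)) jensen
  rw [← log_capIntegral hn hW (hRk k) (hCk k) (hk k), Real.log_rpow (pos k), smul_eq_mul]

end CapacityBounds

theorem convexOn_mul_log_sub_log_Gamma :
    ConvexOn ℝ (Ioi 0) fun x : ℝ => x * Real.log x - Real.log (Real.Gamma (x + 1)) := by
  refine ⟨convex_Ioi 0, fun x hx y hy a b ha hb hab => ?_⟩
  have step : ∀ n : ℕ, ConvexOn ℝ (Ioi 0) fun x : ℝ =>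
      (x + n) * Real.log (x + n) +
        ∑ k ∈ Finset.range n, ((x + k) * Real.log (x + k) - (x + k) * Real.log (x + k + 1)) := by
    intro n
    refine ConvexOn.add ?_ ?_
    · refine ⟨convex_Ioi 0, fun x hx y hy a b ha hb hab => ?_⟩
      have := Real.convexOn_mul_log.2 (x := x + n) (y := y + n)
        (by have := mem_Ioi.1 hx; exact mem_Ici.2 (by positivity))
        (by have := mem_Ioi.1 hy; exact mem_Ici.2 (by positivity)) ha hb hab
      simp only [smul_eq_mul] at this ⊢
      convert this using 2
      · linear_combination (-(n:ℝ)) * hab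
      · congr 1; linear_combination (-(n:ℝ)) * hab
    · refine ⟨convex_Ioi 0, fun x hx y hy a b ha hb hab => ?_⟩
      simp only [smul_eq_mul]
      rw [Finset.mul_sum, Finset.mul_sum, ← Finset.sum_add_distrib]
      refine Finset.sum_le_sum fun k _ => ?_
      have hx := mem_Ioi.1 hx
      have hy := mem_Ioi.1 hy
      have := mul_log_sub_perspective_le (r₀ := x + k) (r₁ := y + k) (A₀ := x + k + 1)
        (A₁ := y + k + 1) (by positivity) (by positivity) (by positivity) (by positivity) ha hb hab
      have e1 : a * (x + k) + b * (y + k) = a * x + b * y + k := by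
        linear_combination (k:ℝ) * hab
      have e2 : a * (x + k + 1) + b * (y + k + 1) = a * x + b * y + k + 1 := by
        linear_combination ((k:ℝ) + 1) * hab
      rw [e1, e2] at this
      linarith
  have closed : ∀ x : ℝ, 0 < x → ∀ n : ℕ, (x + n) * Real.log (x + n) +
        ∑ k ∈ Finset.range n, ((x + k) * Real.log (x + k) - (x + k) * Real.log (x + k + 1)) =
      x * Real.log x + ∑ k ∈ Finset.range n, Real.log (x + 1 + k) := by
    intro x hx n
    induction n with
    | zero => simp
    | succ n ih =>
      rw [Finset.sum_range_succ, Finset.sum_range_succ]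
      push_cast
      rw [show x + 1 + n = x + n + 1 by ring, show x + (n + 1) = x + n + 1 by ring]
      linarith
  have lim : ∀ x : ℝ, 0 < x → Tendsto (fun n : ℕ => (x + n) * Real.log (x + n) +
        (∑ k ∈ Finset.range n, ((x + k) * Real.log (x + k) - (x + k) * Real.log (x + k + 1))) -
        x * Real.log n - Real.log n.factorial) atTop
      (𝓝 (x * Real.log x - Real.log (Real.Gamma (x + 1)))) := by
    intro x hx
    have t := Real.BohrMollerup.tendsto_log_gamma hx
    have g : Real.log (Real.Gamma (x + 1)) = Real.log x + Real.log (Real.Gamma x) := by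
      rw [Real.Gamma_add_one hx.ne', Real.log_mul hx.ne' (Real.Gamma_pos_of_pos hx).ne']
    rw [g]
    have := (tendsto_const_nhds (x := x * Real.log x - Real.log x)).sub t
    rw [show x * Real.log x - (Real.log x + Real.log (Real.Gamma x)) =
      x * Real.log x - Real.log x - Real.log (Real.Gamma x) by ring]
    refine this.congr fun n => ?_
    rw [closed x hx, Real.BohrMollerup.logGammaSeq, Finset.sum_range_succ']
    have : ∑ k ∈ Finset.range n, Real.log (x + ((k + 1 : ℕ):ℝ)) =
        ∑ k ∈ Finset.range n, Real.log (x + 1 + k) :=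
      Finset.sum_congr rfl fun k _ => by push_cast; ring_nf
    rw [this]
    push_cast
    rw [add_zero]
    ring
  have hx := mem_Ioi.1 hx
  have hy := mem_Ioi.1 hy
  have hz : 0 < a * x + b * y := by
    have := convex_Ioi (0:ℝ) (mem_Ioi.2 hx) (mem_Ioi.2 hy) ha hb hab
    simpa using this
  refine le_of_tendsto_of_tendsto' (lim _ hz) (((lim x hx).const_mul a).add
    ((lim y hy).const_mul b)) fun n => ?_
  have := (step n).2 (mem_Ioi.2 hx) (mem_Ioi.2 hy) ha hb hab
  simp only [smul_eq_mul] at this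
  have e : a * Real.log n.factorial + b * Real.log n.factorial = Real.log n.factorial := by
    rw [← add_mul, hab, one_mul]
  simp only [smul_eq_mul]
  linarith

theorem pow_div_Gamma_pow_le_prod {n N : ℕ} (hn : 0 < n) {C : Fin n → ℕ} (hC : ∀ j, 0 < C j)
    (hCN : ∑ j, C j = N) {s : ℝ} (hs : s = N / n) :
    s ^ N ≤ Real.Gamma (s + 1) ^ n * ∏ j, (C j:ℝ) ^ C j / (C j).factorial := by
  have : Nonempty (Fin n) := ⟨⟨0, hn⟩⟩
  have np : (0:ℝ) < n := by exact_mod_cast hn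
  have Np : (0:ℝ) < N := by
    rw [← hCN]
    exact_mod_cast Finset.sum_pos (fun j _ => hC j) Finset.univ_nonempty
  have sp : 0 < s := by rw [hs]; positivity
  have gp : 0 < Real.Gamma (s + 1) := Real.Gamma_pos_of_pos (by linarith)
  have cp : ∀ j, (0:ℝ) < (C j:ℝ) ^ C j := fun j => pow_pos (Nat.cast_pos.2 (hC j)) _
  have qp : ∀ j, (0:ℝ) < (C j:ℝ) ^ C j / (C j).factorial := fun j =>
    div_pos (cp j) (by positivity)
  have jensen := convexOn_mul_log_sub_log_Gamma.map_sum_le (t := Finset.univ)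
    (w := fun _ : Fin n => 1 / (n:ℝ)) (p := fun j => (C j:ℝ)) (fun _ _ => by positivity)
    (by simp [np.ne']) (fun j _ => mem_Ioi.2 (Nat.cast_pos.2 (hC j)))
  have e : ∑ j, (1 / (n:ℝ)) • (C j:ℝ) = s := by
    simp only [smul_eq_mul]
    rw [← Finset.mul_sum, hs, ← hCN]
    push_cast
    ring
  rw [e, ← Finset.smul_sum, smul_eq_mul] at jensen
  have jensen' := mul_le_mul_of_nonneg_left jensen np.le
  have e2 : ∀ j, (C j:ℝ) * Real.log (C j) - Real.log (Real.Gamma ((C j:ℝ) + 1)) =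
      Real.log ((C j:ℝ) ^ C j / (C j).factorial) := fun j => by
    rw [Real.log_div (cp j).ne' (by positivity), Real.log_pow, Real.Gamma_nat_eq_factorial]
  simp only [e2] at jensen'
  rw [← mul_assoc, mul_one_div_cancel np.ne', one_mul, ← Real.log_prod fun j _ => (qp j).ne']
    at jensen'
  rw [← Real.log_le_log_iff (pow_pos sp _) (mul_pos (pow_pos gp _)
    (Finset.prod_pos fun j _ => qp j)), Real.log_mul (pow_pos gp _).ne'
    (Finset.prod_pos fun j _ => qp j).ne', Real.log_pow, Real.log_pow]
  have e3 : (N:ℝ) = n * s := by rw [hs]; field_simp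
  rw [e3]
  linarith

theorem prod_tableWeight_rpow_le_of_pos {m n p N : ℕ} (hn : 0 < n)
    {W : Fin m → Fin n → ℝ} (hW : ∀ i j, 0 < W i j)
    {Rk : Fin p → Fin m → ℕ} {Ck : Fin p → Fin n → ℕ}
    (hRk : ∀ k i, 0 < Rk k i) (hCk : ∀ k j, 0 < Ck k j)
    (hRkN : ∀ k, ∑ i, Rk k i = N) (hCkN : ∀ k, ∑ j, Ck k j = N)
    {α : Fin p → ℝ} (hα : ∀ k, 0 ≤ α k) (hα1 : ∑ k, α k = 1)
    {R : Fin m → ℕ} {C : Fin n → ℕ} (hR : ∀ i, 0 < R i) (hC : ∀ j, 0 < C j)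
    (hRα : ∀ i, (R i : ℝ) = ∑ k, α k * Rk k i) (hCα : ∀ j, (C j : ℝ) = ∑ k, α k * Ck k j)
    {s : ℝ} (hs : s = (N : ℝ) / (n : ℝ)) :
    ∏ k, tableWeight (Rk k) (Ck k) W ^ α k ≤
      (N : ℝ) ^ N / N.factorial * (Real.Gamma (s + 1) ^ n / s ^ N) * tableWeight R C W := by
  have total : ∀ {l : ℕ} {B : Fin l → ℕ} {Bk : Fin p → Fin l → ℕ}, (∀ k, ∑ i, Bk k i = N) →
      (∀ i, (B i : ℝ) = ∑ k, α k * Bk k i) → ∑ i, B i = N := by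
    intro l B Bk hN hB
    have : ((∑ i, B i : ℕ) : ℝ) = N := by
      push_cast
      simp only [hB]
      rw [Finset.sum_comm]
      have : ∀ k, ∑ i, α k * (Bk k i:ℝ) = α k * N := fun k => by
        rw [← Finset.mul_sum, ← hN k]
        push_cast
        rfl
      simp only [this]
      rw [← Finset.sum_mul, hα1, one_mul]
    exact_mod_cast this
  have hRN := total hRkN hRα
  have hCN := total hCkN hCα
  have : Nonempty (Fin n) := ⟨⟨0, hn⟩⟩
  have np : (0:ℝ) < n := by exact_mod_cast hn
  have Np : (0:ℝ) < N := by
    rw [← hCN]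
    exact_mod_cast Finset.sum_pos (fun j _ => hC j) Finset.univ_nonempty
  have sp : 0 < s := by rw [hs]; positivity
  have gp : 0 < Real.Gamma (s + 1) := Real.Gamma_pos_of_pos (by linarith)
  have h1 : ∏ k, tableWeight (Rk k) (Ck k) W ^ α k ≤ capIntegral W R C := by
    refine le_trans (Finset.prod_le_prod (fun k _ => Real.rpow_nonneg
      (tableWeight_nonneg _ _ fun i j => (hW i j).le) _) fun k _ => ?_)
      (prod_capIntegral_rpow_le hn hW hRk hCk (fun k => (hRkN k).trans (hCkN k).symm) hα hα1 hR hC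
        (hRN.trans hCN.symm) hRα hCα)
    exact Real.rpow_le_rpow (tableWeight_nonneg _ _ fun i j => (hW i j).le)
      (tableWeight_le_capIntegral hn hW (hRk k) (hCk k) ((hRkN k).trans (hCkN k).symm)) (hα k)
  refine h1.trans ?_
  have h2 := capIntegral_le_tableWeight hn hW hR hC hRN hCN
  have h3 := pow_div_Gamma_pow_le_prod hn hC hCN hs
  have Φ := (capIntegral_pos hn hW hR hC (hRN.trans hCN.symm)).le
  set K := ∏ j, (C j:ℝ) ^ C j / (C j).factorial
  have pre : 0 ≤ (N : ℝ) ^ N / N.factorial * (Real.Gamma (s + 1) ^ n / s ^ N) := by positivity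
  refine le_trans ?_ (mul_le_mul_of_nonneg_left h2 pre)
  have e : (N : ℝ) ^ N / N.factorial * (Real.Gamma (s + 1) ^ n / s ^ N) *
      (capIntegral W R C * (N.factorial / (N:ℝ) ^ N * K)) =
      capIntegral W R C * (Real.Gamma (s + 1) ^ n * K / s ^ N) := by
    field_simp
  rw [e]
  exact le_mul_of_one_le_right Φ ((one_le_div (by positivity)).2 h3)

theorem prod_tableWeight_rpow_le {m n p N : ℕ} (hn : 0 < n)
    {W : Fin m → Fin n → ℝ} (hW : ∀ i j, 0 ≤ W i j)
    {Rk : Fin p → Fin m → ℕ} {Ck : Fin p → Fin n → ℕ}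
    (hRk : ∀ k i, 0 < Rk k i) (hCk : ∀ k j, 0 < Ck k j)
    (hRkN : ∀ k, ∑ i, Rk k i = N) (hCkN : ∀ k, ∑ j, Ck k j = N)
    {α : Fin p → ℝ} (hα : ∀ k, 0 ≤ α k) (hα1 : ∑ k, α k = 1)
    {R : Fin m → ℕ} {C : Fin n → ℕ} (hR : ∀ i, 0 < R i) (hC : ∀ j, 0 < C j)
    (hRα : ∀ i, (R i : ℝ) = ∑ k, α k * Rk k i) (hCα : ∀ j, (C j : ℝ) = ∑ k, α k * Ck k j)
    {s : ℝ} (hs : s = (N : ℝ) / (n : ℝ)) :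
    ∏ k, tableWeight (Rk k) (Ck k) W ^ α k ≤
      (N : ℝ) ^ N / N.factorial * (Real.Gamma (s + 1) ^ n / s ^ N) * tableWeight R C W := by
  have lim : Tendsto (fun ε : ℝ => fun i j => W i j + ε) (𝓝[>] 0) (𝓝 W) := by
    have : Tendsto (fun ε : ℝ => fun i j => W i j + ε) (𝓝[>] 0) (𝓝 fun i j => W i j + 0) :=
      (Continuous.tendsto (by fun_prop) 0).mono_left nhdsWithin_le_nhds
    simpa using this
  refine le_of_tendsto_of_tendsto (tendsto_finsetProd _ fun k _ =>
    (((continuous_tableWeight (Rk k) (Ck k)).tendsto W).comp lim).rpow_const (Or.inr (hα k)))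
    ((((continuous_tableWeight R C).tendsto W).comp lim).const_mul _) ?_
  filter_upwards [self_mem_nhdsWithin] with ε hε
  exact prod_tableWeight_rpow_le_of_pos hn
    (fun i j => add_pos_of_nonneg_of_pos (hW i j) (mem_Ioi.1 hε)) hRk hCk hRkN hCkN hα hα1 hR hC
    hRα hCα hs

end

theorem brunn_minkowski_contingency_cor2 {m n p N : ℕ}
    (hm : 0 < m) (hn : 0 < n)
    (W : Fin m → Fin n → ℝ) (hW : ∀ i j, 0 ≤ W i j)
    (Rk : Fin p → Fin m → ℕ) (Ck : Fin p → Fin n → ℕ)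
    (hRkpos : ∀ k i, 0 < Rk k i) (hCkpos : ∀ k j, 0 < Ck k j)
    (hRkN : ∀ k, ∑ i, Rk k i = N) (hCkN : ∀ k, ∑ j, Ck k j = N)
    (α : Fin p → ℝ) (hα : ∀ k, 0 ≤ α k) (hα1 : ∑ k, α k = 1)
    (R : Fin m → ℕ) (C : Fin n → ℕ)
    (hRpos : ∀ i, 0 < R i) (hCpos : ∀ j, 0 < C j)
    (hR : ∀ i, (R i : ℝ) = ∑ k, α k * Rk k i)
    (hC : ∀ j, (C j : ℝ) = ∑ k, α k * Ck k j)
    (a : ℕ) (ha : a = min m n) (s : ℝ) (hs : s = (N : ℝ) / (a : ℝ)) :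
    ((N : ℝ) ^ N / (Nat.factorial N : ℝ)) *
        (Real.Gamma (s + 1) ^ a / s ^ N) * tableWeight R C W ≥
      ∏ k, tableWeight (Rk k) (Ck k) W ^ (α k) := by
  rcases min_choice m n with h | h
  · rw [h] at ha
    subst ha
    have := prod_tableWeight_rpow_le hm (W := fun j i => W i j) (fun j i => hW i j) hCkpos hRkpos
      hCkN hRkN hα hα1 hCpos hRpos hC hR hs
    simpa only [tableWeight_transpose] using this
  · rw [h] at ha
    subst ha
    exact prod_tableWeight_rpow_le hn hW hRkpos hCkpos hRkN hCkN hα hα1 hRpos hCpos hR hC hs
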